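/- If p = (p0,p1,p2) ∈ [0,1)³ satisfies κ_△(p) = 0, then both P^△_p on the triangular lattice and P^⬡_{1−p} on the hexagonal lattice, where 1−p = (1−p0,1−p1,1−p2), have the box-crossing property. -/

import Mathlib

open MeasureTheory Set

set_option linter.unusedVariables false

namespace Perc

/-- Points of the plane. -/
abbrev Pt := ℝ × ℝ

/-- A lattice embedded in the plane, with edges indexed by `E`;
each edge is embedded as the segment between the two endpoints given by `ends`. -/
structure LatticeOn (E : Type) where
  ends : E → Pt × Pt

/-- Bond configurations. -/
abbrev Config (E : Type) := E → Bool

/-- `P` is the Bernoulli bond-percolation product measure in which edge `e`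
is open with probability `p e`, independently over edges. -/
def IsBernoulliProduct {E : Type} (p : E → ℝ) (P : Measure (Config E)) : Prop :=
  IsProbabilityMeasure P ∧
    ∀ (s : Finset E) (f : E → Bool),
      P {ω | ∀ e ∈ s, ω e = f e} =
        ∏ e ∈ s, ENNReal.ofReal (if f e then p e else 1 - p e)

/-- The union of the closed segments of the open edges. -/
def openEdgeSet {E : Type} (L : LatticeOn E) (ω : Config E) : Set Pt :=
  ⋃ e ∈ {e : E | ω e = true}, segment ℝ (L.ends e).1 (L.ends e).2

/-- There is an arc, contained in `S` and in the union of the open edges,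
with one endpoint in `A` and the other in `B`. -/
def CrossingIn {E : Type} (L : LatticeOn E) (ω : Config E) (S A B : Set Pt) : Prop :=
  ∃ γ : ℝ → Pt, ContinuousOn γ (Icc 0 1) ∧ γ 0 ∈ A ∧ γ 1 ∈ B ∧
    ∀ t ∈ Icc (0:ℝ) 1, γ t ∈ S ∩ openEdgeSet L ω

/-- Rotation of the plane by angle `θ`. -/
noncomputable def rot (θ : ℝ) (z : Pt) : Pt :=
  (Real.cos θ * z.1 - Real.sin θ * z.2, Real.sin θ * z.1 + Real.cos θ * z.2)

/-- `f` comprises a rotation and a translation. -/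
def IsRotTrans (f : Pt → Pt) : Prop := ∃ θ : ℝ, ∃ t : Pt, f = fun z => rot θ z + t

def stdRect (h l : ℝ) : Set Pt := {z | 0 ≤ z.1 ∧ z.1 ≤ h ∧ 0 ≤ z.2 ∧ z.2 ≤ l}
def leftSide (h l : ℝ) : Set Pt := {z | z.1 = 0 ∧ 0 ≤ z.2 ∧ z.2 ≤ l}
def rightSide (h l : ℝ) : Set Pt := {z | z.1 = h ∧ 0 ≤ z.2 ∧ z.2 ≤ l}
def bottomSide (h l : ℝ) : Set Pt := {z | z.2 = 0 ∧ 0 ≤ z.1 ∧ z.1 ≤ h}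
def topSide (h l : ℝ) : Set Pt := {z | z.2 = l ∧ 0 ≤ z.1 ∧ z.1 ≤ h}

/-- The box `f(stdRect h l)` (where `f` is a rotation plus translation) possesses
open crossings in both directions. -/
def HasBoxCrossings {E : Type} (L : LatticeOn E) (ω : Config E) (h l : ℝ) (f : Pt → Pt) : Prop :=
  CrossingIn L ω (f '' stdRect h l) (f '' leftSide h l) (f '' rightSide h l) ∧
  CrossingIn L ω (f '' stdRect h l) (f '' bottomSide h l) (f '' topSide h l)

/-- The box-crossing property: for every `α > 0` there is `δ > 0` such that every box
of size `αN × N` (any position and orientation) possesses open crossings with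
probability at least `δ`, for all large `N`. -/
def BoxCrossingProperty {E : Type} (L : LatticeOn E) (P : Measure (Config E)) : Prop :=
  ∀ α : ℝ, 0 < α → ∃ δ : ℝ, 0 < δ ∧ ∃ N₀ : ℕ, ∀ N : ℕ, N₀ ≤ N →
    ∀ f : Pt → Pt, IsRotTrans f →
      ENNReal.ofReal δ ≤ P {ω | HasBoxCrossings L ω (α * N) N f}

/-- Horizontal-crossing event of the box `[-m,m] × [0,n]`. -/
def Ch {E : Type} (L : LatticeOn E) (m n : ℝ) (ω : Config E) : Prop :=
  CrossingIn L ω {z | -m ≤ z.1 ∧ z.1 ≤ m ∧ 0 ≤ z.2 ∧ z.2 ≤ n}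
    {z | z.1 = -m ∧ 0 ≤ z.2 ∧ z.2 ≤ n} {z | z.1 = m ∧ 0 ≤ z.2 ∧ z.2 ≤ n}

/-- Vertical-crossing event of the box `[-m,m] × [0,n]`. -/
def Cv {E : Type} (L : LatticeOn E) (m n : ℝ) (ω : Config E) : Prop :=
  CrossingIn L ω {z | -m ≤ z.1 ∧ z.1 ≤ m ∧ 0 ≤ z.2 ∧ z.2 ≤ n}
    {z | z.2 = 0 ∧ -m ≤ z.1 ∧ z.1 ≤ m} {z | z.2 = n ∧ -m ≤ z.1 ∧ z.1 ≤ m}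

/-- `u` and `v` are the endpoints of some open edge. -/
def openAdj {E : Type} (L : LatticeOn E) (ω : Config E) (u v : Pt) : Prop :=
  ∃ e, ω e = true ∧ (L.ends e = (u, v) ∨ L.ends e = (v, u))

/-- `u` and `v` are joined by a path of open edges. -/
def openConn {E : Type} (L : LatticeOn E) (ω : Config E) : Pt → Pt → Prop :=
  Relation.ReflTransGen (openAdj L ω)

/-- The open cluster at `v`. -/
def cluster {E : Type} (L : LatticeOn E) (ω : Config E) (v : Pt) : Set Pt :=
  {u | openConn L ω v u}

/-- The vertex set of the lattice. -/
def vertexSet {E : Type} (L : LatticeOn E) : Set Pt :=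
  ⋃ e : E, {(L.ends e).1, (L.ends e).2}

/-- `v` is the endpoint of an infinite open self-avoiding path. -/
def ConnToInfinity {E : Type} (L : LatticeOn E) (ω : Config E) (v : Pt) : Prop :=
  ∃ γ : ℕ → Pt, γ 0 = v ∧ Function.Injective γ ∧ ∀ n, openAdj L ω (γ n) (γ (n + 1))

/-- Euclidean distance on the plane. -/
noncomputable def edist2 (u v : Pt) : ℝ := Real.sqrt ((u.1 - v.1) ^ 2 + (u.2 - v.2) ^ 2)

/-- `rad (C_v) ≥ r`, where `rad (C_v)` is the supremum of all `x` such that `C_v`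
meets the complement of the open Euclidean ball `v + S_x`. -/
def RadiusGE {E : Type} (L : LatticeOn E) (ω : Config E) (v : Pt) (r : ℝ) : Prop :=
  ∀ x : ℝ, x < r → ∃ u ∈ cluster L ω v, x ≤ edist2 v u

/-- `κ_□`. -/
def kappaS (a b : ℝ) : ℝ := a + b - 1
/-- `κ_△`. -/
def kappaT (a b c : ℝ) : ℝ := a + b + c - a * b * c - 1
/-- `κ_⬡`. -/
def kappaH (a b c : ℝ) : ℝ := -kappaT (1 - a) (1 - b) (1 - c)

/-- Edges of a square-type lattice: `(a, b, true)` is the `horizontal`-class edge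
at `(a,b)` and `(a, b, false)` the `vertical`-class edge at `(a,b)`. -/
abbrev SqE := ℤ × ℤ × Bool
/-- Edges of the triangular lattice (also indexing the dual hexagonal edges):
`(a, b, i)` with `i = 0` horizontal, `i = 1` the right edge of an upwards pointing
triangle, `i = 2` the left edge of an upwards pointing triangle, in row `b`. -/
abbrev TriE := ℤ × ℤ × Fin 3

/-- The unit square lattice, with vertex set `ℤ²`. -/
noncomputable def sqLattice : LatticeOn SqE :=
  ⟨fun e =>
    if e.2.2 then (((e.1 : ℝ), (e.2.1 : ℝ)), ((e.1 : ℝ) + 1, (e.2.1 : ℝ)))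
    else (((e.1 : ℝ), (e.2.1 : ℝ)), ((e.1 : ℝ), (e.2.1 : ℝ) + 1))⟩

/-- The dual of the unit square lattice (shifted by `(1/2, 1/2)`), with each dual edge
indexed by the primal edge it crosses. -/
noncomputable def sqDualLattice : LatticeOn SqE :=
  ⟨fun e =>
    if e.2.2 then
      (((e.1 : ℝ) + 1 / 2, (e.2.1 : ℝ) - 1 / 2), ((e.1 : ℝ) + 1 / 2, (e.2.1 : ℝ) + 1 / 2))
    else
      (((e.1 : ℝ) - 1 / 2, (e.2.1 : ℝ) + 1 / 2), ((e.1 : ℝ) + 1 / 2, (e.2.1 : ℝ) + 1 / 2))⟩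

/-- Vertices of the triangular lattice (equilateral triangles of side `√3`,
one family of edges horizontal). -/
noncomputable def tv (a b : ℤ) : Pt :=
  (Real.sqrt 3 * ((a : ℝ) + (b : ℝ) / 2), 3 / 2 * (b : ℝ))

/-- The triangular lattice. -/
noncomputable def triLattice : LatticeOn TriE :=
  ⟨fun e =>
    if e.2.2 = 0 then (tv e.1 e.2.1, tv (e.1 + 1) e.2.1)
    else if e.2.2 = 1 then (tv (e.1 + 1) e.2.1, tv e.1 (e.2.1 + 1))
    else (tv e.1 e.2.1, tv e.1 (e.2.1 + 1))⟩

/-- Circumcentre of the upwards pointing triangle with base vertex `tv a b`. -/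
noncomputable def hup (a b : ℤ) : Pt :=
  (Real.sqrt 3 * ((a : ℝ) + ((b : ℝ) + 1) / 2), 3 / 2 * (b : ℝ) + 1 / 2)

/-- Circumcentre of the downwards pointing triangle below the edge `tv a b – tv (a+1) b`. -/
noncomputable def hdown (a b : ℤ) : Pt :=
  (Real.sqrt 3 * ((a : ℝ) + ((b : ℝ) + 1) / 2), 3 / 2 * (b : ℝ) - 1 / 2)

/-- The hexagonal lattice, the planar dual of `triLattice`, with vertices at the
circumcentres of the triangles; each hexagonal edge is indexed by the triangular
edge it crosses. -/
noncomputable def hexLattice : LatticeOn TriE :=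
  ⟨fun e =>
    if e.2.2 = 0 then (hdown e.1 e.2.1, hup e.1 e.2.1)
    else if e.2.2 = 1 then (hup e.1 e.2.1, hdown e.1 (e.2.1 + 1))
    else (hup e.1 e.2.1, hdown (e.1 - 1) (e.2.1 + 1))⟩

/-- The square lattice with horizontal edges of length `√3` and vertical edges of
length `1` (as in the mixed lattices). -/
noncomputable def sqStretch : LatticeOn SqE :=
  ⟨fun e =>
    if e.2.2 then
      ((Real.sqrt 3 * (e.1 : ℝ), (e.2.1 : ℝ)), (Real.sqrt 3 * ((e.1 : ℝ) + 1), (e.2.1 : ℝ)))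
    else ((Real.sqrt 3 * (e.1 : ℝ), (e.2.1 : ℝ)), (Real.sqrt 3 * (e.1 : ℝ), (e.2.1 : ℝ) + 1))⟩

/-- Vertices of the square lattice rotated by `π/4`. -/
noncomputable def rv (a b : ℤ) : Pt :=
  (((a : ℝ) - (b : ℝ)) / Real.sqrt 2, ((a : ℝ) + (b : ℝ)) / Real.sqrt 2)

/-- The square lattice rotated by `π/4`: edges `(a,b,true)` are inclined at angle `π/4`
and edges `(a,b,false)` at angle `3π/4`; the row (height) of such an edge is `a + b`. -/
noncomputable def rsqLattice : LatticeOn SqE :=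
  ⟨fun e =>
    if e.2.2 then (rv e.1 e.2.1, rv (e.1 + 1) e.2.1)
    else (rv e.1 e.2.1, rv e.1 (e.2.1 + 1))⟩

/-- Inhomogeneous intensities on the square lattice: `ph` on horizontal edges,
`pv` on vertical ones. -/
def sqInt (ph pv : ℝ) : SqE → ℝ := fun e => if e.2.2 then ph else pv

/-- Inhomogeneous intensities on the triangular (or hexagonal) lattice:
`p0` on class-0 edges, `p1` on class-1, `p2` on class-2. -/
def triInt (p0 p1 p2 : ℝ) : TriE → ℝ := fun e => ![p0, p1, p2] e.2.2

/-- Highly inhomogeneous intensities on the triangular (or hexagonal) lattice: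
`p` on horizontal-class edges, `q n` on right edges of upwards pointing triangles at
height `n`, `q' n` on left edges of upwards pointing triangles at height `n`. -/
def triHI (p : ℝ) (q q' : ℤ → ℝ) : TriE → ℝ := fun e =>
  if e.2.2 = 0 then p else if e.2.2 = 1 then q e.2.1 else q' e.2.1

/-- Highly inhomogeneous intensities on the rotated square lattice: `q n` on edges
inclined at `π/4` at height `n`, `q' n` on edges inclined at `3π/4` at height `n`. -/
def rsqHI (q q' : ℤ → ℝ) : SqE → ℝ := fun e =>
  if e.2.2 then q (e.1 + e.2.1) else q' (e.1 + e.2.1)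

/-! ### Bernoulli product measures -/

section Bernoulli

/-- Truncation to the unit interval. -/
noncomputable def clamp (x : ℝ) : ℝ := max 0 (min x 1)

lemma clamp_nonneg (x : ℝ) : 0 ≤ clamp x := le_max_left _ _
lemma clamp_le_one (x : ℝ) : clamp x ≤ 1 := max_le zero_le_one (min_le_right _ _)
lemma clamp_of_mem {x : ℝ} (h0 : 0 ≤ x) (h1 : x ≤ 1) : clamp x = x := by
  simp [clamp, h0, h1]

/-- The law of a single edge of intensity `x`. -/
noncomputable def bit (x : ℝ) : Measure Bool :=
  ENNReal.ofReal (clamp x) • Measure.dirac true + ENNReal.ofReal (1 - clamp x) • Measure.dirac false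

instance (x : ℝ) : IsProbabilityMeasure (bit x) := ⟨by
  simp only [bit, Measure.coe_add, Measure.coe_smul, Pi.add_apply, Pi.smul_apply, measure_univ,
    smul_eq_mul, mul_one]
  rw [← ENNReal.ofReal_add (clamp_nonneg x) (by linarith [clamp_le_one x])]
  simp⟩

variable {E : Type}

/-- The Bernoulli product measure with intensities `p` (truncated to the unit interval). -/
noncomputable def bern (p : E → ℝ) : Measure (Config E) := Measure.infinitePi fun e => bit (p e)

instance (p : E → ℝ) : IsProbabilityMeasure (bern p) := by unfold bern; infer_instance

lemma IsBernoulliProduct.eq_bern {p : E → ℝ} {P : Measure (Config E)}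
    (hP : IsBernoulliProduct p P) (hp : ∀ e, 0 ≤ p e ∧ p e ≤ 1) : P = bern p := by
  classical
  obtain ⟨h1, h2⟩ := hP
  have key : ∀ s : Finset E, P.map s.restrict = Measure.pi (fun i : s => bit (p i)) := by
    intro s
    have : IsProbabilityMeasure (P.map s.restrict) :=
      Measure.isProbabilityMeasure_map (by fun_prop)
    refine Measure.ext_of_singleton fun f => ?_
    rw [Measure.map_apply (Finset.measurable_restrict s) (measurableSet_singleton f),
      Measure.pi_singleton]
    have := h2 s (fun e => if h : e ∈ s then f ⟨e, h⟩ else true)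
    have e1 : s.restrict ⁻¹' ({f} : Set (s → Bool)) =
        {ω : E → Bool | ∀ e ∈ s, ω e = (if h : e ∈ s then f ⟨e, h⟩ else true)} := by
      ext ω
      simp only [mem_preimage, mem_singleton_iff, mem_ofPred_eq, funext_iff]
      constructor
      · intro h e he; simp [he, ← h ⟨e, he⟩]
      · rintro h ⟨e, he⟩; have := h e he; simpa [he] using this
    rw [e1, this, ← Finset.prod_coe_sort]
    refine Finset.prod_congr rfl fun e _ => ?_
    have hc := clamp_of_mem (hp e).1 (hp e).2
    rcases h : f e <;> simp [h, bit, hc]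
  have h3 : IsProjectiveLimit P fun s : Finset E => Measure.pi fun i : s => bit (p i.1) := key
  exact h3.unique (Measure.isProjectiveLimit_infinitePi _)

open Classical in
/-- Averaging over the state of one edge. -/
lemma bern_cond [DecidableEq E] (p : E → ℝ) (e : E) {A : Set (Config E)} (hA : MeasurableSet A) :
    (bern p).real A = clamp (p e) * (bern p).real {ω | Function.update ω e true ∈ A} +
      (1 - clamp (p e)) * (bern p).real {ω | Function.update ω e false ∈ A} := by
  have hm : ∀ b : Bool, Measurable (fun ω : E → Bool => Function.update ω e b) := by
    intro b; fun_prop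
  have key : bern p = ENNReal.ofReal (clamp (p e)) • (bern p).map (fun ω => Function.update ω e true)
      + ENNReal.ofReal (1 - clamp (p e)) • (bern p).map (fun ω => Function.update ω e false) := by
    symm
    refine Measure.eq_infinitePi _ fun s t ht => ?_
    have hpi : MeasurableSet ((s : Set E).pi t) := .pi s.countable_toSet fun _ _ => ht _
    simp only [Measure.coe_add, Measure.coe_smul, Pi.add_apply, Pi.smul_apply, smul_eq_mul]
    rw [Measure.map_apply (hm _) hpi, Measure.map_apply (hm _) hpi]
    by_cases he : e ∈ s
    · have h0 : ∀ b : Bool, (fun ω : E → Bool => Function.update ω e b) ⁻¹' ((s : Set E).pi t) =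
          if b ∈ t e then ((s.erase e : Finset E) : Set E).pi t else ∅ := by
        intro b
        ext ω
        simp only [mem_preimage, Set.mem_pi]
        split_ifs with hb
        · simp only [Finset.mem_coe, Set.mem_pi, Finset.mem_erase]
          constructor
          · intro h x hx; have := h x hx.2; rwa [Function.update_of_ne hx.1] at this
          · intro h x hx
            by_cases hxe : x = e
            · subst hxe; simpa using hb
            · rw [Function.update_of_ne hxe]; exact h x ⟨hxe, hx⟩
        · simp only [mem_empty_iff_false, iff_false, not_forall]
          exact ⟨e, he, by simpa using hb⟩
      rw [h0, h0, ← Finset.mul_prod_erase s _ he]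
      have h1 : bern p (((s.erase e : Finset E) : Set E).pi t) =
          ∏ x ∈ s.erase e, bit (p x) (t x) :=
        Measure.infinitePi_pi _ (fun i _ => ht i)
      have hbit : bit (p e) (t e) = ENNReal.ofReal (clamp (p e)) * (if true ∈ t e then 1 else 0) +
          ENNReal.ofReal (1 - clamp (p e)) * (if false ∈ t e then 1 else 0) := by
        simp only [bit, Measure.coe_add, Measure.coe_smul, Pi.add_apply, Pi.smul_apply, smul_eq_mul,
          Measure.dirac_apply, indicator, Pi.one_apply]
      rw [hbit, ← h1]
      split_ifs <;> simp [add_mul]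
    · have h0 : ∀ b : Bool, (fun ω : E → Bool => Function.update ω e b) ⁻¹' ((s : Set E).pi t) =
          (s : Set E).pi t := by
        intro b
        ext ω
        simp only [mem_preimage, Set.mem_pi]
        refine forall₂_congr fun x hx => ?_
        rw [Function.update_of_ne (by rintro rfl; exact he hx)]
      rw [h0, h0, ← add_mul, ← ENNReal.ofReal_add (clamp_nonneg _) (by linarith [clamp_le_one (p e)])]
      simp only [add_sub_cancel, ENNReal.ofReal_one, one_mul]
      exact Measure.infinitePi_pi _ (fun i _ => ht i)
  conv_lhs => rw [key]
  rw [measureReal_def, Measure.coe_add, Pi.add_apply, Measure.coe_smul, Measure.coe_smul,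
    Pi.smul_apply, Pi.smul_apply, Measure.map_apply (hm _) hA, Measure.map_apply (hm _) hA,
    smul_eq_mul, smul_eq_mul, ENNReal.toReal_add (by finiteness) (by finiteness),
    ENNReal.toReal_mul, ENNReal.toReal_mul, ENNReal.toReal_ofReal (clamp_nonneg _),
    ENNReal.toReal_ofReal (by linarith [clamp_le_one (p e)])]
  rfl

/-- The event `A` is determined by the states of the edges in `s`. -/
def Dep (s : Set E) (A : Set (Config E)) : Prop :=
  ∀ ω ω' : Config E, (∀ e ∈ s, ω e = ω' e) → ω ∈ A → ω' ∈ A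

/-- The event `A` is determined by finitely many edges. -/
def Fd (A : Set (Config E)) : Prop := ∃ s : Finset E, Dep (s : Set E) A

lemma Dep.mono {s t : Set E} {A : Set (Config E)} (h : Dep s A) (hst : s ⊆ t) : Dep t A :=
  fun ω ω' hw => h ω ω' fun e he => hw e (hst he)

lemma Dep.inter {s : Set E} {A B : Set (Config E)} (h : Dep s A) (h' : Dep s B) : Dep s (A ∩ B) :=
  fun ω ω' hw hA => ⟨h ω ω' hw hA.1, h' ω ω' hw hA.2⟩

lemma Dep.fd {s : Set E} {A : Set (Config E)} (h : Dep s A) (hs : s.Finite) : Fd A :=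
  ⟨hs.toFinset, h.mono (by simp)⟩

lemma Fd.inter {A B : Set (Config E)} (h : Fd A) (h' : Fd B) : Fd (A ∩ B) := by
  classical
  obtain ⟨s, hs⟩ := h; obtain ⟨t, ht⟩ := h'
  exact ⟨s ∪ t, (hs.mono (by simp)).inter (ht.mono (by simp))⟩

lemma Fd.measurableSet {A : Set (Config E)} (h : Fd A) : MeasurableSet A := by
  classical
  obtain ⟨s, hs⟩ := h
  have : A = s.restrict ⁻¹' (s.restrict '' A) := by
    ext ω
    refine ⟨fun h => ⟨ω, h, rfl⟩, ?_⟩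
    rintro ⟨ω', h, he⟩
    exact hs ω' ω (fun e hes => congrFun he ⟨e, hes⟩) h
  rw [this]
  exact Finset.measurable_restrict s (Set.toFinite _).measurableSet

lemma Dep.update [DecidableEq E] {s : Finset E} {e : E} {A : Set (Config E)}
    (h : Dep ((insert e s : Finset E) : Set E) A) (b : Bool) :
    Dep (s : Set E) {ω | Function.update ω e b ∈ A} := by
  intro ω ω' hw hA
  refine h _ _ (fun x hx => ?_) hA
  by_cases hxe : x = e
  · subst hxe; simp
  · rw [Function.update_of_ne hxe, Function.update_of_ne hxe]
    exact hw x (by simpa [hxe] using hx)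

lemma Dep.empty_cases {A : Set (Config E)} (h : Dep ((∅ : Finset E) : Set E) A) :
    A = ∅ ∨ A = univ := by
  rcases A.eq_empty_or_nonempty with h' | ⟨ω, hω⟩
  · exact Or.inl h'
  · exact Or.inr (eq_univ_of_forall fun ω' => h ω ω' (by simp) hω)

/-- Two Bernoulli measures agree on events determined by edges where the intensities agree. -/
lemma bern_congr {p q : E → ℝ} (s : Finset E) (hpq : ∀ e ∈ s, p e = q e) {A : Set (Config E)}
    (hA : Dep (s : Set E) A) : (bern p).real A = (bern q).real A := by
  classical
  induction s using Finset.induction_on generalizing A with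
  | empty => rcases hA.empty_cases with rfl | rfl <;> simp
  | insert e s he ih =>
    have hm := Fd.measurableSet ⟨_, hA⟩
    rw [bern_cond p e hm, bern_cond q e hm, hpq e (by simp),
      ih (fun x hx => hpq x (by simp [hx])) (hA.update true),
      ih (fun x hx => hpq x (by simp [hx])) (hA.update false)]

/-- Independence of events determined by disjoint sets of edges. -/
lemma bern_indep {p : E → ℝ} (s : Finset E) {A B : Set (Config E)}
    (hA : Dep (s : Set E) A) (hB : Dep ((s : Set E)ᶜ) B) (hBm : MeasurableSet B) :
    (bern p).real (A ∩ B) = (bern p).real A * (bern p).real B := by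
  classical
  induction s using Finset.induction_on generalizing A with
  | empty => rcases hA.empty_cases with rfl | rfl <;> simp
  | insert e s he ih =>
    have hm := Fd.measurableSet ⟨_, hA⟩
    have hu : ∀ b, {ω | Function.update ω e b ∈ A ∩ B} = {ω | Function.update ω e b ∈ A} ∩ B := by
      intro b; ext ω
      have : Function.update ω e b ∈ B ↔ ω ∈ B := by
        constructor <;> refine hB _ _ fun x hx => ?_ <;>
          rw [Function.update_of_ne (by rintro rfl; simp at hx)]
      simp [this]
    have hB' : Dep ((s : Set E)ᶜ) B := hB.mono (by simp)
    rw [bern_cond p e (hm.inter hBm), bern_cond p e hm, hu, hu, ih (hA.update _) hB',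
      ih (hA.update _) hB']
    ring

/-- The Harris–FKG inequality. -/
lemma bern_fkg (p : E → ℝ) {A B : Set (Config E)} (hA : IsUpperSet A) (hB : IsUpperSet B)
    (hAf : Fd A) (hBf : Fd B) :
    (bern p).real A * (bern p).real B ≤ (bern p).real (A ∩ B) := by
  classical
  obtain ⟨s₁, h₁⟩ := hAf
  obtain ⟨s₂, h₂⟩ := hBf
  obtain ⟨s, hAs, hBs⟩ : ∃ s : Finset E, Dep (s : Set E) A ∧ Dep (s : Set E) B :=
    ⟨s₁ ∪ s₂, h₁.mono (by simp), h₂.mono (by simp)⟩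
  clear h₁ h₂
  induction s using Finset.induction_on generalizing A B with
  | empty => rcases hAs.empty_cases with rfl | rfl <;> simp
  | insert e s he ih =>
    have hAm := Fd.measurableSet ⟨_, hAs⟩
    have hBm := Fd.measurableSet ⟨_, hBs⟩
    have up : ∀ {C : Set (Config E)}, IsUpperSet C → ∀ b,
        IsUpperSet {ω | Function.update ω e b ∈ C} := by
      intro C hC b ω ω' hw h
      refine hC (fun x => ?_) h
      by_cases hx : x = e
      · subst hx; simp
      · simpa [Function.update_of_ne hx] using hw x
    have le : ∀ {C : Set (Config E)}, IsUpperSet C →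
        (bern p).real {ω | Function.update ω e false ∈ C} ≤
          (bern p).real {ω | Function.update ω e true ∈ C} := by
      intro C hC
      refine measureReal_mono (fun ω h => hC (fun x => ?_) h)
      by_cases hx : x = e
      · subst hx; simp
      · simp [Function.update_of_ne hx]
    have i1 := ih (up hA true) (up hB true) (hAs.update true) (hBs.update true)
    have i0 := ih (up hA false) (up hB false) (hAs.update false) (hBs.update false)
    rw [bern_cond p e (hAm.inter hBm), bern_cond p e hAm, bern_cond p e hBm]
    have hc0 := clamp_nonneg (p e)
    have hc1 := clamp_le_one (p e)
    have la := le hA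
    have lb := le hB
    simp only [mem_inter_iff, ofPred_and] at i1 i0 ⊢
    generalize clamp (p e) = c at *
    nlinarith [mul_le_mul_of_nonneg_left i1 hc0,
      mul_le_mul_of_nonneg_left i0 (sub_nonneg.2 hc1),
      mul_nonneg (mul_nonneg hc0 (sub_nonneg.2 hc1)) (mul_nonneg (sub_nonneg.2 la) (sub_nonneg.2 lb))]

lemma measurable_relabel {E' : Type} (σ : E' → E) :
    Measurable (fun ω : Config E => (fun e => ω (σ e) : Config E')) := by fun_prop

/-- Relabelling edges. -/
lemma bern_relabel {E' : Type} (p : E → ℝ) (σ : E' → E) (hσ : Function.Injective σ)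
    {A : Set (Config E')} (hA : MeasurableSet A) :
    (bern p).real {ω | (fun e => ω (σ e)) ∈ A} = (bern fun e => p (σ e)).real A := by
  have : (bern p).map (fun ω e => ω (σ e)) = bern fun e => p (σ e) :=
    Measure.map_infinitePi_infinitePi_of_inj hσ
  rw [← this, measureReal_def, measureReal_def, Measure.map_apply (measurable_relabel σ) hA]
  rfl

end Bernoulli

/-! ### Local transformations and the star–triangle relation -/

section Blocks

variable {E J : Type}

/-- Apply the maps `F j` in each block `t (j, ·)` of edges. -/
def blockMap (t : J × Fin 3 ≃ E) (F : J → (Fin 3 → Bool) → (Fin 3 → Bool)) (ω : Config E) :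
    Config E := fun e => F (t.symm e).1 (fun k => ω (t ((t.symm e).1, k))) (t.symm e).2

lemma blockMap_apply (t : J × Fin 3 ≃ E) (F : J → (Fin 3 → Bool) → (Fin 3 → Bool)) (ω : Config E)
    (j : J) (k : Fin 3) : blockMap t F ω (t (j, k)) = F j (fun k => ω (t (j, k))) k := by
  simp [blockMap]

lemma measurable_blockMap (t : J × Fin 3 ≃ E) (F : J → (Fin 3 → Bool) → (Fin 3 → Bool)) :
    Measurable (blockMap t F) := by
  refine measurable_pi_lambda _ fun e => ?_
  have h : Measurable fun ω : Config E => fun k => ω (t ((t.symm e).1, k)) := by fun_prop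
  exact (measurable_of_finite fun x : Fin 3 → Bool => F (t.symm e).1 x (t.symm e).2).comp h

lemma map_blockMap (t : J × Fin 3 ≃ E) (F : J → (Fin 3 → Bool) → (Fin 3 → Bool)) (p : E → ℝ) :
    (bern p).map (blockMap t F) =
      (Measure.infinitePi fun j => (bern fun k => p (t (j, k))).map (F j)).map
        (fun y e => y (t.symm e).1 (t.symm e).2) := by
  have hF : ∀ j, Measurable (F j) := fun j => measurable_of_finite _
  have h1 : (bern p).map (fun ω e => ω (t e)) = bern fun e => p (t e) :=
    Measure.map_infinitePi_infinitePi_of_inj t.injective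
  have h2 : (bern fun e => p (t e)).map (MeasurableEquiv.curry J (Fin 3) Bool) =
      Measure.infinitePi fun j => bern fun k => p (t (j, k)) :=
    Measure.infinitePi_map_curry (fun j k => bit (p (t (j, k))))
  rw [← Measure.infinitePi_map_pi _ hF, ← h2, ← h1, Measure.map_map (by fun_prop) (by fun_prop),
    Measure.map_map, Measure.map_map]
  · rfl
  all_goals first
    | exact measurable_pi_lambda _ fun j => (hF j).comp (measurable_pi_apply j)
    | exact measurable_pi_lambda _ fun e => by fun_prop

/-- If two families of local maps have the same laws in every block, the images of the
configurations have the same law. -/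
lemma bern_blockMap_eq (t : J × Fin 3 ≃ E) (F F' : J → (Fin 3 → Bool) → (Fin 3 → Bool))
    (p p' : E → ℝ)
    (h : ∀ j y, (bern fun k => p (t (j, k))).real {x | F j x = y} =
      (bern fun k => p' (t (j, k))).real {x | F' j x = y})
    {A : Set (Config E)} (hA : MeasurableSet A) :
    (bern p).real {ω | blockMap t F ω ∈ A} = (bern p').real {ω | blockMap t F' ω ∈ A} := by
  have hF : ∀ j, Measurable (F j) := fun j => measurable_of_finite _
  have hF' : ∀ j, Measurable (F' j) := fun j => measurable_of_finite _
  have key : ∀ j, (bern fun k => p (t (j, k))).map (F j) =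
      (bern fun k => p' (t (j, k))).map (F' j) := by
    intro j
    have : IsProbabilityMeasure ((bern fun k => p (t (j, k))).map (F j)) :=
      Measure.isProbabilityMeasure_map (hF j).aemeasurable
    refine Measure.ext_of_singleton fun y => ?_
    rw [Measure.map_apply (hF j) (measurableSet_singleton y),
      Measure.map_apply (hF' j) (measurableSet_singleton y)]
    exact (ENNReal.toReal_eq_toReal_iff' (by finiteness) (by finiteness)).1 (h j y)
  have := congrArg (fun μ => (μ A).toReal) ((map_blockMap t F p).trans (by
    simp_rw [key]; exact (map_blockMap t F' p').symm))
  simp only [Measure.map_apply (measurable_blockMap t _) hA] at this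
  exact this

/-- The law of three independent edges. -/
lemma bern_three (r : Fin 3 → ℝ) (hr : ∀ k, 0 ≤ r k ∧ r k ≤ 1) (P : (Fin 3 → Bool) → Prop)
    [DecidablePred P] :
    (bern r).real {x | P x} =
      r 0 * (r 1 * (r 2 * (if P ![true, true, true] then 1 else 0) +
        (1 - r 2) * (if P ![true, true, false] then 1 else 0)) +
      (1 - r 1) * (r 2 * (if P ![true, false, true] then 1 else 0) +
        (1 - r 2) * (if P ![true, false, false] then 1 else 0))) +
      (1 - r 0) * (r 1 * (r 2 * (if P ![false, true, true] then 1 else 0) +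
        (1 - r 2) * (if P ![false, true, false] then 1 else 0)) +
      (1 - r 1) * (r 2 * (if P ![false, false, true] then 1 else 0) +
        (1 - r 2) * (if P ![false, false, false] then 1 else 0))) := by
  have hm : ∀ A : Set (Fin 3 → Bool), MeasurableSet A := fun A => A.toFinite.measurableSet
  have hc : ∀ k, clamp (r k) = r k := fun k => clamp_of_mem (hr k).1 (hr k).2
  have hv : ∀ (x : Fin 3 → Bool) a b c, Function.update (Function.update (Function.update x 2 c) 1 b)
      0 a = ![a, b, c] := by
    intro x a b c; ext k; fin_cases k <;> simp
  have hq : ∀ (Q : Prop) [Decidable Q], (bern r).real {x | Q} = if Q then 1 else 0 := by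
    intro Q _; split_ifs with h <;> simp [h]
  have e2 : ∀ a b, (bern r).real {x | P (Function.update (Function.update x 1 b) 0 a)} =
      r 2 * (if P ![a, b, true] then 1 else 0) + (1 - r 2) * (if P ![a, b, false] then 1 else 0) := by
    intro a b
    rw [bern_cond r 2 (hm _)]
    simp only [mem_ofPred_eq, hv, hq, hc]
  have e1 : ∀ a, (bern r).real {x | P (Function.update x 0 a)} = _ :=
    fun a => bern_cond r 1 (hm _)
  rw [bern_cond r 0 (hm _)]
  simp only [mem_ofPred_eq, e1, e2, hc]

/-- Closure of a set of edges of a triangle under connectivity. -/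
def cl (x : Fin 3 → Bool) (k : Fin 3) : Bool := x k || (x (k + 1) && x (k + 2))

/-- Connections between the endpoints of a star; leg `k` is opposite to the edge `k`. -/
def st (x : Fin 3 → Bool) (k : Fin 3) : Bool := x (k + 1) && x (k + 2)

/-- The star–triangle relation. -/
lemma star_triangle (r : Fin 3 → ℝ) (hr : ∀ k, 0 ≤ r k ∧ r k ≤ 1)
    (hκ : kappaT (r 0) (r 1) (r 2) = 0) (y : Fin 3 → Bool) :
    (bern r).real {x | cl x = y} = (bern fun k => 1 - r k).real {x | st x = y} := by
  rw [bern_three r hr, bern_three (fun k => 1 - r k)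
    (fun k => ⟨by linarith [(hr k).2], by linarith [(hr k).1]⟩)]
  have hy : y = ![y 0, y 1, y 2] := by ext k; fin_cases k <;> rfl
  have h0 : ∀ a b c, cl ![a, b, c] = ![a || (b && c), b || (c && a), c || (a && b)] := by
    intro a b c; ext k; fin_cases k <;> rfl
  have h1 : ∀ a b c, st ![a, b, c] = ![b && c, c && a, a && b] := by
    intro a b c; ext k; fin_cases k <;> rfl
  have h2 : ∀ a b c a' b' c' : Bool, (![a, b, c] = ![a', b', c']) ↔ (a = a' ∧ b = b' ∧ c = c') := by
    decide
  unfold kappaT at hκ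
  rw [hy]
  simp only [h0, h1, h2]
  rcases y 0 <;> rcases y 1 <;> rcases y 2 <;> simp <;> linarith

end Blocks

/-! ### Open connections in abstract graphs -/

section Graph

variable {E V : Type}

/-- One step along an open edge inside `R`. -/
def Step (g : E → V × V) (ω : Config E) (R : Set V) (u v : V) : Prop :=
  u ∈ R ∧ v ∈ R ∧ ∃ e, ω e = true ∧ (g e = (u, v) ∨ g e = (v, u))

/-- Reachability by open edges inside `R`. -/
def Rch (g : E → V × V) (ω : Config E) (R : Set V) : V → V → Prop :=
  Relation.ReflTransGen (Step g ω R)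

/-- `A` is connected to `B` by open edges inside `R`. -/
def Conn (g : E → V × V) (ω : Config E) (R A B : Set V) : Prop :=
  ∃ u ∈ A, ∃ v ∈ B, u ∈ R ∧ Rch g ω R u v

variable {g : E → V × V} {ω ω' : Config E} {R R' A A' B B' : Set V} {u v w : V}

lemma Step.symm (h : Step g ω R u v) : Step g ω R v u :=
  ⟨h.2.1, h.1, h.2.2.imp fun _ he => ⟨he.1, he.2.symm⟩⟩

lemma Step.mono (hω : ω ≤ ω') (hR : R ⊆ R') (h : Step g ω R u v) : Step g ω' R' u v :=
  ⟨hR h.1, hR h.2.1, h.2.2.imp fun e he => ⟨Bool.eq_true_of_true_le (by have := hω e; rwa [he.1] at this),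
    he.2⟩⟩

lemma Rch.refl : Rch g ω R u u := Relation.ReflTransGen.refl

lemma Step.rch (h : Step g ω R u v) : Rch g ω R u v := Relation.ReflTransGen.single h

lemma Rch.trans (h : Rch g ω R u v) (h' : Rch g ω R v w) : Rch g ω R u w :=
  Relation.ReflTransGen.trans h h'

lemma Rch.symm (h : Rch g ω R u v) : Rch g ω R v u := by
  induction h with
  | refl => exact Rch.refl
  | tail _ h ih => exact h.symm.rch.trans ih

lemma Rch.mono (hω : ω ≤ ω') (hR : R ⊆ R') (h : Rch g ω R u v) : Rch g ω' R' u v :=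
  Relation.ReflTransGen.mono (fun _ _ => Step.mono hω hR) _ _ h

lemma Rch.mem (h : Rch g ω R u v) (hu : u ∈ R) : v ∈ R := by
  induction h with
  | refl => exact hu
  | tail _ h _ => exact h.2.1

/-- Induction along a path, from the start. -/
lemma Rch.induct {P : V → Prop} (h : Rch g ω R u v) (h0 : P u)
    (hs : ∀ x y, Rch g ω R u x → Step g ω R x y → P x → P y) : P v := by
  induction h with
  | refl => exact h0
  | tail h h' ih => exact hs _ _ h h' ih

lemma Rch.map {E' V' : Type} {g' : E' → V' × V'} {ω' : Config E'} {R' : Set V'} (f : V → V')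
    (hf : ∀ x y, Step g ω R x y → Rch g' ω' R' (f x) (f y)) (h : Rch g ω R u v) :
    Rch g' ω' R' (f u) (f v) :=
  h.induct (P := fun x => Rch g' ω' R' (f u) (f x)) Rch.refl
    fun x y _ hxy hx => hx.trans (hf x y hxy)

lemma Conn.mono (hω : ω ≤ ω') (hR : R ⊆ R') (hA : A ⊆ A') (hB : B ⊆ B') (h : Conn g ω R A B) :
    Conn g ω' R' A' B' := by
  obtain ⟨u, hu, v, hv, hR', h⟩ := h
  exact ⟨u, hA hu, v, hB hv, hR hR', h.mono hω hR⟩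

lemma Conn.symm (h : Conn g ω R A B) : Conn g ω R B A := by
  obtain ⟨u, hu, v, hv, hR, h⟩ := h
  exact ⟨v, hv, u, hu, h.mem hR, h.symm⟩

lemma isUpperSet_conn (g : E → V × V) (R A B : Set V) : IsUpperSet {ω | Conn g ω R A B} :=
  fun _ _ h hc => hc.mono h subset_rfl subset_rfl subset_rfl

/-- The edges with both endpoints in `R`. -/
def inner (g : E → V × V) (R : Set V) : Set E := {e | (g e).1 ∈ R ∧ (g e).2 ∈ R}

lemma Step.congr (h : ∀ e ∈ inner g R, ω e = ω' e) (hs : Step g ω R u v) : Step g ω' R u v := by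
  obtain ⟨hu, hv, e, he, hg⟩ := hs
  refine ⟨hu, hv, e, ?_, hg⟩
  rw [← h e, he]
  rcases hg with hg | hg <;> simp [inner, hg, hu, hv]

lemma Rch.congr (h : ∀ e ∈ inner g R, ω e = ω' e) (hs : Rch g ω R u v) : Rch g ω' R u v :=
  Relation.ReflTransGen.mono (fun _ _ => Step.congr h) _ _ hs

lemma dep_conn (g : E → V × V) (R A B : Set V) : Dep (inner g R) {ω | Conn g ω R A B} := by
  rintro ω ω' h ⟨u, hu, v, hv, hR, hs⟩
  exact ⟨u, hu, v, hv, hR, hs.congr h⟩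

/-- A path from height at most `α` to height at least `α` contains a final piece above `α`. -/
lemma Rch.last_exit {φ : V → ℤ} (hφ : ∀ x y, Step g ω R x y → |φ x - φ y| ≤ 1) {α : ℤ}
    (h : Rch g ω R u v) (hR : u ∈ R) (hu : φ u ≤ α) (hv : α ≤ φ v) :
    ∃ u', φ u' = α ∧ Rch g ω R u u' ∧ u' ∈ R ∩ {x | α ≤ φ x} ∧
      Rch g ω (R ∩ {x | α ≤ φ x}) u' v := by
  induction h with
  | refl => exact ⟨u, by omega, Rch.refl, ⟨hR, hv⟩, Rch.refl⟩
  | @tail b c h h' ih =>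
    by_cases hb : α ≤ φ b
    · obtain ⟨u', h1, h2, h3, h4⟩ := ih hb
      exact ⟨u', h1, h2, h3, h4.trans (Step.rch ⟨⟨h'.1, hb⟩, ⟨h'.2.1, hv⟩, h'.2.2⟩)⟩
    · have := abs_le.1 (hφ _ _ h')
      exact ⟨c, by omega, Rch.trans h h'.rch, ⟨h'.2.1, hv⟩, Rch.refl⟩

/-- A path from height at most `α` to height at least `β` crosses the strip between `α`
and `β`. -/
lemma Rch.trim {φ : V → ℤ} (hφ : ∀ x y, Step g ω R x y → |φ x - φ y| ≤ 1) {α β : ℤ}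
    (hαβ : α ≤ β) (h : Rch g ω R u v) (hR : u ∈ R) (hu : φ u ≤ α) (hv : β ≤ φ v) :
    ∃ u' v', φ u' = α ∧ φ v' = β ∧ Rch g ω R u u' ∧ u' ∈ R ∩ {x | α ≤ φ x ∧ φ x ≤ β} ∧
      Rch g ω (R ∩ {x | α ≤ φ x ∧ φ x ≤ β}) u' v' := by
  obtain ⟨u', h1, h2, h3, h4⟩ := h.last_exit hφ hR hu (hαβ.trans hv)
  obtain ⟨v', k1, k2, k3, k4⟩ := h4.symm.last_exit (φ := fun x => - φ x) (α := -β)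
    (fun x y hxy => by
      have := hφ x y (hxy.mono le_rfl inter_subset_left)
      rw [abs_le] at this ⊢; omega) (h4.mem h3) (by simpa using hv) (by simp [h1, hαβ])
  have hs : R ∩ {x | α ≤ φ x} ∩ {x | -β ≤ - φ x} ⊆ R ∩ {x | α ≤ φ x ∧ φ x ≤ β} :=
    fun x hx => ⟨hx.1.1, hx.1.2, by have := hx.2; simpa using this⟩
  exact ⟨u', v', h1, by omega, h2, ⟨h3.1, h3.2, by simp [h1, hαβ]⟩,
    (k4.mono le_rfl hs).symm⟩

end Graph

/-! ### The triangular lattice as a graph, and planar duality -/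

section Planar

/-- Lattice coordinates. -/
abbrev Z2 := ℤ × ℤ

/-- The triangular lattice as a graph. -/
def tg (e : TriE) : Z2 × Z2 :=
  if e.2.2 = 0 then ((e.1, e.2.1), (e.1 + 1, e.2.1))
  else if e.2.2 = 1 then ((e.1 + 1, e.2.1), (e.1, e.2.1 + 1))
  else ((e.1, e.2.1), (e.1, e.2.1 + 1))

@[simp] lemma tg_zero (a b : ℤ) : tg (a, b, 0) = ((a, b), (a + 1, b)) := rfl
@[simp] lemma tg_one (a b : ℤ) : tg (a, b, 1) = ((a + 1, b), (a, b + 1)) := rfl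
@[simp] lemma tg_two (a b : ℤ) : tg (a, b, 2) = ((a, b), (a, b + 1)) := rfl

/-- Vertices of the hexagonal lattice: up-triangles (`true`) and down-triangles (`false`). -/
abbrev HV := Z2 × Bool

/-- The centre of an up-triangle. -/
abbrev Up (a b : ℤ) : HV := ((a, b), true)
/-- The centre of a down-triangle. -/
abbrev Dn (a b : ℤ) : HV := ((a, b), false)

/-- The hexagonal lattice as a graph. -/
def hg (e : TriE) : HV × HV :=
  if e.2.2 = 0 then (Up e.1 e.2.1, Dn e.1 e.2.1)
  else if e.2.2 = 1 then (Up e.1 e.2.1, Dn e.1 (e.2.1 + 1))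
  else (Up e.1 e.2.1, Dn (e.1 - 1) (e.2.1 + 1))

@[simp] lemma hg_zero (a b : ℤ) : hg (a, b, 0) = (Up a b, Dn a b) := rfl
@[simp] lemma hg_one (a b : ℤ) : hg (a, b, 1) = (Up a b, Dn a (b + 1)) := rfl
@[simp] lemma hg_two (a b : ℤ) : hg (a, b, 2) = (Up a b, Dn (a - 1) (b + 1)) := rfl

/-- The mod 2 boundary of a chain. -/
def bdry (c : TriE → ZMod 2) (z : Z2) : ZMod 2 :=
  c (z.1, z.2, 0) + c (z.1 - 1, z.2, 0) + c (z.1 - 1, z.2, 1) + c (z.1, z.2 - 1, 1) +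
    c (z.1, z.2, 2) + c (z.1, z.2 - 1, 2)

lemma bdry_add (c c' : TriE → ZMod 2) (z : Z2) : bdry (c + c') z = bdry c z + bdry c' z := by
  simp only [bdry, Pi.add_apply]; ring

lemma bdry_single (e : TriE) (z : Z2) : bdry (Pi.single e 1) z =
    (if z = (tg e).1 then 1 else 0) + (if z = (tg e).2 then 1 else 0) := by
  obtain ⟨a, b, i⟩ := e
  obtain ⟨x, y⟩ := z
  have e1 : x - 1 = a ↔ x = a + 1 := by omega
  have e2 : y - 1 = b ↔ y = b + 1 := by omega
  fin_cases i <;> simp [bdry, Pi.single_apply, e1, e2]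

lemma zmod2_self (x : ZMod 2) : x + x = 0 := CharTwo.add_self_eq_zero x

lemma tri_induct {P : TriE → Prop} (h0 : ∀ a b, P (a, b, 0)) (h1 : ∀ a b, P (a, b, 1))
    (h2 : ∀ a b, P (a, b, 2)) (e : TriE) : P e := by
  obtain ⟨a, b, i⟩ := e
  fin_cases i
  exacts [h0 a b, h1 a b, h2 a b]

/-- An open path gives a mod 2 chain. -/
lemma Rch.chain {ω : Config TriE} {R : Set Z2} {u v : Z2} (h : Rch tg ω R u v) (hu : u ∈ R) :
    ∃ c : TriE → ZMod 2,
      (∀ e, c e ≠ 0 → ω e = true ∧ (tg e).1 ∈ R ∧ (tg e).2 ∈ R ∧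
        Rch tg ω R u (tg e).1 ∧ Rch tg ω R u (tg e).2) ∧
      ∀ z, bdry c z = (if z = u then 1 else 0) + (if z = v then 1 else 0) := by
  induction h with
  | refl => exact ⟨0, by simp, fun z => by simp [bdry, zmod2_self]⟩
  | @tail b d h h' ih =>
    obtain ⟨c, hc, hb⟩ := ih
    obtain ⟨hbR, hdR, e, he, hg⟩ := h'
    have hs : Rch tg ω R u d := Rch.trans h (Step.rch ⟨hbR, hdR, e, he, hg⟩)
    refine ⟨c + Pi.single e 1, fun x hx => ?_, fun z => ?_⟩
    · by_cases hxe : x = e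
      · subst hxe
        rcases hg with hg | hg
        · rw [hg]; exact ⟨he, hbR, hdR, h, hs⟩
        · rw [hg]; exact ⟨he, hdR, hbR, hs, h⟩
      · refine hc x ?_
        simpa [Pi.single_apply, hxe] using hx
    · rw [bdry_add, hb, bdry_single]
      rcases hg with hg | hg <;> rw [hg] <;>
        linear_combination zmod2_self (if z = b then 1 else 0)

/-- Add to a chain from `u` to `v` the half-lines from `u` down and from `v` up. -/
def extend (c : TriE → ZMod 2) (u v : Z2) (e : TriE) : ZMod 2 :=
  c e + (if e.2.2 = 2 ∧ e.1 = u.1 ∧ e.2.1 < u.2 then 1 else 0) +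
    (if e.2.2 = 2 ∧ e.1 = v.1 ∧ v.2 ≤ e.2.1 then 1 else 0)

lemma bdry_extend {c : TriE → ZMod 2} {u v : Z2}
    (hc : ∀ z, bdry c z = (if z = u then 1 else 0) + (if z = v then 1 else 0)) (z : Z2) :
    bdry (extend c u v) z = 0 := by
  obtain ⟨a, b⟩ := z
  obtain ⟨u1, u2⟩ := u
  obtain ⟨v1, v2⟩ := v
  have h := hc (a, b)
  have hu : (if a = u1 ∧ b < u2 then 1 else 0) + (if a = u1 ∧ b - 1 < u2 then 1 else 0) =
      (if a = u1 ∧ b = u2 then (1 : ZMod 2) else 0) := by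
    by_cases ha : a = u1
    · rcases lt_trichotomy b u2 with hb | hb | hb
      · simp [ha, hb, hb.ne, show b - 1 < u2 by omega, zmod2_self]
      · simp [ha, hb]
      · simp [ha, hb.ne', show ¬ b < u2 by omega, show ¬ b - 1 < u2 by omega]
    · simp [ha]
  have hv : (if a = v1 ∧ v2 ≤ b then 1 else 0) + (if a = v1 ∧ v2 ≤ b - 1 then 1 else 0) =
      (if a = v1 ∧ b = v2 then (1 : ZMod 2) else 0) := by
    by_cases ha : a = v1
    · rcases lt_trichotomy b v2 with hb | hb | hb
      · simp [ha, hb.ne, show ¬ v2 ≤ b by omega, show ¬ v2 ≤ b - 1 by omega]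
      · simp [ha, hb]
      · simp [ha, hb.ne', show v2 ≤ b by omega, show v2 ≤ b - 1 by omega, zmod2_self]
    · simp [ha]
  simp only [bdry, extend, Prod.mk.injEq] at h ⊢
  simp only [Fin.isValue, Fin.reduceEq, false_and, if_false, true_and, add_zero] at h ⊢
  linear_combination h + hu + hv + zmod2_self (if a = u1 ∧ b = u2 then (1 : ZMod 2) else 0) +
    zmod2_self (if a = v1 ∧ b = v2 then (1 : ZMod 2) else 0)

/-- A vertical chain in the columns between `x0` and `x1` separates left from right. -/
lemma exists_potential {c : TriE → ZMod 2} {u v : Z2} {x0 x1 yl : ℤ}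
    (hc : ∀ z, bdry c z = (if z = u then 1 else 0) + (if z = v then 1 else 0))
    (hsupp : ∀ e, c e ≠ 0 → x0 ≤ e.1 ∧ e.1 ≤ x1 ∧ yl ≤ e.2.1)
    (hu : x0 ≤ u.1 ∧ u.1 ≤ x1) (hv : x0 ≤ v.1 ∧ v.1 ≤ x1) :
    ∃ f : HV → ZMod 2, (∀ e, f (hg e).1 + f (hg e).2 = extend c u v e) ∧
      (∀ a b, a < x0 → f (Up a b) = 0) ∧ (∀ a b, a < x0 → f (Dn a b) = 0) ∧
      (∀ a b, x1 < a → f (Up a b) = 1) ∧ (∀ a b, x1 ≤ a → f (Dn a b) = 1) := by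
  set d := extend c u v with hd
  have hdx : ∀ a b i, (a < x0 ∨ x1 < a) → d (a, b, i) = 0 := by
    intro a b i ha
    have h1 : c (a, b, i) = 0 := by
      by_contra h
      have := hsupp _ h
      simp only at this
      omega
    simp only [hd, extend, h1]
    rw [if_neg (by rintro ⟨-, h, -⟩; omega),
      if_neg (by rintro ⟨-, h, -⟩; omega)]
    simp
  have hbd : ∀ a b, d (a, b, 0) + d (a - 1, b, 0) + d (a - 1, b, 1) + d (a, b - 1, 1) +
    d (a, b, 2) + d (a, b - 1, 2) = 0 := fun a b => bdry_extend hc (a, b)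
  clear_value d
  let T : ℤ → ℤ → ZMod 2 := fun a b => ∑ x ∈ Finset.Ico x0 a, (d (x, b, 1) + d (x, b, 2))
  have hT : ∀ a b, T (a + 1) b = T a b + (d (a, b, 1) + d (a, b, 2)) := by
    intro a b
    by_cases ha : x0 ≤ a
    · have : Finset.Ico x0 (a + 1) = insert a (Finset.Ico x0 a) := by
        ext x; simp only [Finset.mem_Ico, Finset.mem_insert]; omega
      simp only [T]
      rw [this, Finset.sum_insert (by simp), add_comm]
    · rw [hdx a b 1 (by omega), hdx a b 2 (by omega)]
      simp only [T]
      rw [Finset.Ico_eq_empty (by omega), Finset.Ico_eq_empty (by omega)]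
      simp
  have hT0 : ∀ a b, a ≤ x0 → T a b = 0 := by
    intro a b ha
    simp only [T]
    rw [Finset.Ico_eq_empty (by omega)]; simp
  have hrel : ∀ a b, T a b + d (a, b, 2) + T (a + 1) (b - 1) = d (a, b, 0) := by
    intro a b
    by_cases ha : a < x0
    · rw [hT0 _ _ (by omega), hT0 _ _ (by omega), hdx _ _ _ (by omega), hdx _ _ _ (by omega)]
      simp
    · have h : x0 - 1 ≤ a := by omega
      clear ha
      induction a, h using Int.leInduction with
      | base =>
        rw [hT0 _ _ (by omega), hT0 _ _ (by omega), hdx _ _ _ (by omega), hdx _ _ _ (by omega)]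
        simp
      | succ a ha ih =>
        have h1 := hT a b
        have h2 := hT (a + 1) (b - 1)
        have h3 := hbd (a + 1) b
        rw [add_sub_cancel_right] at h3
        rw [h2, h1]
        linear_combination ih + h3 - zmod2_self (d (a + 1, b, 0))
  have hflux : ∀ a b, x1 < a → T a b = 1 := by
    have hconst : ∀ a b, x1 < a → T a b = T a (b - 1) := by
      intro a b ha
      have h1 := hrel a b
      have h2 := hT a (b - 1)
      rw [hdx _ _ _ (Or.inr ha), hdx _ _ _ (Or.inr ha)] at h2
      rw [hdx _ _ _ (Or.inr ha), hdx _ _ _ (Or.inr ha), h2] at h1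
      linear_combination h1 - zmod2_self (T a (b - 1))
    have hlow : ∀ a b, x1 < a → b < min yl (min u.2 v.2) → T a b = 1 := by
      intro a b ha hb
      have hdl : ∀ x i, d (x, b, i) = if i = 2 ∧ x = u.1 then 1 else 0 := by
        intro x i
        have h1 : c (x, b, i) = 0 := by
          by_contra h
          have := hsupp _ h
          simp only at this
          omega
        rw [hd, extend, h1]
        have e1 : b < u.2 := by omega
        have e2 : ¬ v.2 ≤ b := by omega
        simp [e1, e2]
      simp only [T, hdl]
      simp
      omega
    intro a b ha
    have : ∀ n : ℕ, T a (b - n) = T a b := by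
      intro n
      induction n with
      | zero => simp
      | succ n ih => rw [← ih, hconst _ (b - n) ha]; congr 1; push_cast; ring
    rw [← this (b - min yl (min u.2 v.2) + 1).toNat]
    exact hlow _ _ ha (by omega)
  refine ⟨fun h => if h.2 then T h.1.1 h.1.2 + d (h.1.1, h.1.2, 2) else T (h.1.1 + 1) (h.1.2 - 1),
    ?_, ?_, ?_, ?_, ?_⟩
  · intro e
    induction e using tri_induct with
    | h0 a b => simpa using hrel a b
    | h1 a b =>
      simp only [hg_one, if_true, Bool.false_eq_true, if_false, add_sub_cancel_right]
      rw [hT]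
      linear_combination zmod2_self (T a b) + zmod2_self (d (a, b, 2))
    | h2 a b =>
      simp only [hg_two, if_true, Bool.false_eq_true, if_false, add_sub_cancel_right,
        sub_add_cancel]
      linear_combination zmod2_self (T a b)
  · intro a b ha
    simp [hT0 a b ha.le, hdx a b 2 (Or.inl ha)]
  · intro a b ha
    simpa using hT0 (a + 1) (b - 1) (by omega)
  · intro a b ha
    simp [hflux a b ha, hdx a b 2 (Or.inr ha)]
  · intro a b ha
    simpa using hflux (a + 1) (b - 1) (by omega)

end Planar

section Planar

/-- The six edges at a vertex vanish under `d`. -/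
def ClearAt (d : TriE → ZMod 2) (z : Z2) : Prop :=
  d (z.1, z.2, 0) = 0 ∧ d (z.1 - 1, z.2, 0) = 0 ∧ d (z.1 - 1, z.2, 1) = 0 ∧
    d (z.1, z.2 - 1, 1) = 0 ∧ d (z.1, z.2, 2) = 0 ∧ d (z.1, z.2 - 1, 2) = 0

lemma clearAt_of {d : TriE → ZMod 2} {z : Z2} (h : ∀ e, (tg e).1 = z ∨ (tg e).2 = z → d e = 0) :
    ClearAt d z := by
  refine ⟨h _ ?_, h _ ?_, h _ ?_, h _ ?_, h _ ?_, h _ ?_⟩ <;> simp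

/-- A potential is constant on the six faces around a vertex where no edge carries flow. -/
lemma ClearAt.faces {d : TriE → ZMod 2} {f : HV → ZMod 2}
    (hf : ∀ e, f (hg e).1 + f (hg e).2 = d e) {a b : ℤ} (h : ClearAt d (a, b)) :
    f (Dn (a - 1) (b + 1)) = f (Up a b) ∧ f (Up (a - 1) b) = f (Up a b) ∧
    f (Dn (a - 1) b) = f (Up a b) ∧ f (Up a (b - 1)) = f (Up a b) ∧ f (Dn a b) = f (Up a b) := by
  obtain ⟨h0, h1, h2, h3, h4, h5⟩ := h
  have k0 := hf (a, b, 0)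
  have k1 := hf (a - 1, b, 0)
  have k2 := hf (a - 1, b, 1)
  have k3 := hf (a, b - 1, 1)
  have k4 := hf (a, b, 2)
  have k5 := hf (a, b - 1, 2)
  simp only at h0 h1 h2 h3 h4 h5
  simp only [hg_zero, hg_one, hg_two, h0, h1, h2, h3, h4, h5, CharTwo.add_eq_zero,
    sub_add_cancel] at k0 k1 k2 k3 k4 k5
  refine ⟨k4.symm, ?_, ?_, ?_, k0.symm⟩
  · rw [k2, k4]
  · rw [← k1, k2, k4]
  · rw [k3, ← k0]

/-- Along a path avoiding the flow, the potential of the adjacent faces does not change. -/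
lemma Step.potential {d : TriE → ZMod 2} {f : HV → ZMod 2}
    (hf : ∀ e, f (hg e).1 + f (hg e).2 = d e) {ω : Config TriE} {R : Set Z2} {x y : Z2}
    (h : Step tg ω R x y) (hx : ClearAt d x) (hy : ClearAt d y) :
    f (Up x.1 x.2) = f (Up y.1 y.2) := by
  have key : ∀ e, ClearAt d (tg e).1 → ClearAt d (tg e).2 →
      f (Up (tg e).1.1 (tg e).1.2) = f (Up (tg e).2.1 (tg e).2.2) := by
    intro e
    induction e using tri_induct with
    | h0 a b =>
      intro h1 h2
      simpa using (h2.faces hf).2.1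
    | h1 a b =>
      intro h1 h2
      have k1 := (h1.faces hf).2.1
      have k2 := (h2.faces hf).2.2.2.1
      simp only [add_sub_cancel_right] at k1 k2
      simp only [tg_one]
      rw [← k1, ← k2]
    | h2 a b =>
      intro h1 h2
      have k2 := (h2.faces hf).2.2.2.1
      simp only [add_sub_cancel_right] at k2
      simpa using k2
  obtain ⟨-, -, e, -, hg | hg⟩ := h
  · have := key e; rw [hg] at this; exact this hx hy
  · have := key e; rw [hg] at this; exact (this hy hx).symm

lemma inner_bounds {x0 x1 : ℤ} {e : TriE} (h1 : x0 ≤ (tg e).1.1 ∧ (tg e).1.1 ≤ x1)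
    (h2 : x0 ≤ (tg e).2.1 ∧ (tg e).2.1 ≤ x1) : x0 ≤ e.1 ∧ e.1 ≤ x1 := by
  induction e using tri_induct <;> simp at h1 h2 ⊢ <;> omega

lemma fst_row_le {yl : ℤ} {e : TriE} (h1 : yl ≤ (tg e).1.2) : yl ≤ e.2.1 := by
  induction e using tri_induct <;> simpa using h1

/-- The potential associated with a vertical path in a set of bounded columns. -/
lemma Rch.exists_potential {ω : Config TriE} {R : Set Z2} {u v : Z2} {x0 x1 : ℤ}
    (h : Rch tg ω R u v) (hu : u ∈ R) (hR : ∀ z ∈ R, x0 ≤ z.1 ∧ z.1 ≤ x1)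
    (hRy : ∃ yl : ℤ, ∀ z ∈ R, yl ≤ z.2) :
    ∃ c : TriE → ZMod 2, ∃ f : HV → ZMod 2,
      (∀ e, c e ≠ 0 → ω e = true ∧ (tg e).1 ∈ R ∧ (tg e).2 ∈ R ∧
        Rch tg ω R u (tg e).1 ∧ Rch tg ω R u (tg e).2) ∧
      (∀ e, f (hg e).1 + f (hg e).2 = extend c u v e) ∧
      (∀ a b, a < x0 → f (Up a b) = 0) ∧ (∀ a b, a < x0 → f (Dn a b) = 0) ∧
      (∀ a b, x1 < a → f (Up a b) = 1) ∧ (∀ a b, x1 ≤ a → f (Dn a b) = 1) := by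
  obtain ⟨c, hc, hb⟩ := h.chain hu
  obtain ⟨yl, hyl⟩ := hRy
  obtain ⟨f, hf⟩ := Perc.exists_potential hb (x0 := x0) (x1 := x1) (yl := yl) (fun e he => by
    obtain ⟨-, h1, h2, -⟩ := hc e he
    have := inner_bounds (hR _ h1) (hR _ h2)
    exact ⟨this.1, this.2, fst_row_le (hyl _ h1)⟩) (hR _ hu) (hR _ (h.mem hu))
  exact ⟨c, f, hc, hf⟩

/-- A vertical and a horizontal path intersect. -/
lemma exists_intersection {ω ω' : Config TriE} {R R' : Set Z2} {u v u' v' : Z2} {x0 x1 y0 y1 : ℤ}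
    (h : Rch tg ω R u v) (hu : u ∈ R) (hR : ∀ z ∈ R, x0 ≤ z.1 ∧ z.1 ≤ x1)
    (hRy : ∃ yl : ℤ, ∀ z ∈ R, yl ≤ z.2) (hu0 : u.2 ≤ y0) (hv1 : y1 ≤ v.2)
    (h' : Rch tg ω' R' u' v') (hu' : u' ∈ R') (hR' : ∀ z ∈ R', y0 ≤ z.2 ∧ z.2 ≤ y1)
    (hu'0 : u'.1 ≤ x0) (hv'1 : x1 ≤ v'.1) :
    ∃ z, Rch tg ω R u z ∧ Rch tg ω' R' u' z := by
  by_contra hcon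
  push Not at hcon
  obtain ⟨c, f, hc, hf, f1, f2, f3, f4⟩ := h.exists_potential hu hR hRy
  have hclear : ∀ y, Rch tg ω' R' u' y → ClearAt (extend c u v) y := by
    intro y hy
    have hny : ¬ Rch tg ω R u y := fun hz => hcon y hz hy
    have hyR := hR' y (hy.mem hu')
    have hyu : y ≠ u := by rintro rfl; exact hny Rch.refl
    have hyv : y ≠ v := by rintro rfl; exact hny h
    refine clearAt_of fun e he => ?_
    have h0 : c e = 0 := by
      by_contra h0
      obtain ⟨-, -, -, h1, h2⟩ := hc e h0
      rcases he with he | he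
      · exact hny (he ▸ h1)
      · exact hny (he ▸ h2)
    rw [extend, h0, if_neg, if_neg]
    · simp
    · obtain ⟨a, b, i⟩ := e
      rintro ⟨rfl, h1, h2⟩
      simp only at h1 h2
      simp only [tg_two] at he
      obtain ⟨v1, v2⟩ := v
      obtain ⟨y1, y2⟩ := y
      simp only [Prod.mk.injEq, ne_eq] at he hyv hyR h1 h2 hv1
      omega
    · obtain ⟨a, b, i⟩ := e
      rintro ⟨rfl, h1, h2⟩
      simp only at h1 h2
      simp only [tg_two] at he
      obtain ⟨u1, u2⟩ := u
      obtain ⟨y1, y2⟩ := y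
      simp only [Prod.mk.injEq, ne_eq] at he hyu hyR h1 h2 hu0
      omega
  have hcst : f (Up u'.1 u'.2) = f (Up v'.1 v'.2) :=
    h'.induct (P := fun x => f (Up u'.1 u'.2) = f (Up x.1 x.2)) rfl fun x y hx hxy ih =>
      ih.trans (hxy.potential hf (hclear x hx) (hclear y (hx.trans hxy.rch)))
  have e1 := ((hclear u' Rch.refl).faces hf).2.1
  have e2 := ((hclear v' h').faces hf).2.2.2.2
  rw [f1 _ _ (by omega)] at e1
  rw [f4 _ _ (by omega)] at e2
  rw [← e1, ← e2] at hcst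
  exact zero_ne_one hcst

lemma extend_eq_of {c : TriE → ZMod 2} {u v : Z2} {e : TriE} (h : u.2 ≤ e.2.1) (h' : e.2.1 < v.2) :
    extend c u v e = c e := by
  rw [extend, if_neg (by omega), if_neg (by omega)]; simp

/-- A vertical path and a dual horizontal path exclude each other. -/
lemma no_dual_crossing {ω : Config TriE} {R : Set Z2} {u v : Z2} {x0 x1 y0 y1 : ℤ}
    (h : Rch tg ω R u v) (hu : u ∈ R) (hR : ∀ z ∈ R, x0 ≤ z.1 ∧ z.1 ≤ x1)
    (hRy : ∃ yl : ℤ, ∀ z ∈ R, yl ≤ z.2) (hu0 : u.2 ≤ y0) (hv1 : y1 ≤ v.2) {R' : Set HV}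
    (hR' : ∀ a b, Up a b ∈ R' → y0 ≤ b ∧ b < y1) {p q : Z2} (hp : p.1 < x0) (hq : x1 ≤ q.1)
    (h' : Rch hg (fun e => !ω e) R' (p, false) (q, false)) : False := by
  obtain ⟨c, f, hc, hf, f1, f2, f3, f4⟩ := h.exists_potential hu hR hRy
  have key : ∀ e, ω e = false → (hg e).1 ∈ R' → f (hg e).1 = f (hg e).2 := by
    intro e he hm
    have hc0 : c e = 0 := by
      by_contra h0
      exact absurd (hc e h0).1 (by simp [he])
    have hm' : Up e.1 e.2.1 ∈ R' := by
      obtain ⟨a, b, i⟩ := e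
      fin_cases i <;> exact hm
    have := hR' _ _ hm'
    rw [← CharTwo.add_eq_zero, hf, extend_eq_of (by omega) (by omega), hc0]
  have hcst : f (p, false) = f (q, false) :=
    h'.induct (P := fun x => f (p, false) = f x) rfl fun x y hx hxy ih => by
      obtain ⟨hxR, hyR, e, he, hg⟩ := hxy
      have he : ω e = false := by simpa using he
      refine ih.trans ?_
      have := key e he
      rcases hg with hg | hg <;> rw [hg] at this
      · exact this hxR
      · exact (this hyR).symm
  rw [f2 p.1 p.2 hp, f4 q.1 q.2 hq] at hcst
  exact zero_ne_one hcst

/-- The box `[0,m] × [0,n]`. -/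
def box (m n : ℕ) : Set Z2 := {z | 0 ≤ z.1 ∧ z.1 ≤ m ∧ 0 ≤ z.2 ∧ z.2 ≤ n}

/-- The dual region of `box m n`, for left-right dual crossings. -/
def dbox (m n : ℕ) : Set HV := {h | if h.2 then 0 ≤ h.1.1 ∧ h.1.1 < m ∧ 0 ≤ h.1.2 ∧ h.1.2 < n
  else -1 ≤ h.1.1 ∧ h.1.1 < m ∧ 1 ≤ h.1.2 ∧ h.1.2 ≤ n}

lemma up_mem_dbox {m n : ℕ} {a b : ℤ} :
    Up a b ∈ dbox m n ↔ 0 ≤ a ∧ a < m ∧ 0 ≤ b ∧ b < n := by simp [dbox]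

lemma dn_mem_dbox {m n : ℕ} {a b : ℤ} :
    Dn a b ∈ dbox m n ↔ -1 ≤ a ∧ a < m ∧ 1 ≤ b ∧ b ≤ n := by simp [dbox]

/-- If there is no vertical crossing then there is a horizontal dual crossing. -/
lemma exists_dual_crossing {ω : Config TriE} {m n : ℕ}
    (h : ¬ Conn tg ω (box m n) {z | z.2 = 0} {z | z.2 = n}) :
    Conn hg (fun e => !ω e) (dbox m n) {h | h.2 = false ∧ h.1.1 = -1}
      {h | h.2 = false ∧ h.1.1 = m - 1} := by
  classical
  by_contra hW
  let χ : ℤ → ℤ → ZMod 2 := fun a b =>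
    if ∃ u : Z2, u.2 = 0 ∧ u ∈ box m n ∧ Rch tg ω (box m n) u (a, b) then 1 else 0
  let W : ℤ → ℤ → Bool → ZMod 2 := fun a b t =>
    if ∃ p : HV, p.2 = false ∧ p.1.1 = -1 ∧ p ∈ dbox m n ∧
      Rch hg (fun e => !ω e) (dbox m n) p ((a, b), t) then 1 else 0
  have χ0 : ∀ a : ℤ, 0 ≤ a → a ≤ m → χ a 0 = 1 := fun a h0 h1 =>
    if_pos ⟨(a, 0), rfl, ⟨h0, h1, le_rfl, by positivity⟩, Rch.refl⟩
  have χn : ∀ a : ℤ, χ a n = 0 := fun a => if_neg (by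
    rintro ⟨u, hu, huR, hr⟩
    exact h ⟨u, hu, _, rfl, huR, hr⟩)
  have W0 : ∀ b : ℤ, 1 ≤ b → b ≤ n → W (-1) b false = 1 := fun b h0 h1 =>
    if_pos ⟨Dn (-1) b, rfl, rfl, dn_mem_dbox.2 ⟨le_rfl, by omega, h0, h1⟩, Rch.refl⟩
  have Wm : ∀ b : ℤ, W (m - 1) b false = 0 := fun b => if_neg (by
    rintro ⟨u, hu, hu', huR, hr⟩
    exact hW ⟨u, ⟨hu, hu'⟩, _, ⟨rfl, rfl⟩, huR, hr⟩)
  have hχ : ∀ e, (tg e).1 ∈ box m n → (tg e).2 ∈ box m n → ω e = true →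
      χ (tg e).1.1 (tg e).1.2 = χ (tg e).2.1 (tg e).2.2 := by
    intro e h1 h2 he
    simp only [χ]
    congr 1
    simp only [eq_iff_iff]
    constructor <;> rintro ⟨u, hu, huR, hr⟩
    · exact ⟨u, hu, huR, hr.trans (Step.rch ⟨h1, h2, e, he, Or.inl rfl⟩)⟩
    · exact ⟨u, hu, huR, hr.trans (Step.rch ⟨h2, h1, e, he, Or.inr rfl⟩)⟩
  have hWe : ∀ e, (hg e).1 ∈ dbox m n → (hg e).2 ∈ dbox m n → ω e = false →
      W (hg e).1.1.1 (hg e).1.1.2 (hg e).1.2 = W (hg e).2.1.1 (hg e).2.1.2 (hg e).2.2 := by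
    intro e h1 h2 he
    simp only [W]
    congr 1
    simp only [eq_iff_iff]
    constructor <;> rintro ⟨u, hu, hu', huR, hr⟩
    · exact ⟨u, hu, hu', huR, hr.trans (Step.rch ⟨h1, h2, e, by simp [he], Or.inl rfl⟩)⟩
    · exact ⟨u, hu, hu', huR, hr.trans (Step.rch ⟨h2, h1, e, by simp [he], Or.inr rfl⟩)⟩
  clear_value χ W
  have hprod : ∀ e, (tg e).1 ∈ box m n → (tg e).2 ∈ box m n → (hg e).1 ∈ dbox m n →
      (hg e).2 ∈ dbox m n → (χ (tg e).1.1 (tg e).1.2 + χ (tg e).2.1 (tg e).2.2) *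
        (W (hg e).1.1.1 (hg e).1.1.2 (hg e).1.2 + W (hg e).2.1.1 (hg e).2.1.2 (hg e).2.2) = 0 := by
    intro e h1 h2 h3 h4
    rcases hω : ω e
    · rw [hWe e h3 h4 hω, zmod2_self, mul_zero]
    · rw [hχ e h1 h2 hω, zmod2_self, zero_mul]
  have q0 : ∀ a b : ℤ, 0 ≤ a → a < m → 0 ≤ b → b < n →
      (χ a b + χ (a + 1) b) * (W a b true + W a b false) = 0 := by
    intro a b h0 h1 h2 h3
    rcases h2.eq_or_lt with rfl | h2
    · rw [χ0 a h0 h1.le, χ0 (a + 1) (by omega) (by omega), zmod2_self, zero_mul]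
    · refine hprod (a, b, 0) ⟨?_, ?_, ?_, ?_⟩ ⟨?_, ?_, ?_, ?_⟩ (up_mem_dbox.2 ⟨?_, ?_, ?_, ?_⟩)
        (dn_mem_dbox.2 ⟨?_, ?_, ?_, ?_⟩) <;> simp <;> omega
  have q1 : ∀ a b : ℤ, 0 ≤ a → a < m → 0 ≤ b → b < n →
      (χ (a + 1) b + χ a (b + 1)) * (W a b true + W a (b + 1) false) = 0 := by
    intro a b h0 h1 h2 h3
    refine hprod (a, b, 1) ⟨?_, ?_, ?_, ?_⟩ ⟨?_, ?_, ?_, ?_⟩ (up_mem_dbox.2 ⟨?_, ?_, ?_, ?_⟩)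
        (dn_mem_dbox.2 ⟨?_, ?_, ?_, ?_⟩) <;> simp <;> omega
  have q2 : ∀ a b : ℤ, 0 ≤ a → a < m → 0 ≤ b → b < n →
      (χ a b + χ a (b + 1)) * (W a b true + W (a - 1) (b + 1) false) = 0 := by
    intro a b h0 h1 h2 h3
    refine hprod (a, b, 2) ⟨?_, ?_, ?_, ?_⟩ ⟨?_, ?_, ?_, ?_⟩ (up_mem_dbox.2 ⟨?_, ?_, ?_, ?_⟩)
        (dn_mem_dbox.2 ⟨?_, ?_, ?_, ?_⟩) <;> simp <;> omega
  -- the contributions of the up-triangles, summed along a row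
  have hrow : ∀ b : ℤ, 0 ≤ b → b < n → ∀ k : ℕ, (k : ℤ) ≤ m →
      (∑ i ∈ Finset.range k, ((χ i b + χ (i + 1) b) * W i b false +
        (χ i (b + 1) + χ (i + 1) (b + 1)) * W i (b + 1) false)) =
      (χ 0 b + χ 0 (b + 1)) * W (-1) (b + 1) false +
        (χ k b + χ k (b + 1)) * W (k - 1) (b + 1) false := by
    intro b hb0 hb1 k
    induction k with
    | zero => intro _; simp [zmod2_self]
    | succ k ih =>
      intro hk
      push_cast at hk
      rw [Finset.sum_range_succ, ih (by omega)]
      have r0 := q0 k b (by omega) (by omega) hb0 hb1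
      have r1 := q1 k b (by omega) (by omega) hb0 hb1
      have r2 := q2 k b (by omega) (by omega) hb0 hb1
      push_cast
      rw [add_sub_cancel_right]
      linear_combination r0 + r1 + r2
        - zmod2_self ((χ k b + χ (k+1) b + χ k (b+1)) * W k b true)
        - zmod2_self (χ (k+1) b * W k (b+1) false)
  have hcol : ∀ l : ℕ, (l : ℤ) ≤ n → χ 0 0 + χ 0 l =
      ∑ i ∈ Finset.range m, (χ i l + χ (i + 1) l) * W i l false := by
    intro l
    induction l with
    | zero =>
      intro _
      rw [Nat.cast_zero, zmod2_self, eq_comm]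
      refine Finset.sum_eq_zero fun i hi => ?_
      have := Finset.mem_range.1 hi
      rw [χ0 i (by omega) (by omega), χ0 (i + 1) (by omega) (by omega), zmod2_self, zero_mul]
    | succ l ih =>
      intro hl
      push_cast at hl
      have h1 := hrow l (by omega) (by omega) m le_rfl
      rw [Finset.sum_add_distrib, ← ih (by omega), W0 _ (by omega) (by omega), Wm] at h1
      push_cast
      linear_combination -h1 + zmod2_self (χ 0 0)
  have := hcol n le_rfl
  rw [χn, χ0 0 le_rfl (by positivity), Finset.sum_eq_zero fun i _ => by rw [χn, χn]; simp] at this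
  simp at this

end Planar

/-! ### Relabelling, translations and numerical duality -/

section Relabel

variable {E V E' V' : Type}

lemma Step.relabel {g : E → V × V} {g' : E' → V' × V'} {σ : E → E'} {s : V → V'} {ω : Config E'}
    {R : Set V} {R' : Set V'} {x y : V}
    (hg : ∀ e, g' (σ e) = (s (g e).1, s (g e).2) ∨ g' (σ e) = (s (g e).2, s (g e).1))
    (hR : MapsTo s R R') (h : Step g (fun e => ω (σ e)) R x y) : Step g' ω R' (s x) (s y) := by
  obtain ⟨hx, hy, e, he, hxy⟩ := h
  refine ⟨hR hx, hR hy, σ e, he, ?_⟩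
  rcases hxy with hxy | hxy <;> have := hg e <;> rw [hxy] at this
  · exact this
  · exact this.symm

lemma Rch.relabel {g : E → V × V} {g' : E' → V' × V'} {σ : E → E'} {s : V → V'} {ω : Config E'}
    {R : Set V} {R' : Set V'} {x y : V}
    (hg : ∀ e, g' (σ e) = (s (g e).1, s (g e).2) ∨ g' (σ e) = (s (g e).2, s (g e).1))
    (hR : MapsTo s R R') (h : Rch g (fun e => ω (σ e)) R x y) : Rch g' ω R' (s x) (s y) :=
  h.map s fun _ _ hxy => (hxy.relabel hg hR).rch

lemma Conn.relabel {g : E → V × V} {g' : E' → V' × V'} {σ : E → E'} {s : V → V'} {ω : Config E'}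
    {R A B : Set V} {R' A' B' : Set V'}
    (hg : ∀ e, g' (σ e) = (s (g e).1, s (g e).2) ∨ g' (σ e) = (s (g e).2, s (g e).1))
    (hR : MapsTo s R R') (hA : MapsTo s A A') (hB : MapsTo s B B')
    (h : Conn g (fun e => ω (σ e)) R A B) : Conn g' ω R' A' B' := by
  obtain ⟨u, hu, v, hv, huR, h⟩ := h
  exact ⟨s u, hA hu, s v, hB hv, hR huR, h.relabel hg hR⟩

end Relabel

section Tri

/-- The probability that `A` is connected to `B` inside `R` in the triangular lattice. -/
noncomputable def Pr (p : TriE → ℝ) (R A B : Set Z2) : ℝ := (bern p).real {ω | Conn tg ω R A B}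

/-- A rectangle of lattice points. -/
def rect (x0 x1 y0 y1 : ℤ) : Set Z2 := {z | x0 ≤ z.1 ∧ z.1 ≤ x1 ∧ y0 ≤ z.2 ∧ z.2 ≤ y1}

lemma rect_finite (x0 x1 y0 y1 : ℤ) : (rect x0 x1 y0 y1).Finite :=
  ((Set.finite_Icc x0 x1).prod (Set.finite_Icc y0 y1)).subset
    fun z hz => ⟨⟨hz.1, hz.2.1⟩, hz.2.2⟩

lemma box_finite (m n : ℕ) : (box m n).Finite := rect_finite 0 m 0 n

lemma inner_tg_finite {R : Set Z2} (hR : R.Finite) : (inner tg R).Finite := by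
  refine ((hR.prod (Set.finite_univ (α := Fin 3))).image fun x : Z2 × Fin 3 =>
    ((if x.2 = 1 then x.1.1 - 1 else x.1.1, x.1.2, x.2) : TriE)).subset fun e he => ?_
  refine ⟨((tg e).1, e.2.2), ⟨he.1, trivial⟩, ?_⟩
  induction e using tri_induct <;> simp

lemma fd_conn {R : Set Z2} (hR : R.Finite) (A B : Set Z2) : Fd {ω | Conn tg ω R A B} :=
  (dep_conn tg R A B).fd (inner_tg_finite hR)

lemma Pr_mono {p : TriE → ℝ} {R A B R' A' B' : Set Z2} (hR : R ⊆ R') (hA : A ⊆ A') (hB : B ⊆ B') :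
    Pr p R A B ≤ Pr p R' A' B' :=
  measureReal_mono fun _ h => h.mono le_rfl hR hA hB

lemma Pr_nonneg (p : TriE → ℝ) (R A B : Set Z2) : 0 ≤ Pr p R A B := measureReal_nonneg

lemma Pr_le_one (p : TriE → ℝ) (R A B : Set Z2) : Pr p R A B ≤ 1 := measureReal_le_one

lemma Pr_relabel_le {p p' : TriE → ℝ} {σ : TriE → TriE} (hσ : Function.Injective σ) {s : Z2 → Z2}
    {R A B R' A' B' : Set Z2}
    (hg : ∀ e, tg (σ e) = (s (tg e).1, s (tg e).2) ∨ tg (σ e) = (s (tg e).2, s (tg e).1))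
    (hp : ∀ e, p' (σ e) = p e) (hRf : R.Finite)
    (hR : MapsTo s R R') (hA : MapsTo s A A') (hB : MapsTo s B B') :
    Pr p R A B ≤ Pr p' R' A' B' := by
  have := bern_relabel p' σ hσ (fd_conn hRf A B).measurableSet
  simp only [hp] at this
  rw [Pr, ← this]
  exact measureReal_mono fun ω h => Conn.relabel hg hR hA hB h

/-- Translation of edges. -/
def shift (w : Z2) (e : TriE) : TriE := (e.1 + w.1, e.2.1 + w.2, e.2.2)

lemma shift_injective (w : Z2) : Function.Injective (shift w) := by
  rintro ⟨a, b, i⟩ ⟨a', b', i'⟩ h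
  simp only [shift, Prod.mk.injEq] at h ⊢
  omega

lemma tg_shift (w : Z2) (e : TriE) : tg (shift w e) = ((tg e).1 + w, (tg e).2 + w) := by
  obtain ⟨w1, w2⟩ := w
  induction e using tri_induct <;> simp [shift] <;> omega

/-- Invariance of the intensities under all translations. -/
def TInv (p : TriE → ℝ) : Prop := ∀ w e, p (shift w e) = p e

lemma tInv_triInt (p0 p1 p2 : ℝ) : TInv (triInt p0 p1 p2) := fun w e => rfl

lemma Pr_shift_le {p : TriE → ℝ} {w : Z2} (hp : ∀ e, p (shift w e) = p e)
    {R A B R' A' B' : Set Z2} (hRf : R.Finite)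
    (hR : MapsTo (· + w) R R') (hA : MapsTo (· + w) A A') (hB : MapsTo (· + w) B B') :
    Pr p R A B ≤ Pr p R' A' B' :=
  Pr_relabel_le (shift_injective w) (fun e => Or.inl (tg_shift w e)) hp hRf hR hA hB

/-- The probability of a horizontal crossing of `[0,m] × [0,n]`. -/
noncomputable def hx (p : TriE → ℝ) (m n : ℕ) : ℝ := Pr p (box m n) {z | z.1 = 0} {z | z.1 = m}

/-- The probability of a vertical crossing of `[0,m] × [0,n]`. -/
noncomputable def vx (p : TriE → ℝ) (m n : ℕ) : ℝ := Pr p (box m n) {z | z.2 = 0} {z | z.2 = n}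

lemma step_fst {ω : Config TriE} {R : Set Z2} {x y : Z2} (h : Step tg ω R x y) :
    |x.1 - y.1| ≤ 1 := by
  have key : ∀ e, |(tg e).1.1 - (tg e).2.1| ≤ 1 := fun e => by
    induction e using tri_induct <;> simp
  obtain ⟨-, -, e, -, hg | hg⟩ := h <;> have := key e <;> rw [hg] at this
  · exact this
  · rwa [abs_sub_comm]

lemma step_snd {ω : Config TriE} {R : Set Z2} {x y : Z2} (h : Step tg ω R x y) :
    |x.2 - y.2| ≤ 1 := by
  have key : ∀ e, |(tg e).1.2 - (tg e).2.2| ≤ 1 := fun e => by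
    induction e using tri_induct <;> simp
  obtain ⟨-, -, e, -, hg | hg⟩ := h <;> have := key e <;> rw [hg] at this
  · exact this
  · rwa [abs_sub_comm]

/-- The up-triangles as blocks of edges. -/
def upBlock : Z2 × Fin 3 ≃ TriE := Equiv.prodAssoc ℤ ℤ (Fin 3)

@[simp] lemma upBlock_apply (a b : ℤ) (i : Fin 3) : upBlock ((a, b), i) = (a, b, i) := rfl

/-- The closure of a configuration in every up-triangle. -/
def clUp (ω : Config TriE) : Config TriE := blockMap upBlock (fun _ => cl) ω

lemma clUp_apply (ω : Config TriE) (a b : ℤ) (i : Fin 3) :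
    clUp ω (a, b, i) = (ω (a, b, i) || (ω (a, b, i + 1) && ω (a, b, i + 2))) := rfl

lemma le_clUp (ω : Config TriE) : ω ≤ clUp ω := by
  rintro ⟨a, b, i⟩
  rw [clUp_apply]
  cases ω (a, b, i) <;> simp

/-- The star–triangle image of a configuration of legs. -/
def stUp (ω : Config TriE) : Config TriE := blockMap upBlock (fun _ => st) ω

lemma stUp_apply (ω : Config TriE) (a b : ℤ) (i : Fin 3) :
    stUp ω (a, b, i) = (ω (a, b, i + 1) && ω (a, b, i + 2)) := rfl

/-- The set `R'` contains all vertices of up-triangles with two vertices in `R`. -/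
def UpClosed (R R' : Set Z2) : Prop :=
  ∀ a b : ℤ, ((a, b) ∈ R → (a + 1, b) ∈ R → (a, b + 1) ∈ R') ∧
    ((a, b) ∈ R → (a, b + 1) ∈ R → (a + 1, b) ∈ R') ∧
    ((a + 1, b) ∈ R → (a, b + 1) ∈ R → (a, b) ∈ R')

lemma Rch.of_clUp {ω : Config TriE} {R R' : Set Z2} {u v : Z2} (hRR : R ⊆ R')
    (hR : UpClosed R R') (h : Rch tg (clUp ω) R u v) : Rch tg ω R' u v := by
  have key : ∀ e, clUp ω e = true → (tg e).1 ∈ R → (tg e).2 ∈ R →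
      Rch tg ω R' (tg e).1 (tg e).2 := by
    intro e he h1 h2
    have two : ∀ e₁ e₂ x y z, ω e₁ = true → ω e₂ = true → x ∈ R' → y ∈ R' → z ∈ R' →
        (tg e₁ = (x, y) ∨ tg e₁ = (y, x)) → (tg e₂ = (y, z) ∨ tg e₂ = (z, y)) →
        Rch tg ω R' x z := fun e₁ e₂ x y z he₁ he₂ hx hy hz hg₁ hg₂ =>
      (Step.rch ⟨hx, hy, e₁, he₁, hg₁⟩).trans (Step.rch ⟨hy, hz, e₂, he₂, hg₂⟩)
    induction e using tri_induct with
    | h0 a b =>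
      simp only [clUp_apply, Bool.or_eq_true, Bool.and_eq_true] at he
      rcases he with he | ⟨he1, he2⟩
      · exact Step.rch ⟨hRR h1, hRR h2, _, he, Or.inl rfl⟩
      · exact two (a, b, 2) (a, b, 1) _ (a, b + 1) _ he2 he1 (hRR h1) ((hR a b).1 h1 h2) (hRR h2)
          (Or.inl rfl) (Or.inr rfl)
    | h1 a b =>
      simp only [clUp_apply, Bool.or_eq_true, Bool.and_eq_true] at he
      rcases he with he | ⟨he1, he2⟩
      · exact Step.rch ⟨hRR h1, hRR h2, _, he, Or.inl rfl⟩
      · exact two (a, b, 0) (a, b, 2) _ (a, b) _ he2 he1 (hRR h1) ((hR a b).2.2 h1 h2) (hRR h2)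
          (Or.inr rfl) (Or.inl rfl)
    | h2 a b =>
      simp only [clUp_apply, Bool.or_eq_true, Bool.and_eq_true] at he
      rcases he with he | ⟨he1, he2⟩
      · exact Step.rch ⟨hRR h1, hRR h2, _, he, Or.inl rfl⟩
      · exact two (a, b, 0) (a, b, 1) _ (a + 1, b) _ he1 he2 (hRR h1) ((hR a b).2.1 h1 h2) (hRR h2)
          (Or.inl rfl) (Or.inl rfl)
  refine Rch.map id (fun x y hxy => ?_) h
  obtain ⟨hx, hy, e, he, hg⟩ := hxy
  have := key e he
  rcases hg with hg | hg <;> rw [hg] at this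
  · exact this hx hy
  · exact (this hy hx).symm

/-- The involution of `TriE` induced by the rotation by `π`, exchanging down-triangles and
vertices of the dual triangular lattice. -/
def flip (e : TriE) : TriE := (-e.1, -e.2.1 - 1, e.2.2)

lemma flip_flip (e : TriE) : flip (flip e) = e := by
  obtain ⟨a, b, i⟩ := e
  simp [flip]

lemma flip_injective : Function.Injective flip := Function.LeftInverse.injective flip_flip

/-- The triangular configuration equivalent to a configuration `η` on the hexagonal lattice. -/
def hexTri (η : Config TriE) : Config TriE := fun e => stUp η (flip e)

/-- The vertex of the dual triangular lattice corresponding to a down-triangle. -/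
def dnPt (z : Z2) : Z2 := (-z.1, -z.2)

/-- Legs of a hexagonal star: the down-triangle at the end of leg `i` of `Up a b`. -/
def dnNb (a b : ℤ) (i : Fin 3) : Z2 := ![(a, b), (a, b + 1), (a - 1, b + 1)] i

lemma hg_eq (a b : ℤ) (i : Fin 3) : hg (a, b, i) = (Up a b, (dnNb a b i, false)) := by
  fin_cases i <;> rfl

lemma hexTri_conn {η : Config TriE} {a b : ℤ} {i j : Fin 3} {R : Set Z2} (hij : i ≠ j)
    (hi : η (a, b, i) = true) (hj : η (a, b, j) = true) (hiR : dnPt (dnNb a b i) ∈ R)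
    (hjR : dnPt (dnNb a b j) ∈ R) :
    Step tg (hexTri η) R (dnPt (dnNb a b i)) (dnPt (dnNb a b j)) := by
  have h : ∀ k, hexTri η (-a, -b - 1, k) = (η (a, b, k + 1) && η (a, b, k + 2)) := by
    intro k; simp [hexTri, flip, stUp_apply]
  refine ⟨hiR, hjR, (-a, -b - 1, if i ≠ 0 ∧ j ≠ 0 then 0 else if i ≠ 1 ∧ j ≠ 1 then 1 else 2), ?_⟩
  fin_cases i <;> fin_cases j <;> first | exact absurd rfl hij | skip
  all_goals
    simp only [Fin.zero_eta, Fin.mk_one, Fin.reduceFinMk] at hi hj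
    simp [h, hi, hj, dnPt, dnNb]
    first | done | omega

/-- Hexagonal connections give connections in the equivalent triangular configuration. -/
lemma Rch.hexTri {η : Config TriE} {R : Set HV} {R' : Set Z2}
    (hR : ∀ z, (z, false) ∈ R → dnPt z ∈ R') {p q : Z2} (hp : (p, false) ∈ R)
    (h : Rch hg η R (p, false) (q, false)) : Rch tg (Perc.hexTri η) R' (dnPt p) (dnPt q) := by
  let P : HV → Prop := fun x => if x.2 then
    ∃ i, η (x.1.1, x.1.2, i) = true ∧ (dnNb x.1.1 x.1.2 i, false) ∈ R ∧
      Rch tg (Perc.hexTri η) R' (dnPt p) (dnPt (dnNb x.1.1 x.1.2 i))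
    else Rch tg (Perc.hexTri η) R' (dnPt p) (dnPt x.1)
  have : P (q, false) := by
    refine h.induct (P := P) (by simp [P, Rch.refl]) ?_
    rintro x y - ⟨hx, hy, ⟨a, b, i⟩, he, hg⟩ hPx
    rw [hg_eq] at hg
    rcases hg with hg | hg <;> simp only [Prod.mk.injEq] at hg <;> obtain ⟨rfl, rfl⟩ := hg
    · simp only [P, if_true, Bool.false_eq_true, if_false] at hPx ⊢
      obtain ⟨j, hj, hjR, hr⟩ := hPx
      by_cases hij : j = i
      · exact hij ▸ hr
      · exact hr.trans (hexTri_conn hij hj he (hR _ hjR) (hR _ hy)).rch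
    · simp only [P, if_true, Bool.false_eq_true, if_false] at hPx ⊢
      exact ⟨i, he, hx, hPx⟩
  simpa [P] using this

/-- Connections in the equivalent triangular configuration give hexagonal connections. -/
lemma Rch.of_hexTri {η : Config TriE} {R : Set Z2} {R' : Set HV}
    (hR : ∀ z ∈ R, (dnPt z, false) ∈ R')
    (hU : ∀ e, (tg e).1 ∈ R → (tg e).2 ∈ R → Up (-e.1) (-e.2.1 - 1) ∈ R') {u v : Z2}
    (h : Rch tg (Perc.hexTri η) R u v) : Rch hg η R' (dnPt u, false) (dnPt v, false) := by
  have key : ∀ e, Perc.hexTri η e = true → (tg e).1 ∈ R → (tg e).2 ∈ R →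
      Rch hg η R' (dnPt (tg e).1, false) (dnPt (tg e).2, false) := by
    intro e he h1 h2
    have hUe := hU e h1 h2
    have two : ∀ i j, η (-e.1, -e.2.1 - 1, i) = true → η (-e.1, -e.2.1 - 1, j) = true →
        dnPt (tg e).1 = dnNb (-e.1) (-e.2.1 - 1) i → dnPt (tg e).2 = dnNb (-e.1) (-e.2.1 - 1) j →
        Rch hg η R' (dnPt (tg e).1, false) (dnPt (tg e).2, false) := by
      intro i j hi hj h3 h4
      have h3' := hR _ h1
      have h4' := hR _ h2
      rw [h3] at h3' ⊢
      rw [h4] at h4' ⊢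
      exact (Step.rch ⟨h3', hUe, _, hi, Or.inr (hg_eq _ _ i)⟩).trans
        (Step.rch ⟨hUe, h4', _, hj, Or.inl (hg_eq _ _ j)⟩)
    obtain ⟨a, b, k⟩ := e
    simp only [Perc.hexTri, flip, stUp_apply, Bool.and_eq_true] at he
    fin_cases k
    · exact two 1 2 he.1 he.2 (by simp [dnPt, dnNb]) (by simp [dnPt, dnNb]; omega)
    · exact two 2 0 he.1 he.2 (by simp [dnPt, dnNb]; omega) (by simp [dnPt, dnNb]; omega)
    · exact two 1 0 he.2 he.1 (by simp [dnPt, dnNb]) (by simp [dnPt, dnNb]; omega)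
  refine Rch.map (fun z => (dnPt z, false)) (fun x y hxy => ?_) h
  obtain ⟨hx, hy, e, he, hg⟩ := hxy
  have := key e he
  rcases hg with hg | hg <;> rw [hg] at this
  · exact this hx hy
  · exact (this hy hx).symm

/-- Admissible critical parameters. -/
def Crit (p0 p1 p2 : ℝ) : Prop :=
  (0 ≤ p0 ∧ p0 ≤ 1) ∧ (0 ≤ p1 ∧ p1 ≤ 1) ∧ (0 ≤ p2 ∧ p2 ≤ 1) ∧ kappaT p0 p1 p2 = 0

lemma Crit.mem {p0 p1 p2 : ℝ} (h : Crit p0 p1 p2) (k : Fin 3) :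
    0 ≤ ![p0, p1, p2] k ∧ ![p0, p1, p2] k ≤ 1 := by
  obtain ⟨h0, h1, h2, -⟩ := h
  fin_cases k <;> simp [h0, h1, h2]

lemma triInt_compl (p0 p1 p2 : ℝ) (e : TriE) :
    triInt (1 - p0) (1 - p1) (1 - p2) e = 1 - triInt p0 p1 p2 e := by
  obtain ⟨a, b, k⟩ := e
  fin_cases k <;> rfl

/-- Star–triangle relation for hexagonal configurations. -/
lemma bern_hexTri {p0 p1 p2 : ℝ} (h : Crit p0 p1 p2) {A : Set (Config TriE)}
    (hA : MeasurableSet A) :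
    (bern (triInt (1 - p0) (1 - p1) (1 - p2))).real {η | hexTri η ∈ A} =
      (bern (triInt p0 p1 p2)).real {ω | clUp ω ∈ A} := by
  have h1 := bern_blockMap_eq (A := A) upBlock (fun _ => cl) (fun _ => st) (triInt p0 p1 p2)
    (triInt (1 - p0) (1 - p1) (1 - p2)) (fun j y => by
      have := star_triangle ![p0, p1, p2] h.mem h.2.2.2 y
      refine this.trans ?_
      congr 2
      ext k
      exact (triInt_compl p0 p1 p2 (upBlock (j, k))).symm)
    hA
  have h2 := bern_relabel (triInt (1 - p0) (1 - p1) (1 - p2)) flip flip_injective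
    (A := {ζ | stUp ζ ∈ A}) (measurable_blockMap upBlock (fun _ => st) hA)
  exact h2.trans h1.symm

end Tri

/-! ### Numerical duality -/

section Neg

variable {E : Type}

lemma bern_neg {p : E → ℝ} (hp : ∀ e, 0 ≤ p e ∧ p e ≤ 1) {A : Set (Config E)} (hA : Fd A) :
    (bern p).real {ω | (fun e => !ω e) ∈ A} = (bern fun e => 1 - p e).real A := by
  classical
  obtain ⟨s, hA⟩ := hA
  induction s using Finset.induction_on generalizing A with
  | empty => rcases hA.empty_cases with rfl | rfl <;> simp
  | insert e s hes ih =>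
    have hneg : Fd {ω : Config E | (fun e => !ω e) ∈ A} :=
      ⟨insert e s, fun ω ω' hw h => hA _ _ (fun x hx => by simp [hw x hx]) h⟩
    rw [bern_cond p e hneg.measurableSet, bern_cond (fun e => 1 - p e) e (Fd.measurableSet ⟨_, hA⟩),
      ← ih (hA.update true), ← ih (hA.update false)]
    have hu : ∀ b, {ω : Config E | Function.update ω e b ∈ {ω | (fun e => !ω e) ∈ A}} =
        {ω | (fun e => !ω e) ∈ {ω | Function.update ω e (!b) ∈ A}} := by
      intro b
      ext ω
      have : (fun x => !(Function.update ω e b x)) = Function.update (fun x => !ω x) e (!b) := by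
        funext x
        by_cases hx : x = e
        · subst hx; simp
        · simp [hx]
      simp [this]
    rw [hu, hu, clamp_of_mem (hp e).1 (hp e).2,
      clamp_of_mem (by linarith [hp e]) (by linarith [hp e])]
    simp only [Bool.not_true, Bool.not_false]
    ring

end Neg

lemma Crit.triInt_mem {p0 p1 p2 : ℝ} (h : Crit p0 p1 p2) (e : TriE) :
    0 ≤ triInt p0 p1 p2 e ∧ triInt p0 p1 p2 e ≤ 1 := h.mem e.2.2

lemma fd_hexTri {A : Set (Config TriE)} (hA : Fd A) : Fd {η | hexTri η ∈ A} := by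
  classical
  obtain ⟨s, hs⟩ := hA
  refine ⟨s.biUnion fun e => Finset.univ.image fun i => (flip (e.1, e.2.1, i)), ?_⟩
  intro ω ω' hw h
  refine hs _ _ (fun e he => ?_) h
  have key : ∀ i, ω (flip (e.1, e.2.1, i)) = ω' (flip (e.1, e.2.1, i)) := fun i =>
    hw _ (by simp only [Finset.coe_biUnion, mem_iUnion]; exact ⟨e, he, by simp⟩)
  change (ω (flip (e.1, e.2.1, e.2.2 + 1)) && ω (flip (e.1, e.2.1, e.2.2 + 2))) =
    (ω' (flip (e.1, e.2.1, e.2.2 + 1)) && ω' (flip (e.1, e.2.1, e.2.2 + 2)))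
  rw [key, key]

lemma bern_dual {p0 p1 p2 : ℝ} (h : Crit p0 p1 p2) {A : Set (Config TriE)} (hA : Fd A) :
    (bern (triInt p0 p1 p2)).real {ω | hexTri (fun e => !ω e) ∈ A} =
      (bern (triInt p0 p1 p2)).real {ω | clUp ω ∈ A} := by
  rw [← bern_hexTri h hA.measurableSet]
  have := bern_neg h.triInt_mem (fd_hexTri hA)
  have he : (fun e => 1 - triInt p0 p1 p2 e) = triInt (1 - p0) (1 - p1) (1 - p2) := by
    funext e; rw [triInt_compl]
  rw [he] at this
  exact this

lemma vx_add_hx_le {p0 p1 p2 : ℝ} (h : Crit p0 p1 p2) (m n : ℕ) :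
    vx (triInt p0 p1 p2) m (n + 1) + hx (triInt p0 p1 p2) (m + 1) n ≤ 1 := by
  set p := triInt p0 p1 p2
  have hRf := rect_finite (-m) 1 (-(n + 1)) (-1)
  set R := rect (-m) 1 (-(n + 1)) (-1) with hR
  have h1 : hx p (m + 1) n ≤
      (bern p).real {ω | Conn tg (hexTri fun e => !ω e) R {z | z.1 = -m} {z | z.1 = 1}} := by
    refine le_trans ?_ (bern_dual h (fd_conn hRf _ _)).ge
    refine (Pr_shift_le (w := (-m, -(n + 1))) (R' := R) (A' := {z | z.1 = -m}) (B' := {z | z.1 = 1})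
      (tInv_triInt _ _ _ _) (box_finite _ _) ?_ ?_ ?_).trans
      (measureReal_mono fun ω hω => hω.mono (le_clUp ω) le_rfl le_rfl le_rfl)
    · rintro z ⟨h1, h2, h3, h4⟩
      simp only [hR, rect, mem_ofPred_eq, Prod.fst_add, Prod.snd_add]
      push_cast at *
      omega
    · intro z hz
      simp only [mem_ofPred_eq, Prod.fst_add] at *
      omega
    · intro z hz
      simp only [mem_ofPred_eq, Prod.fst_add] at *
      push_cast at *
      omega
  have hd : Disjoint {ω | Conn tg ω (box m (n + 1)) {z | z.2 = 0} {z | z.2 = (n + 1 : ℕ)}}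
      {ω | Conn tg (hexTri fun e => !ω e) R {z | z.1 = -m} {z | z.1 = 1}} := by
    rw [Set.disjoint_left]
    rintro ω ⟨u, hu, v, hv, huR, huv⟩ ⟨s, hs, t, ht, hsR, hst⟩
    refine no_dual_crossing (x0 := 0) (x1 := m) (y0 := 0) (y1 := n + 1) huv huR
      (fun z hz => ⟨hz.1, hz.2.1⟩) ⟨0, fun z hz => hz.2.2.1⟩ (le_of_eq hu)
      (by rw [mem_ofPred_eq] at hv; omega)
      (R' := {h | h.2 = true → 0 ≤ h.1.2 ∧ h.1.2 < n + 1}) (fun a b hab => hab rfl)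
      (p := dnPt t) (q := dnPt s) ?_ ?_ (Rch.of_hexTri (R := R) ?_ ?_ hst.symm)
    · simp only [mem_ofPred_eq] at ht; simp [dnPt, ht]
    · simp only [mem_ofPred_eq] at hs; simp [dnPt, hs]
    · intro z hz; simp
    · intro e he1 he2 _
      simp only [hR, rect, mem_ofPred_eq] at he1 he2
      induction e using tri_induct <;> simp at he1 he2 ⊢ <;> omega
  have hm : MeasurableSet
      {ω : Config TriE | Conn tg (hexTri fun e => !ω e) R {z | z.1 = -m} {z | z.1 = 1}} := by
    obtain ⟨s, hs⟩ := fd_hexTri (fd_conn hRf {z | z.1 = -m} {z | z.1 = 1})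
    refine Fd.measurableSet ⟨s, fun ω ω' hw hA => ?_⟩
    exact hs (fun e => !ω e) (fun e => !ω' e) (fun e he => by simp [hw e he]) hA
  have h2 := measureReal_union (μ := bern p) hd hm
  have h3 : (bern p).real ({ω | Conn tg ω (box m (n + 1)) {z | z.2 = 0} {z | z.2 = (n + 1 : ℕ)}} ∪
      {ω | Conn tg (hexTri fun e => !ω e) R {z | z.1 = -m} {z | z.1 = 1}}) ≤ 1 :=
    measureReal_le_one
  rw [h2] at h3
  exact (add_le_add le_rfl h1).trans h3

lemma one_le_vx_add_hx {p0 p1 p2 : ℝ} (h : Crit p0 p1 p2) (m n : ℕ) :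
    1 ≤ vx (triInt p0 p1 p2) m n + hx (triInt p0 p1 p2) m n := by
  set p := triInt p0 p1 p2
  have hRf := rect_finite (-m + 1) 1 (-n) (-1)
  set R := rect (-m + 1) 1 (-n) (-1) with hR
  set V := {ω | Conn tg ω (box m n) {z | z.2 = 0} {z | z.2 = n}} with hV
  have h1 : (bern p).real Vᶜ = 1 - vx p m n := by
    rw [probReal_compl_eq_one_sub (fd_conn (box_finite m n) _ _).measurableSet]; rfl
  have h2 : (bern p).real Vᶜ ≤
      (bern p).real {ω | Conn tg (hexTri fun e => !ω e) R {z | z.1 = 1} {z | z.1 = -m + 1}} := by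
    refine measureReal_mono fun ω hω => ?_
    obtain ⟨⟨s, s'⟩, ⟨rfl, hs⟩, ⟨t, t'⟩, ⟨rfl, ht⟩, hsR, hst⟩ := exists_dual_crossing hω
    have hmap : ∀ z, (z, false) ∈ dbox m n → dnPt z ∈ R := by
      intro z hz
      have := dn_mem_dbox.1 hz
      simp only [hR, rect, dnPt, mem_ofPred_eq]
      omega
    refine ⟨dnPt s, ?_, dnPt t, ?_, hmap _ hsR, hst.hexTri hmap hsR⟩
    · simp only [dnPt, mem_ofPred_eq] at hs ⊢; omega
    · simp only [dnPt, mem_ofPred_eq] at ht ⊢; omega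
  have h3 : (bern p).real {ω | Conn tg (clUp ω) R {z | z.1 = 1} {z | z.1 = -m + 1}} ≤
      Pr p (rect (-m + 1) 1 (-n) 0) {z | z.1 = -m + 1} {z | z.1 = 1} := by
    refine measureReal_mono fun ω hω => ?_
    obtain ⟨s, hs, t, ht, hsR, hst⟩ := hω.symm
    have hRR : R ⊆ rect (-m + 1) 2 (-n) 0 := fun z hz => by
      simp only [hR, rect, mem_ofPred_eq] at hz ⊢; omega
    have hup : UpClosed R (rect (-m + 1) 2 (-n) 0) := by
      intro a b
      simp only [hR, rect, mem_ofPred_eq]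
      omega
    obtain ⟨u, v, hu, hv, -, h4, h5⟩ := (hst.of_clUp hRR hup).trim (φ := fun z => z.1)
      (α := -m + 1) (β := 1) (fun _ _ => step_fst) (by omega) (hRR hsR) (show s.1 = _ from hs).le (show t.1 = _ from ht).ge
    have hsub : rect (-m + 1) 2 (-n) 0 ∩ {x | -m + 1 ≤ x.1 ∧ x.1 ≤ 1} ⊆ rect (-m + 1) 1 (-n) 0 :=
      fun z hz => by simp only [rect, mem_inter_iff, mem_ofPred_eq] at hz ⊢; omega
    exact ⟨u, hu, v, hv, hsub h4, h5.mono le_rfl hsub⟩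
  have h4 : Pr p (rect (-m + 1) 1 (-n) 0) {z | z.1 = -m + 1} {z | z.1 = 1} ≤ hx p m n := by
    refine Pr_shift_le (w := (m - 1, n)) (tInv_triInt _ _ _ _) (rect_finite _ _ _ _) ?_ ?_ ?_
    · intro z hz
      simp only [rect, box, mem_ofPred_eq, Prod.fst_add, Prod.snd_add] at hz ⊢
      omega
    · intro z hz
      simp only [mem_ofPred_eq, Prod.fst_add] at hz ⊢
      omega
    · intro z hz
      simp only [mem_ofPred_eq, Prod.fst_add] at hz ⊢
      omega
  have h5 := bern_dual h (fd_conn hRf {z | z.1 = 1} {z | z.1 = -m + 1})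
  have h6 : (bern p).real {ω | Conn tg (hexTri fun e => !ω e) R {z | z.1 = 1} {z | z.1 = -m + 1}} =
    (bern p).real {ω | Conn tg (clUp ω) R {z | z.1 = 1} {z | z.1 = -m + 1}} := h5
  linarith

/-! ### The square lattice -/

section Square

/-- The square lattice as a graph, with degenerate edges of class `1`. -/
def sg (e : TriE) : Z2 × Z2 := if e.2.2 = 1 then ((e.1, e.2.1), (e.1, e.2.1)) else tg e

@[simp] lemma sg_zero (a b : ℤ) : sg (a, b, 0) = ((a, b), (a + 1, b)) := rfl
@[simp] lemma sg_one (a b : ℤ) : sg (a, b, 1) = ((a, b), (a, b)) := rfl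
@[simp] lemma sg_two (a b : ℤ) : sg (a, b, 2) = ((a, b), (a, b + 1)) := rfl

open Classical in
/-- The restriction of a configuration to a set of edges. -/
noncomputable def res {E : Type} (N : Set E) (ω : Config E) : Config E :=
  fun e => ω e && decide (e ∈ N)

@[simp] lemma res_eq_true {E : Type} {N : Set E} {ω : Config E} {e : E} :
    res N ω e = true ↔ ω e = true ∧ e ∈ N := by simp [res]

lemma res_le {E : Type} (N : Set E) (ω : Config E) : res N ω ≤ ω := fun e => by
  by_cases h : res N ω e = true
  · exact (res_eq_true.1 h).1 ▸ Bool.le_true _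
  · rw [Bool.not_eq_true] at h; rw [h]; exact Bool.false_le _

/-- The edges of the square lattice. -/
def Sq : Set TriE := {e | e.2.2 ≠ 1}

lemma rch_sg_iff {ω : Config TriE} {R : Set Z2} {u v : Z2} :
    Rch sg ω R u v ↔ Rch tg (res Sq ω) R u v := by
  constructor
  · refine fun h => Rch.map id (fun x y hxy => ?_) h
    obtain ⟨hx, hy, e, he, hg⟩ := hxy
    by_cases hc : e.2.2 = 1
    · simp only [sg, hc, if_true, Prod.mk.injEq] at hg
      have : x = y := by
        rcases hg with hg | hg
        · exact hg.1.symm.trans hg.2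
        · exact hg.2.symm.trans hg.1
      exact this ▸ Rch.refl
    · simp only [sg, hc, if_false] at hg
      exact Step.rch ⟨hx, hy, e, res_eq_true.2 ⟨he, hc⟩, hg⟩
  · refine fun h => Rch.map id (fun x y hxy => ?_) h
    obtain ⟨hx, hy, e, he, hg⟩ := hxy
    obtain ⟨he, hc⟩ := res_eq_true.1 he
    exact Step.rch ⟨hx, hy, e, he, by rw [sg, if_neg hc]; exact hg⟩

lemma conn_sg_iff {ω : Config TriE} {R A B : Set Z2} :
    Conn sg ω R A B ↔ Conn tg (res Sq ω) R A B := by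
  simp only [Conn, rch_sg_iff]

lemma ae_res_sq {p : TriE → ℝ} (hp : ∀ e, e.2.2 = 1 → p e = 0) :
    ∀ᵐ ω ∂(bern p), res Sq ω = ω := by
  classical
  have h : ∀ᵐ ω ∂(bern p), ∀ e : TriE, e.2.2 = 1 → ω e = false := by
    rw [ae_all_iff]
    intro e
    by_cases hc : e.2.2 = 1
    · have hm : MeasurableSet {ω : Config TriE | ω e = true} :=
        Fd.measurableSet ⟨{e}, fun ω ω' hw h => by
          rw [mem_ofPred_eq, ← hw e (by simp)]; exact h⟩
      have := bern_cond p e hm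
      simp [hp e hc, clamp] at this
      rw [ae_iff]
      simpa [hc, measureReal_eq_zero_iff] using this
    · exact ae_of_all _ fun ω h => absurd h hc
  filter_upwards [h] with ω hω
  funext e
  by_cases hc : e.2.2 = 1
  · rw [hω e hc]; simp [res, hω e hc]
  · simp [res, Sq, hc]

lemma real_conn_sg {p : TriE → ℝ} (hp : ∀ e, e.2.2 = 1 → p e = 0) (R A B : Set Z2) :
    (bern p).real {ω | Conn sg ω R A B} = Pr p R A B := by
  refine measureReal_congr ?_
  filter_upwards [ae_res_sq hp] with ω hω
  refine propext ?_
  change Conn sg ω R A B ↔ Conn tg ω R A B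
  rw [conn_sg_iff, hω]

lemma inner_sg_finite {R : Set Z2} (hR : R.Finite) : (inner sg R).Finite := by
  refine ((hR.prod (Set.finite_univ (α := Fin 3))).image fun x : Z2 × Fin 3 =>
    ((x.1.1, x.1.2, x.2) : TriE)).subset fun e he => ?_
  refine ⟨((e.1, e.2.1), e.2.2), ⟨?_, trivial⟩, rfl⟩
  have : (sg e).1 ∈ R := he.1
  by_cases hc : e.2.2 = 1
  · simpa [sg, hc] using this
  · obtain ⟨a, b, i⟩ := e
    fin_cases i
    · exact this
    · exact absurd rfl hc
    · exact this

lemma fd_conn_sg {R : Set Z2} (hR : R.Finite) (A B : Set Z2) : Fd {ω | Conn sg ω R A B} :=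
  (dep_conn sg R A B).fd (inner_sg_finite hR)

/-! #### Exploration from the left side of a box -/

/-- The edges of the square lattice inside `box n n`. -/
def Inn (n : ℕ) : Set TriE := {e | e ∈ Sq ∧ (tg e).1 ∈ box n n ∧ (tg e).2 ∈ box n n}

/-- The faces reached from the left side of `box n n`. -/
def Wt (n : ℕ) (ω : Config TriE) : Set HV :=
  {h | ∃ s ∈ dbox (n + 1) n, s.2 = false ∧ s.1.1 = -1 ∧
    Rch hg (fun e => !res (Inn n) ω e) (dbox (n + 1) n) s h}

/-- The edges revealed by the exploration. -/
def Exl (n : ℕ) (w : Set HV) : Set TriE :=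
  {e | (hg e).1 ∈ dbox (n + 1) n ∧ (hg e).2 ∈ dbox (n + 1) n ∧ ((hg e).1 ∈ w ∨ (hg e).2 ∈ w)}

/-- The boundary of the explored set. -/
def Bdl (n : ℕ) (w : Set HV) : Set TriE :=
  {e | (hg e).1 ∈ dbox (n + 1) n ∧ (hg e).2 ∈ dbox (n + 1) n ∧ ((hg e).1 ∈ w ↔ (hg e).2 ∉ w)}

lemma wt_subset (n : ℕ) (ω : Config TriE) : Wt n ω ⊆ dbox (n + 1) n := by
  rintro h ⟨s, hs, -, -, hr⟩
  exact hr.mem hs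

lemma wt_step {n : ℕ} {ω : Config TriE} {x y : HV} (hx : x ∈ Wt n ω)
    (h : Step hg (fun e => !res (Inn n) ω e) (dbox (n + 1) n) x y) : y ∈ Wt n ω := by
  obtain ⟨s, hs, h1, h2, hr⟩ := hx
  exact ⟨s, hs, h1, h2, hr.trans h.rch⟩

lemma wt_induct {n : ℕ} {ω : Config TriE} {P : HV → Prop}
    (h0 : ∀ b, Dn (-1) b ∈ dbox (n + 1) n → P (Dn (-1) b))
    (h1 : ∀ x y, P x → Step hg (fun e => !res (Inn n) ω e) (dbox (n + 1) n) x y → P y)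
    {x : HV} (hx : x ∈ Wt n ω) : P x := by
  obtain ⟨⟨⟨a, b⟩, t⟩, hs, rfl, rfl, hr⟩ := hx
  exact hr.induct (h0 b hs) fun x y _ hxy hx => h1 x y hx hxy

lemma mem_exl_of_step {n : ℕ} {w : Set HV} {ω : Config TriE} {x y : HV} (hx : x ∈ w)
    (h : Step hg ω (dbox (n + 1) n) x y) :
    ∃ e ∈ Exl n w, ω e = true ∧ (hg e = (x, y) ∨ hg e = (y, x)) := by
  obtain ⟨hxd, hyd, e, he, hg⟩ := h
  refine ⟨e, ?_, he, hg⟩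
  rcases hg with hg | hg <;> simp [Exl, hg, hxd, hyd, hx]

lemma dep_wt (n : ℕ) (w : Set HV) : Dep (Exl n w) {ω | Wt n ω = w} := by
  rintro ω ω' hw rfl
  have hres : ∀ e ∈ Exl n (Wt n ω), res (Inn n) ω e = res (Inn n) ω' e := fun e he => by
    simp [res, hw e he]
  change Wt n ω' = Wt n ω
  refine Subset.antisymm (fun x hx => ?_) (fun x hx => ?_)
  · refine wt_induct (P := fun x => x ∈ Wt n ω) ?_ ?_ hx
    · intro b hb
      exact ⟨_, hb, rfl, rfl, Rch.refl⟩
    · intro x y hx hxy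
      obtain ⟨e, he, heω, hg⟩ := mem_exl_of_step hx hxy
      refine wt_step hx ⟨hxy.1, hxy.2.1, e, ?_, hg⟩
      change (!res (Inn n) ω e) = true
      rw [hres e he]; exact heω
  · refine (wt_induct (P := fun x => x ∈ Wt n ω ∧ x ∈ Wt n ω') ?_ ?_ hx).2
    · intro b hb
      exact ⟨⟨_, hb, rfl, rfl, Rch.refl⟩, ⟨_, hb, rfl, rfl, Rch.refl⟩⟩
    · rintro x y ⟨hx, hx'⟩ hxy
      refine ⟨wt_step hx hxy, ?_⟩
      obtain ⟨e, he, heω, hg⟩ := mem_exl_of_step hx hxy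
      refine wt_step hx' ⟨hxy.1, hxy.2.1, e, ?_, hg⟩
      change (!res (Inn n) ω' e) = true
      rw [← hres e he]; exact heω

lemma bdl_open {n : ℕ} {ω : Config TriE} {e : TriE} (he : e ∈ Bdl n (Wt n ω)) :
    ω e = true ∧ e ∈ Inn n := by
  by_contra hc
  rw [← res_eq_true, Bool.not_eq_true] at hc
  obtain ⟨h1, h2, h3⟩ := he
  by_cases h : (hg e).1 ∈ Wt n ω
  · exact h3.1 h (wt_step h ⟨h1, h2, e, by simp [hc], Or.inl rfl⟩)
  · have h4 : (hg e).2 ∈ Wt n ω := by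
      by_contra h4
      exact h (h3.2 h4)
    exact h (wt_step h4 ⟨h2, h1, e, by simp [hc], Or.inr rfl⟩)

/-- The exploration does not reach the right side. -/
def Good (n : ℕ) (w : Set HV) : Prop := ∀ b, Dn n b ∉ w

lemma good_of_conn {n : ℕ} {ω : Config TriE}
    (h : Conn sg ω (box n n) {z | z.2 = 0} {z | z.2 = n}) : Good n (Wt n ω) := by
  rintro b ⟨⟨⟨a, b'⟩, t⟩, hs, rfl, rfl, hr⟩
  obtain ⟨u, hu, v, hv, huR, huv⟩ := h
  rw [rch_sg_iff] at huv
  refine no_dual_crossing (x0 := 0) (x1 := n) (y0 := 0) (y1 := n) (ω := res (Inn n) ω)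
    (R := box n n) (u := u) (v := v) ?_ huR (fun z hz => ⟨hz.1, hz.2.1⟩) ⟨0, fun z hz => hz.2.2.1⟩
    (le_of_eq hu) (ge_of_eq hv) (fun a b hab => ?_) ?_ ?_ hr
  · refine Rch.map id (fun x y hxy => Step.rch ?_) huv
    obtain ⟨hx, hy, e, he, hg⟩ := hxy
    obtain ⟨he, hc⟩ := res_eq_true.1 he
    refine ⟨hx, hy, e, res_eq_true.2 ⟨he, hc, ?_⟩, hg⟩
    rcases hg with hg | hg <;> rw [hg]
    · exact ⟨hx, hy⟩
    · exact ⟨hy, hx⟩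
  · exact (up_mem_dbox.1 hab).2.2
  · simp
  · simp

open Classical in
/-- The configuration with open edges `N`. -/
noncomputable def ind (N : Set TriE) : Config TriE := fun e => decide (e ∈ N)

@[simp] lemma ind_eq_true {N : Set TriE} {e : TriE} : ind N e = true ↔ e ∈ N := by simp [ind]

/-- The boundary of an exploration contains a vertical crossing. -/
lemma Good.exists_path {n : ℕ} (hn : 0 < n) {ω : Config TriE} (h : Good n (Wt n ω)) :
    ∃ u v : Z2, u.2 = 0 ∧ v.2 = n ∧ u ∈ box n n ∧ Rch tg (ind (Bdl n (Wt n ω))) (box n n) u v := by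
  have h1 : Conn tg (ind (Bdl n (Wt n ω))) (box (n + 1) n) {z | z.2 = 0} {z | z.2 = n} := by
    by_contra hc
    obtain ⟨⟨⟨a, b⟩, t⟩, ⟨rfl, rfl⟩, ⟨⟨a', b'⟩, t'⟩, ⟨rfl, h2⟩, hd, hr⟩ := exists_dual_crossing hc
    have : Dn a' b' ∈ Wt n ω := by
      refine hr.induct (P := fun x => x ∈ Wt n ω) ⟨_, hd, rfl, rfl, Rch.refl⟩ ?_
      rintro x y - ⟨hx, hy, e, he, hg⟩ hxw
      by_contra hyw
      have : e ∈ Bdl n (Wt n ω) := by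
        rcases hg with hg | hg <;> simp [Bdl, hg, hx, hy, hxw, hyw]
      simp [ind_eq_true.2 this] at he
    have ha : a' = n := by simpa using h2
    exact h b' (ha ▸ this)
  obtain ⟨u, hu, v, hv, huR, huv⟩ := h1
  have key : ∀ x y, Step tg (ind (Bdl n (Wt n ω))) (box (n + 1) n) x y →
      Step tg (ind (Bdl n (Wt n ω))) (box n n) x y := by
    rintro x y ⟨-, -, e, he, hg⟩
    have hi := (bdl_open (ind_eq_true.1 he)).2
    refine ⟨?_, ?_, e, he, hg⟩ <;> rcases hg with hg | hg <;> have := hi.2 <;> rw [hg] at this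
    exacts [this.1, this.2, this.2, this.1]
  refine ⟨u, v, hu, hv, ?_, Rch.map id (fun x y hxy => (key x y hxy).rch) huv⟩
  rcases Relation.ReflTransGen.cases_head huv with rfl | ⟨x, hx, -⟩
  · simp only [mem_ofPred_eq] at hu hv; omega
  · exact (key _ _ hx).1

end Square

section Reflect

/-- Reflection of the plane in the row `n`. -/
def rf (n : ℕ) (z : Z2) : Z2 := (z.1, 2 * n - z.2)

/-- Reflection of the edges of the square lattice in the row `n`. -/
def rfE (n : ℕ) (e : TriE) : TriE := (e.1, 2 * n - e.2.1 - (if e.2.2 = 2 then 1 else 0), e.2.2)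

@[simp] lemma rf_rf (n : ℕ) (z : Z2) : rf n (rf n z) = z := by simp [rf]

@[simp] lemma rfE_rfE (n : ℕ) (e : TriE) : rfE n (rfE n e) = e := by
  obtain ⟨a, b, i⟩ := e
  by_cases h : i = 2 <;> simp [rfE, h] <;> ring

lemma sg_rfE (n : ℕ) (e : TriE) :
    sg (rfE n e) = (rf n (sg e).1, rf n (sg e).2) ∨ sg (rfE n e) = (rf n (sg e).2, rf n (sg e).1) := by
  induction e using tri_induct <;> (simp [rfE, rf]; try omega)

lemma tg_rfE (n : ℕ) {e : TriE} (he : e ∈ Sq) :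
    tg (rfE n e) = (rf n (tg e).1, rf n (tg e).2) ∨ tg (rfE n e) = (rf n (tg e).2, rf n (tg e).1) := by
  induction e using tri_induct
  · simp [rfE, rf]
  · exact absurd rfl he
  · simp [rfE, rf]; omega

lemma clearAt_extend {c : TriE → ZMod 2} {u v y : Z2} {Q : Set Z2}
    (hc : ∀ e, c e ≠ 0 → (tg e).1 ∈ Q ∧ (tg e).2 ∈ Q) (hu : u ∈ Q) (hv : v ∈ Q) (hy : y ∉ Q)
    (h1 : u.2 ≤ y.2) (h2 : y.2 ≤ v.2) : ClearAt (extend c u v) y := by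
  have hyu : y ≠ u := by rintro rfl; exact hy hu
  have hyv : y ≠ v := by rintro rfl; exact hy hv
  refine clearAt_of fun e he => ?_
  have h0 : c e = 0 := by
    by_contra h0
    have := hc e h0
    rcases he with he | he
    · exact hy (he ▸ this.1)
    · exact hy (he ▸ this.2)
  obtain ⟨y1, y2⟩ := y
  rw [extend, h0, if_neg, if_neg]
  · simp
  · obtain ⟨a, b, i⟩ := e
    rintro ⟨rfl, h3, h4⟩
    simp only [tg_two] at he h3 h4
    obtain ⟨v1, v2⟩ := v
    simp only [Prod.mk.injEq, ne_eq] at he hyv h1 h2 h3 h4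
    omega
  · obtain ⟨a, b, i⟩ := e
    rintro ⟨rfl, h3, h4⟩
    simp only [tg_two] at he h3 h4
    obtain ⟨u1, u2⟩ := u
    simp only [Prod.mk.injEq, ne_eq] at he hyu h1 h2 h3 h4
    omega

lemma ClearAt.edge_faces {d : TriE → ZMod 2} {f : HV → ZMod 2}
    (hf : ∀ e, f (hg e).1 + f (hg e).2 = d e) {e : TriE} {x : Z2} (h : ClearAt d x)
    (hx : (tg e).1 = x ∨ (tg e).2 = x) :
    f (hg e).1 = f (Up x.1 x.2) ∧ f (hg e).2 = f (Up x.1 x.2) := by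
  induction e using tri_induct with
  | h0 a b =>
    rcases hx with rfl | rfl <;> obtain ⟨k1, k2, k3, k4, k5⟩ := h.faces hf <;>
      simp only [add_sub_cancel_right] at * <;> simp [*]
  | h1 a b =>
    rcases hx with rfl | rfl <;> obtain ⟨k1, k2, k3, k4, k5⟩ := h.faces hf <;>
      simp only [add_sub_cancel_right] at * <;> simp [*]
  | h2 a b =>
    rcases hx with rfl | rfl <;> obtain ⟨k1, k2, k3, k4, k5⟩ := h.faces hf <;>
      simp only [add_sub_cancel_right] at * <;> simp [*]

/-- The cluster of `u` formed by the boundary of an exploration. -/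
def Gam (n : ℕ) (w : Set HV) (u : Z2) : Set Z2 := {z | Rch tg (ind (Bdl n w)) (box n n) u z}

/-- The edges neither explored nor reflections of explored edges. -/
def Free (n : ℕ) (w : Set HV) : Set TriE := {e | e ∉ Exl n w ∧ rfE n e ∉ Exl n w}

lemma rfE_mem_free {n : ℕ} {w : Set HV} {e : TriE} : rfE n e ∈ Free n w ↔ e ∈ Free n w := by
  simp [Free, and_comm]

/-- A crossing of the doubled box, seen from the right, hits the boundary of the exploration or its
reflection before using explored edges. -/
lemma exists_free_path {n : ℕ} (hn : 0 < n) {ω ω' : Config TriE} {u v s t : Z2} (hu : u.2 = 0)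
    (hv : v.2 = n) (huR : u ∈ box n n)
    (huv : Rch tg (ind (Bdl n (Wt n ω))) (box n n) u v)
    (hs : s.1 = 0) (ht : t.1 = (2 * n : ℕ)) (hsR : s ∈ box (2 * n) (2 * n))
    (h : Rch sg ω' (box (2 * n) (2 * n)) s t) :
    ∃ z, (z ∈ Gam n (Wt n ω) u ∨ rf n z ∈ Gam n (Wt n ω) u) ∧
      Rch sg (res (Free n (Wt n ω)) ω') (box (2 * n) (2 * n)) z t := by
  set w := Wt n ω with hw
  set Γ := Gam n w u with hΓ
  let Q : Set Z2 := {z | z ∈ Γ ∨ rf n z ∈ Γ}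
  have hQr : ∀ z, rf n z ∈ Q ↔ z ∈ Q := fun z => by
    simp only [Q, mem_ofPred_eq, rf_rf]; exact or_comm
  have hΓbox : ∀ z ∈ Γ, z ∈ box n n := fun z hz => Rch.mem hz huR
  have hQc : ∀ z ∈ Q, 0 ≤ z.1 ∧ z.1 ≤ n ∧ 0 ≤ z.2 ∧ z.2 ≤ 2 * n := by
    rintro z (hz | hz)
    · have := hΓbox z hz
      simp only [box, mem_ofPred_eq] at this
      omega
    · have := hΓbox _ hz
      simp only [box, rf, mem_ofPred_eq] at this
      omega
  let β : Config TriE := ind {e | e ∈ Bdl n w ∨ rfE n e ∈ Bdl n w}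
  have h1 : Rch tg β Q u v := by
    refine huv.induct (P := fun y => Rch tg β Q u y) Rch.refl ?_
    rintro x y hux hxy ih
    obtain ⟨hx, hy, e, he, hg⟩ := hxy
    refine ih.trans (Step.rch ⟨Or.inl hux, Or.inl (hux.trans (Step.rch ⟨hx, hy, e, he, hg⟩)), e, ?_,
      hg⟩)
    simp only [β, ind_eq_true] at he ⊢
    exact Or.inl he
  have h2 : Rch tg β Q (rf n u) (rf n v) := by
    refine huv.induct (P := fun y => Rch tg β Q (rf n u) (rf n y)) Rch.refl ?_
    rintro x y hux hxy ih
    obtain ⟨hx, hy, e, he, hg⟩ := hxy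
    refine ih.trans (Step.rch ⟨(hQr _).2 (Or.inl hux),
      (hQr _).2 (Or.inl (hux.trans (Step.rch ⟨hx, hy, e, he, hg⟩))), rfE n e, ?_, ?_⟩)
    · simp only [β, ind_eq_true, mem_ofPred_eq, rfE_rfE] at he ⊢
      exact Or.inr he
    · have := tg_rfE n (bdl_open (ind_eq_true.1 he)).2.1
      rcases hg with hg | hg <;> rw [hg] at this
      · exact this
      · exact this.symm
  have hvv : rf n v = v := by
    ext
    · rfl
    · simp only [rf]; omega
  rw [hvv] at h2
  have hru : (rf n u).2 = 2 * n := by simp only [rf]; omega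
  have huQ : u ∈ Q := Or.inl Rch.refl
  have hruQ : rf n u ∈ Q := (hQr _).2 huQ
  obtain ⟨c, f, hc, hf, f1, f2, f3, f4⟩ := (h1.trans h2.symm).exists_potential huQ
    (fun z hz => ⟨(hQc z hz).1, (hQc z hz).2.1⟩) ⟨0, fun z hz => (hQc z hz).2.2.1⟩
  have hrow : ∀ e ∈ Bdl n w, (tg e).1.2 ≤ n ∧ (tg e).2.2 ≤ n := fun e he => by
    have := (bdl_open he).2.2
    exact ⟨this.1.2.2.2, this.2.2.2.2⟩
  -- the potential vanishes on the explored faces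
  have hw0 : ∀ x ∈ w, f x = 0 := by
    intro x hx
    refine (wt_induct (P := fun x => x ∈ w ∧ f x = 0) ?_ ?_ hx).2
    · intro b hb
      exact ⟨⟨_, hb, rfl, rfl, Rch.refl⟩, f2 _ _ (by omega)⟩
    · rintro x y ⟨hx, hx0⟩ hxy
      have hyw := wt_step hx hxy
      refine ⟨hyw, ?_⟩
      obtain ⟨hxd, hyd, e, he, hg⟩ := hxy
      have hd0 : extend c u (rf n u) e = 0 := by
        have hb : (Perc.hg e).1 ∈ dbox (n + 1) n ∧ (Perc.hg e).1 ∈ w ∧ (Perc.hg e).2 ∈ w := by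
          rcases hg with hg | hg <;> rw [hg]
          exacts [⟨hxd, hx, hyw⟩, ⟨hyd, hyw, hx⟩]
        have hrow' : 0 ≤ e.2.1 ∧ e.2.1 < n := by
          have : Up e.1 e.2.1 ∈ dbox (n + 1) n := by
            have := hb.1
            obtain ⟨a, b, i⟩ := e
            rwa [hg_eq] at this
          exact (up_mem_dbox.1 this).2.2
        rw [extend_eq_of (by omega) (by omega)]
        by_contra h0
        have := (hc e h0).1
        simp only [β, ind_eq_true, mem_ofPred_eq] at this
        rcases this with this | this
        · exact this.2.2.1 hb.2.1 hb.2.2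
        · have h3 := hrow _ this
          have h4 := (bdl_open this).2.1
          induction e using tri_induct
          · simp [rfE] at h3 hrow'; omega
          · exact h4 rfl
          · simp [rfE] at h3 hrow'; omega
      have := hf e
      rw [hd0] at this
      rcases hg with hg | hg <;> rw [hg] at this <;> simp [hx0] at this <;> exact this
  have hclear : ∀ y, y ∉ Q → y ∈ box (2 * n) (2 * n) → ClearAt (extend c u (rf n u)) y := by
    intro y hy hyR
    refine clearAt_extend (fun e he => ⟨(hc e he).2.1, (hc e he).2.2.1⟩) huQ hruQ hy ?_ ?_
    · have := hyR.2.2.1; omega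
    · have := hyR.2.2.2; push_cast at this; omega
  have hrR : ∀ y ∈ box (2 * n) (2 * n), rf n y ∈ box (2 * n) (2 * n) := by
    intro y hy
    simp only [box, rf, mem_ofPred_eq] at hy ⊢
    push_cast at *
    omega
  have hexl : ∀ e ∈ Exl n w, ∀ y, y ∉ Q → y ∈ box (2 * n) (2 * n) → f (Up y.1 y.2) = 1 →
      (tg e).1 = y ∨ (tg e).2 = y → False := by
    intro e he y hy hyR h1 hey
    have := (hclear y hy hyR).edge_faces hf hey
    rcases he.2.2 with h2 | h2
    · exact zero_ne_one ((hw0 _ h2).symm.trans (this.1.trans h1))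
    · exact zero_ne_one ((hw0 _ h2).symm.trans (this.2.trans h1))
  have main : ∀ x, Rch sg ω' (box (2 * n) (2 * n)) t x →
      (∃ z ∈ Q, Rch sg (res (Free n w) ω') (box (2 * n) (2 * n)) z t) ∨
      (x ∉ Q ∧ x ∈ box (2 * n) (2 * n) ∧ f (Up x.1 x.2) = 1 ∧
        f (Up (rf n x).1 (rf n x).2) = 1 ∧
        Rch sg (res (Free n w) ω') (box (2 * n) (2 * n)) x t) := by
    intro x hx
    refine hx.induct (P := fun x => (∃ z ∈ Q, Rch sg (res (Free n w) ω') _ z t) ∨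
      (x ∉ Q ∧ x ∈ box (2 * n) (2 * n) ∧ f (Up x.1 x.2) = 1 ∧ f (Up (rf n x).1 (rf n x).2) = 1 ∧
        Rch sg (res (Free n w) ω') _ x t)) ?_ ?_
    · refine Or.inr ⟨fun hq => ?_, h.mem hsR, f3 _ _ ?_, f3 _ _ ?_, Rch.refl⟩
      · have := (hQc t hq).2.1
        push_cast at ht; omega
      · push_cast at ht; omega
      · simp only [rf]; push_cast at ht; omega
    · rintro x y - hxy (hx | ⟨hxQ, hxR, hfx, hfrx, hxt⟩)
      · exact Or.inl hx
      obtain ⟨-, hyR, e, he, hg⟩ := hxy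
      by_cases hcl : e ∈ Sq
      swap
      · simp only [Sq, mem_ofPred_eq, ne_eq, not_not] at hcl
        simp only [sg, hcl, if_true, Prod.mk.injEq] at hg
        have : x = y := by
          rcases hg with hg | hg
          · exact hg.1.symm.trans hg.2
          · exact hg.2.symm.trans hg.1
        subst this
        exact Or.inr ⟨hxQ, hxR, hfx, hfrx, hxt⟩
      have hgt : tg e = (x, y) ∨ tg e = (y, x) := by rwa [sg, if_neg hcl] at hg
      have hgr : tg (rfE n e) = (rf n x, rf n y) ∨ tg (rfE n e) = (rf n y, rf n x) := by
        have := tg_rfE n hcl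
        rcases hgt with hg | hg <;> rw [hg] at this
        · exact this
        · exact this.symm
      have hrxQ : rf n x ∉ Q := fun hq => hxQ ((hQr x).1 hq)
      have hfree : e ∈ Free n w := by
        refine ⟨fun hE => hexl e hE x hxQ hxR hfx ?_,
          fun hE => hexl _ hE (rf n x) hrxQ (hrR _ hxR) hfrx ?_⟩
        · rcases hgt with hg | hg <;> simp [hg]
        · rcases hgr with hg | hg <;> simp [hg]
      have hyt : Rch sg (res (Free n w) ω') (box (2 * n) (2 * n)) y t :=
        (Step.rch ⟨hyR, hxR, e, res_eq_true.2 ⟨he, hfree⟩, hg.symm⟩).trans hxt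
      by_cases hyQ : y ∈ Q
      · exact Or.inl ⟨y, hyQ, hyt⟩
      have hryQ : rf n y ∉ Q := fun hq => hyQ ((hQr y).1 hq)
      refine Or.inr ⟨hyQ, hyR, ?_, ?_, hyt⟩
      · rw [← hfx]
        exact (Step.potential (ω := fun _ => true) (R := univ) hf
          ⟨trivial, trivial, e, rfl, hgt⟩ (hclear x hxQ hxR) (hclear y hyQ hyR)).symm
      · rw [← hfrx]
        exact (Step.potential (ω := fun _ => true) (R := univ) hf
          ⟨trivial, trivial, _, rfl, hgr⟩ (hclear _ hrxQ (hrR _ hxR))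
          (hclear _ hryQ (hrR _ hyR))).symm
  rcases main s h.symm with ⟨z, hz, hzt⟩ | ⟨hsQ, -, hfs, -⟩
  · exact ⟨z, hz, hzt⟩
  · have := ((hclear s hsQ hsR).faces hf).2.1
    rw [hfs, f1 _ _ (by omega)] at this
    exact absurd this zero_ne_one

end Reflect

section Junction

lemma Dep.res {E : Type} {s N : Set E} {A : Set (Config E)} (h : Dep s A) :
    Dep (s ∩ N) {ω | res N ω ∈ A} := by
  intro ω ω' hw hA
  refine h _ _ (fun e he => ?_) hA
  by_cases hN : e ∈ N
  · simp [Perc.res, hw e ⟨he, hN⟩]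
  · simp [Perc.res, hN]

lemma exl_finite (n : ℕ) (w : Set HV) : (Exl n w).Finite := by
  refine (((rect_finite 0 (n + 1) 0 n).prod (Set.finite_univ (α := Fin 3))).image fun x =>
    ((x.1.1, x.1.2, x.2) : TriE)).subset fun e he => ?_
  obtain ⟨a, b, i⟩ := e
  have h := he.1
  rw [hg_eq] at h
  have := up_mem_dbox.1 h
  refine ⟨((a, b), i), ⟨⟨this.1, ?_, this.2.2.1, ?_⟩, trivial⟩, rfl⟩
  · have := this.2.1; push_cast at this; show a ≤ _; omega
  · have := this.2.2.2; show b ≤ _; omega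

lemma dbox_finite (m n : ℕ) : (dbox m n).Finite := by
  refine ((rect_finite (-1) m 0 n).prod (Set.finite_univ (α := Bool))).subset ?_
  rintro ⟨⟨a, b⟩, t⟩ h
  refine ⟨?_, trivial⟩
  simp only [dbox, mem_ofPred_eq] at h
  simp only [rect, mem_ofPred_eq]
  split_ifs at h <;> omega

/-- The event that a vertical crossing of a box is connected to the right side of its double. -/
def Xev (n : ℕ) : Set (Config TriE) := {ω | ∃ u v t : Z2, u.2 = 0 ∧ v.2 = n ∧ t.1 = (2 * n : ℕ) ∧
  u ∈ box n n ∧ Rch sg ω (box n n) u v ∧ Rch sg ω (box (2 * n) (2 * n)) u t}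

lemma isUpperSet_xev (n : ℕ) : IsUpperSet (Xev n) := by
  rintro ω ω' h ⟨u, v, t, hu, hv, ht, hm, h1, h2⟩
  exact ⟨u, v, t, hu, hv, ht, hm, h1.mono h subset_rfl, h2.mono h subset_rfl⟩

lemma box_subset_double (n : ℕ) : box n n ⊆ box (2 * n) (2 * n) := by
  intro z hz
  simp only [box, mem_ofPred_eq] at hz ⊢
  push_cast
  omega

lemma fd_xev (n : ℕ) : Fd (Xev n) := by
  have hdep : Dep (inner sg (box (2 * n) (2 * n))) (Xev n) := by
    rintro ω ω' hw ⟨u, v, t, hu, hv, ht, hm, h1, h2⟩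
    exact ⟨u, v, t, hu, hv, ht, hm, h1.congr fun e he => hw e ⟨box_subset_double n he.1,
      box_subset_double n he.2⟩, h2.congr hw⟩
  exact hdep.fd (inner_sg_finite (box_finite _ _))

/-- Crossings from `G` to the right side using free edges only. -/
def Kev (n : ℕ) (w : Set HV) (G : Set Z2) : Set (Config TriE) :=
  {ω | Conn sg (res (Free n w) ω) (box (2 * n) (2 * n)) G {z | z.1 = (2 * n : ℕ)}}

lemma dep_kev (n : ℕ) (w : Set HV) (G : Set Z2) :
    Dep (inner sg (box (2 * n) (2 * n)) ∩ Free n w) (Kev n w G) :=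
  (dep_conn sg (box (2 * n) (2 * n)) G {z | z.1 = (2 * n : ℕ)}).res

lemma fd_kev (n : ℕ) (w : Set HV) (G : Set Z2) : Fd (Kev n w G) :=
  (dep_kev n w G).fd ((inner_sg_finite (box_finite _ _)).subset inter_subset_left)

lemma rfE_injective (n : ℕ) : Function.Injective (rfE n) := fun a b h => by
  rw [← rfE_rfE n a, h, rfE_rfE]

lemma real_kev_rf_le {p : TriE → ℝ} (n : ℕ) (hp : ∀ e, p (rfE n e) = p e) (w : Set HV) (G : Set Z2) :
    (bern p).real (Kev n w {z | rf n z ∈ G}) ≤ (bern p).real (Kev n w G) := by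
  have := bern_relabel p (rfE n) (rfE_injective n) (fd_kev n w {z | rf n z ∈ G}).measurableSet
  simp only [hp] at this
  rw [show (bern p).real (Kev n w {z | rf n z ∈ G}) = _ from this.symm]
  refine measureReal_mono fun ω h => ?_
  refine Conn.relabel (σ := rfE n) (s := rf n) (sg_rfE n) (fun z hz => ?_) (fun z hz => hz)
    (fun z hz => hz) (ω := Perc.res (Free n w) ω) (R := box (2 * n) (2 * n)) (A := {z | rf n z ∈ G})
    (B := {z | z.1 = (2 * n : ℕ)}) ?_
  · simp only [box, rf, mem_ofPred_eq] at hz ⊢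
    push_cast at *
    omega
  · have he : (fun e => Perc.res (Free n w) ω (rfE n e)) = Perc.res (Free n w) fun e => ω (rfE n e) := by
      funext e
      have := rfE_mem_free (n := n) (w := w) (e := e)
      simp only [Perc.res]
      by_cases h : e ∈ Free n w
      · simp [h, this.2 h]
      · simp [h, mt this.1 h]
    rw [he]
    exact h

/-- A vertical crossing of a box is connected to the right side of the doubled box. -/
theorem le_real_xev {p : TriE → ℝ} {n : ℕ} (hn : 0 < n) (hp : ∀ e, p (rfE n e) = p e) :
    (bern p).real {ω | Conn sg ω (box n n) {z | z.2 = 0} {z | z.2 = n}} *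
      ((bern p).real {ω | Conn sg ω (box (2 * n) (2 * n)) {z | z.1 = 0} {z | z.1 = (2 * n : ℕ)}} / 2)
      ≤ (bern p).real (Xev n) := by
  classical
  set V := {ω : Config TriE | Conn sg ω (box n n) {z | z.2 = 0} {z | z.2 = n}} with hV
  set H := {ω : Config TriE |
    Conn sg ω (box (2 * n) (2 * n)) {z | z.1 = 0} {z | z.1 = (2 * n : ℕ)}} with hH
  have hWfin : {w : Set HV | ∃ ω, Wt n ω = w ∧ Good n w}.Finite :=
    (dbox_finite (n + 1) n).powerset.subset (by rintro w ⟨ω, rfl, -⟩; exact wt_subset n ω)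
  set S := hWfin.toFinset with hS
  have hSm : ∀ w, w ∈ S ↔ ∃ ω, Wt n ω = w ∧ Good n w := fun w => by simp [hS]
  have hpath : ∀ w ∈ S, ∃ u v : Z2, u.2 = 0 ∧ v.2 = n ∧ u ∈ box n n ∧
      Rch tg (ind (Bdl n w)) (box n n) u v := by
    intro w hw
    obtain ⟨ω, rfl, hg⟩ := (hSm w).1 hw
    exact hg.exists_path hn
  choose! u v hu hv hum huv using hpath
  have hVm : Fd V := fd_conn_sg (box_finite _ _) _ _
  have hWm : ∀ w, Fd {ω : Config TriE | Wt n ω = w} := fun w => (dep_wt n w).fd (exl_finite n w)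
  have hK : ∀ w ∈ S, (bern p).real H / 2 ≤ (bern p).real (Kev n w (Gam n w (u w))) := by
    intro w hw
    have h1 : H ⊆ Kev n w (Gam n w (u w)) ∪ Kev n w {z | rf n z ∈ Gam n w (u w)} := by
      rintro ω ⟨s, hs, t, ht, hsR, hst⟩
      obtain ⟨ω₀, rfl, hg⟩ := (hSm w).1 hw
      obtain ⟨z, hz, hzt⟩ := exists_free_path hn (hu _ hw) (hv _ hw) (hum _ hw) (huv _ hw) hs ht hsR hst
      have hzR : z ∈ box (2 * n) (2 * n) := hzt.symm.mem (hst.mem hsR)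
      rcases hz with hz | hz
      · exact Or.inl ⟨z, hz, t, ht, hzR, hzt⟩
      · exact Or.inr ⟨z, hz, t, ht, hzR, hzt⟩
    have h2 := (measureReal_mono (μ := bern p) h1).trans (measureReal_union_le _ _)
    have h3 := real_kev_rf_le n hp w (Gam n w (u w))
    linarith
  have hind : ∀ w ∈ S, (bern p).real ({ω | Wt n ω = w} ∩ Kev n w (Gam n w (u w))) =
      (bern p).real {ω | Wt n ω = w} * (bern p).real (Kev n w (Gam n w (u w))) := by
    intro w hw
    refine bern_indep (exl_finite n w).toFinset ?_ ?_ (fd_kev _ _ _).measurableSet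
    · simpa using dep_wt n w
    · refine (dep_kev n w _).mono ?_
      rintro e ⟨-, he, -⟩
      simpa using he
  have hX : ∀ w ∈ S, {ω | Wt n ω = w} ∩ Kev n w (Gam n w (u w)) ⊆ Xev n := by
    rintro w hw ω ⟨hω, z, hz, t, ht, hzR, hzt⟩
    have hle : ind (Bdl n w) ≤ res Sq ω := fun e => by
      by_cases h : ind (Bdl n w) e = true
      · rw [ind_eq_true] at h
        have := bdl_open (ω := ω) (n := n) (e := e) (by rw [show Wt n ω = w from hω]; exact h)
        rw [(res_eq_true.2 ⟨this.1, this.2.1⟩ : res Sq ω e = true)]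
        exact Bool.le_true _
      · rw [Bool.not_eq_true] at h; rw [h]; exact Bool.false_le _
    refine ⟨u w, v w, t, hu w hw, hv w hw, ht, hum w hw, rch_sg_iff.2 ((huv w hw).mono hle subset_rfl),
      ?_⟩
    have h1 : Rch sg ω (box n n) (u w) z := rch_sg_iff.2 (Rch.mono hle subset_rfl hz)
    exact (h1.mono le_rfl (box_subset_double n)).trans (hzt.mono (res_le _ _) subset_rfl)
  calc (bern p).real V * ((bern p).real H / 2)
      ≤ (∑ w ∈ S, (bern p).real {ω | Wt n ω = w}) * ((bern p).real H / 2) := by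
        refine mul_le_mul_of_nonneg_right ?_ (by positivity)
        have hVS : V ⊆ ⋃ w ∈ S, {ω | Wt n ω = w} := fun ω hω => by
          simp only [mem_iUnion]
          exact ⟨Wt n ω, (hSm _).2 ⟨ω, rfl, good_of_conn hω⟩, rfl⟩
        exact (measureReal_mono hVS (measure_ne_top _ _)).trans (measureReal_biUnion_finset_le _ _)
    _ = ∑ w ∈ S, (bern p).real {ω | Wt n ω = w} * ((bern p).real H / 2) := Finset.sum_mul _ _ _
    _ ≤ ∑ w ∈ S, (bern p).real ({ω | Wt n ω = w} ∩ Kev n w (Gam n w (u w))) := by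
        refine Finset.sum_le_sum fun w hw => ?_
        rw [hind w hw]
        exact mul_le_mul_of_nonneg_left (hK w hw) measureReal_nonneg
    _ = (bern p).real (⋃ w ∈ S, {ω | Wt n ω = w} ∩ Kev n w (Gam n w (u w))) := by
        refine (measureReal_biUnion_finset ?_ ?_).symm
        · intro w hw w' hw' hne
          refine Set.disjoint_left.2 ?_
          rintro ω ⟨h1, -⟩ ⟨h2, -⟩
          exact hne ((show Wt n ω = w from h1).symm.trans h2)
        · exact fun w hw => ((hWm w).inter (fd_kev _ _ _)).measurableSet
    _ ≤ (bern p).real (Xev n) := by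
        refine measureReal_mono ?_
        simp only [iUnion_subset_iff]
        exact hX

end Junction

section Glue

/-- Reflection of the edges in the diagonal. -/
def diag (e : TriE) : TriE := (e.2.1, e.1, 2 - e.2.2)

lemma diag_diag (e : TriE) : diag (diag e) = e := by simp [diag]

lemma diag_injective : Function.Injective diag := fun a b h => by
  rw [← diag_diag a, h, diag_diag]

lemma tg_diag (e : TriE) : tg (diag e) = ((tg e).1.swap, (tg e).2.swap) ∨
    tg (diag e) = ((tg e).2.swap, (tg e).1.swap) := by
  induction e using tri_induct <;> simp [diag]

lemma triInt_diag (p0 p1 p2 : ℝ) (e : TriE) : triInt p2 p1 p0 (diag e) = triInt p0 p1 p2 e := by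
  induction e using tri_induct <;> simp [diag, triInt]

lemma hx_le_vx_swap (p0 p1 p2 : ℝ) (m n : ℕ) :
    hx (triInt p0 p1 p2) m n ≤ vx (triInt p2 p1 p0) n m :=
  Pr_relabel_le diag_injective (s := Prod.swap) tg_diag (triInt_diag p0 p1 p2) (box_finite _ _)
    (fun z hz => ⟨hz.2.2.1, hz.2.2.2, hz.1, hz.2.1⟩) (fun z hz => hz) (fun z hz => hz)

lemma hx_mono {p : TriE → ℝ} {m m' n n' : ℕ} (hm : m' ≤ m) (hn : n ≤ n') :
    hx p m n ≤ hx p m' n' := by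
  refine measureReal_mono fun ω => ?_
  rintro ⟨u, hu, v, hv, huR, h⟩
  simp only [mem_ofPred_eq] at hu hv
  obtain ⟨u', v', h1, h2, -, h3, h4⟩ := h.trim (φ := Prod.fst) (α := 0) (β := m')
    (fun x y => step_fst) (by positivity) huR hu.le (by rw [hv]; exact_mod_cast hm)
  have hsub : box m n ∩ {x : Z2 | 0 ≤ x.1 ∧ x.1 ≤ (m' : ℤ)} ⊆ box m' n' := by
    rintro z ⟨hz, hz'⟩
    simp only [box, mem_ofPred_eq] at hz hz' ⊢
    omega
  exact ⟨u', h1, v', h2, hsub h3, h4.mono le_rfl hsub⟩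

lemma vx_mono {p : TriE → ℝ} {m m' n n' : ℕ} (hm : m ≤ m') (hn : n' ≤ n) :
    vx p m n ≤ vx p m' n' := by
  refine measureReal_mono fun ω => ?_
  rintro ⟨u, hu, v, hv, huR, h⟩
  simp only [mem_ofPred_eq] at hu hv
  obtain ⟨u', v', h1, h2, -, h3, h4⟩ := h.trim (φ := Prod.snd) (α := 0) (β := n')
    (fun x y => step_snd) (by positivity) huR hu.le (by rw [hv]; exact_mod_cast hn)
  have hsub : box m n ∩ {x : Z2 | 0 ≤ x.2 ∧ x.2 ≤ (n' : ℤ)} ⊆ box m' n' := by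
    rintro z ⟨hz, hz'⟩
    simp only [box, mem_ofPred_eq] at hz hz' ⊢
    omega
  exact ⟨u', h1, v', h2, hsub h3, h4.mono le_rfl hsub⟩

/-- The probability of a horizontal crossing of a rectangle. -/
lemma hx_le_rect {p : TriE → ℝ} (hp : TInv p) (a b : ℤ) (m n : ℕ) :
    hx p m n ≤ Pr p (rect a (a + m) b (b + n)) {z | z.1 = a} {z | z.1 = a + m} := by
  refine Pr_shift_le (w := (a, b)) (hp _) (box_finite _ _) ?_ ?_ ?_ <;> intro z hz <;>
    simp only [box, rect, mem_ofPred_eq, Prod.fst_add, Prod.snd_add] at hz ⊢ <;> omega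

lemma vx_le_rect {p : TriE → ℝ} (hp : TInv p) (a b : ℤ) (m n : ℕ) :
    vx p m n ≤ Pr p (rect a (a + m) b (b + n)) {z | z.2 = b} {z | z.2 = b + n} := by
  refine Pr_shift_le (w := (a, b)) (hp _) (box_finite _ _) ?_ ?_ ?_ <;> intro z hz <;>
    simp only [box, rect, mem_ofPred_eq, Prod.fst_add, Prod.snd_add] at hz ⊢ <;> omega

lemma fkg_three {E : Type} (p : E → ℝ) {A B C : Set (Config E)} (hA : IsUpperSet A)
    (hB : IsUpperSet B) (hC : IsUpperSet C) (fA : Fd A) (fB : Fd B) (fC : Fd C) :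
    (bern p).real A * (bern p).real B * (bern p).real C ≤ (bern p).real (A ∩ B ∩ C) :=
  (mul_le_mul_of_nonneg_right (bern_fkg p hA hB fA fB) measureReal_nonneg).trans
    (bern_fkg p (hA.inter hB) hC (fA.inter fB) fC)

lemma mul3_le {a b c a' b' c' : ℝ} (ha : 0 ≤ a) (hb : 0 ≤ b) (hc : 0 ≤ c) (h1 : a ≤ a') (h2 : b ≤ b')
    (h3 : c ≤ c') : a * b * c ≤ a' * b' * c' :=
  mul_le_mul (mul_le_mul h1 h2 hb (ha.trans h1)) h3 hc (mul_nonneg (ha.trans h1) (hb.trans h2))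

lemma hx_glue {p : TriE → ℝ} (hp : TInv p) {m₁ m₂ w n : ℕ} (h1 : w ≤ m₁) (h2 : w ≤ m₂) :
    hx p m₁ n * hx p m₂ n * vx p w n ≤ hx p (m₁ + m₂ - w) n := by
  have e1 := hx_le_rect hp 0 0 m₁ n
  have e2 := hx_le_rect hp (m₁ - w) 0 m₂ n
  have e3 := vx_le_rect hp (m₁ - w) 0 w n
  refine (mul3_le (Pr_nonneg _ _ _ _) (Pr_nonneg _ _ _ _) (Pr_nonneg _ _ _ _) e1 e2 e3).trans
    ((fkg_three p (isUpperSet_conn _ _ _ _) (isUpperSet_conn _ _ _ _) (isUpperSet_conn _ _ _ _)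
      (fd_conn (rect_finite _ _ _ _) _ _) (fd_conn (rect_finite _ _ _ _) _ _)
      (fd_conn (rect_finite _ _ _ _) _ _)).trans (measureReal_mono ?_))
  rintro ω ⟨⟨⟨u, hu, v, hv, huR, h⟩, ⟨u', hu', v', hv', huR', h'⟩⟩, ⟨s, hs, t, ht, hsR, hst⟩⟩
  simp only [mem_ofPred_eq] at hu hv hu' hv' hs ht
  obtain ⟨z, hz1, hz2⟩ := exists_intersection hst hsR (x0 := m₁ - w) (x1 := m₁) (y0 := 0) (y1 := n)
    (fun z hz => ⟨hz.1, by have := hz.2.1; omega⟩) ⟨0, fun z hz => hz.2.2.1⟩ (by omega) (by omega)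
    h huR (fun z hz => ⟨hz.2.2.1, by have := hz.2.2.2; omega⟩) (by omega) (by omega)
  obtain ⟨z', hz1', hz2'⟩ := exists_intersection hst hsR (x0 := m₁ - w) (x1 := m₁) (y0 := 0) (y1 := n)
    (fun z hz => ⟨hz.1, by have := hz.2.1; omega⟩) ⟨0, fun z hz => hz.2.2.1⟩ (by omega) (by omega)
    h' huR' (fun z hz => ⟨hz.2.2.1, by have := hz.2.2.2; omega⟩) (by omega) (by omega)
  have s1 : rect 0 (0 + m₁) 0 (0 + n) ⊆ box (m₁ + m₂ - w) n := by
    intro z hz; simp only [rect, box, mem_ofPred_eq] at hz ⊢; omega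
  have s2 : rect (m₁ - w) (m₁ - w + m₂) 0 (0 + n) ⊆ box (m₁ + m₂ - w) n := by
    intro z hz; simp only [rect, box, mem_ofPred_eq] at hz ⊢; omega
  have s3 : rect (m₁ - w) (m₁ - w + w) 0 (0 + n) ⊆ box (m₁ + m₂ - w) n := by
    intro z hz; simp only [rect, box, mem_ofPred_eq] at hz ⊢; omega
  refine ⟨u, hu, v', ?_, s1 huR, ?_⟩
  · simp only [mem_ofPred_eq]; omega
  · exact ((hz2.mono le_rfl s1).trans (hz1.symm.mono le_rfl s3)).trans
      ((hz1'.mono le_rfl s3).trans ((hz2'.symm.trans h').mono le_rfl s2))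

lemma vx_glue {p : TriE → ℝ} (hp : TInv p) {m₁ m₂ w n : ℕ} (h1 : w ≤ m₁) (h2 : w ≤ m₂) :
    vx p n m₁ * vx p n m₂ * hx p n w ≤ vx p n (m₁ + m₂ - w) := by
  have e1 := vx_le_rect hp 0 0 n m₁
  have e2 := vx_le_rect hp 0 (m₁ - w) n m₂
  have e3 := hx_le_rect hp 0 (m₁ - w) n w
  refine (mul3_le (Pr_nonneg _ _ _ _) (Pr_nonneg _ _ _ _) (Pr_nonneg _ _ _ _) e1 e2 e3).trans
    ((fkg_three p (isUpperSet_conn _ _ _ _) (isUpperSet_conn _ _ _ _) (isUpperSet_conn _ _ _ _)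
      (fd_conn (rect_finite _ _ _ _) _ _) (fd_conn (rect_finite _ _ _ _) _ _)
      (fd_conn (rect_finite _ _ _ _) _ _)).trans (measureReal_mono ?_))
  rintro ω ⟨⟨⟨u, hu, v, hv, huR, h⟩, ⟨u', hu', v', hv', huR', h'⟩⟩, ⟨s, hs, t, ht, hsR, hst⟩⟩
  simp only [mem_ofPred_eq] at hu hv hu' hv' hs ht
  obtain ⟨z, hz1, hz2⟩ := exists_intersection h huR (x0 := 0) (x1 := n) (y0 := m₁ - w) (y1 := m₁)
    (fun z hz => ⟨hz.1, by have := hz.2.1; omega⟩) ⟨0, fun z hz => hz.2.2.1⟩ (by omega) (by omega)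
    hst hsR (fun z hz => ⟨hz.2.2.1, by have := hz.2.2.2; omega⟩) (by omega) (by omega)
  obtain ⟨z', hz1', hz2'⟩ := exists_intersection h' huR' (x0 := 0) (x1 := n) (y0 := m₁ - w) (y1 := m₁)
    (fun z hz => ⟨hz.1, by have := hz.2.1; omega⟩) ⟨_, fun z hz => hz.2.2.1⟩ (by omega) (by omega)
    hst hsR (fun z hz => ⟨hz.2.2.1, by have := hz.2.2.2; omega⟩) (by omega) (by omega)
  have s1 : rect 0 (0 + n) 0 (0 + m₁) ⊆ box n (m₁ + m₂ - w) := by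
    intro z hz; simp only [rect, box, mem_ofPred_eq] at hz ⊢; omega
  have s2 : rect 0 (0 + n) (m₁ - w) (m₁ - w + m₂) ⊆ box n (m₁ + m₂ - w) := by
    intro z hz; simp only [rect, box, mem_ofPred_eq] at hz ⊢; omega
  have s3 : rect 0 (0 + n) (m₁ - w) (m₁ - w + w) ⊆ box n (m₁ + m₂ - w) := by
    intro z hz; simp only [rect, box, mem_ofPred_eq] at hz ⊢; omega
  refine ⟨u, hu, v', ?_, s1 huR, ?_⟩
  · simp only [mem_ofPred_eq]; omega
  · exact ((hz1.mono le_rfl s1).trans (hz2.symm.mono le_rfl s3)).trans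
      ((hz2'.mono le_rfl s3).trans ((hz1'.symm.trans h').mono le_rfl s2))

/-- Boxes of all aspect ratios are crossed with probability bounded away from `0`. -/
def Bx (p : TriE → ℝ) : Prop :=
  ∀ K : ℕ, ∃ δ : ℝ, 0 < δ ∧ ∃ n₀ : ℕ, ∀ n ≥ n₀, δ ≤ hx p (K * n) n ∧ δ ≤ vx p n (K * n)

/-- Boxes of all aspect ratios are crossed horizontally. -/
def HBx (p : TriE → ℝ) : Prop :=
  ∀ K : ℕ, ∃ δ : ℝ, 0 < δ ∧ ∃ n₀ : ℕ, ∀ n ≥ n₀, δ ≤ hx p (K * n) n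

lemma HBx.bx {p : TriE → ℝ} (hp : TInv p) (h : HBx p) {K₀ : ℕ} (hK : 0 < K₀)
    (hv : ∃ δ : ℝ, 0 < δ ∧ ∃ n₀ : ℕ, ∀ n ≥ n₀, δ ≤ vx p (K₀ * n) n) : Bx p := by
  have key : ∀ j : ℕ, ∃ δ : ℝ, 0 < δ ∧ ∃ n₀ : ℕ, ∀ m ≥ n₀, δ ≤ vx p (K₀ * (2 * m)) ((2 + j) * m) := by
    intro j
    induction j with
    | zero =>
      obtain ⟨δ, hδ, n₀, hn⟩ := hv
      exact ⟨δ, hδ, n₀, fun m hm => hn (2 * m) (by omega)⟩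
    | succ j ih =>
      obtain ⟨δ, hδ, n₀, hn⟩ := hv
      obtain ⟨δ₁, hδ₁, n₁, hn₁⟩ := ih
      obtain ⟨δ₂, hδ₂, n₂, hn₂⟩ := h (K₀ * 2)
      refine ⟨δ₁ * δ * δ₂, by positivity, n₀ + n₁ + n₂, fun m hm => ?_⟩
      have e1 := hn₁ m (by omega)
      have e2 := hn (2 * m) (by omega)
      have e3 := hn₂ m (by omega)
      rw [mul_assoc] at e3
      have := vx_glue hp (m₁ := (2 + j) * m) (m₂ := 2 * m) (w := m) (n := K₀ * (2 * m))
        (by nlinarith) (by omega)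
      rw [show (2 + j) * m + 2 * m - m = (2 + (j + 1)) * m by
        rw [Nat.sub_eq_iff_eq_add (by omega)]; ring] at this
      exact (mul3_le hδ₁.le hδ.le hδ₂.le e1 e2 e3).trans this
  intro K
  obtain ⟨δ₁, hδ₁, n₁, hn₁⟩ := key (K * (4 * K₀))
  obtain ⟨δ₂, hδ₂, n₂, hn₂⟩ := h K
  refine ⟨min δ₁ δ₂, lt_min hδ₁ hδ₂, n₂ + 2 * K₀ * (n₁ + 1), fun n hn => ?_⟩
  refine ⟨(min_le_right _ _).trans (hn₂ n (by nlinarith)), (min_le_left _ _).trans ?_⟩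
  have hm : n₁ + 1 ≤ n / (2 * K₀) := (Nat.le_div_iff_mul_le (by omega)).2 (by nlinarith)
  refine (hn₁ (n / (2 * K₀)) (by omega)).trans (vx_mono ?_ ?_)
  · have := Nat.div_mul_le_self n (2 * K₀)
    nlinarith
  · have := Nat.lt_div_mul_add (a := n) (b := 2 * K₀) (by omega)
    set m := n / (2 * K₀)
    have h2 : n ≤ 4 * K₀ * m := by nlinarith
    calc K * n ≤ K * (4 * K₀ * m) := Nat.mul_le_mul_left _ h2
      _ ≤ _ := by nlinarith

lemma hBx_of {p : TriE → ℝ} (hp : TInv p) {c : ℝ} (hc : 0 < c)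
    (h : ∀ m : ℕ, 0 < m → c ≤ hx p (3 * m) (2 * m) ∧ c ≤ vx p (2 * m) (2 * m)) : HBx p := by
  have key : ∀ j : ℕ, ∃ δ : ℝ, 0 < δ ∧ ∀ m > 0, δ ≤ hx p ((3 + j) * m) (2 * m) := by
    intro j
    induction j with
    | zero => exact ⟨c, hc, fun m hm => (h m hm).1⟩
    | succ j ih =>
      obtain ⟨δ, hδ, hj⟩ := ih
      refine ⟨δ * c * c, by positivity, fun m hm => ?_⟩
      have := hx_glue hp (m₁ := (3 + j) * m) (m₂ := 3 * m) (w := 2 * m) (n := 2 * m)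
        (by nlinarith) (by omega)
      rw [show (3 + j) * m + 3 * m - 2 * m = (3 + (j + 1)) * m by
        rw [Nat.sub_eq_iff_eq_add (by omega)]; ring] at this
      exact (mul3_le hδ.le hc.le hc.le (hj m hm) (h m hm).1 (h m hm).2).trans this
  intro K
  obtain ⟨δ, hδ, hj⟩ := key (3 * K)
  refine ⟨δ, hδ, 2, fun n hn => (hj (n / 2) (by omega)).trans (hx_mono ?_ (by omega))⟩
  have : n ≤ 3 * (n / 2) := by omega
  calc K * n ≤ K * (3 * (n / 2)) := Nat.mul_le_mul_left _ this
    _ ≤ _ := by nlinarith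

end Glue

section RSW

/-- Reflection of the edges in the vertical line `x = n / 2`. -/
def mirE (n : ℕ) (e : TriE) : TriE := (n - e.1 - (if e.2.2 = 0 then 1 else 0), e.2.1, e.2.2)

lemma mirE_mirE (n : ℕ) (e : TriE) : mirE n (mirE n e) = e := by
  obtain ⟨a, b, i⟩ := e
  by_cases h : i = 0 <;> (simp [mirE, h]; try ring)

lemma mirE_injective (n : ℕ) : Function.Injective (mirE n) := fun a b h => by
  rw [← mirE_mirE n a, h, mirE_mirE]

lemma sg_mirE (n : ℕ) (e : TriE) :
    sg (mirE n e) = ((n - (sg e).1.1, (sg e).1.2), (n - (sg e).2.1, (sg e).2.2)) ∨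
    sg (mirE n e) = ((n - (sg e).2.1, (sg e).2.2), (n - (sg e).1.1, (sg e).1.2)) := by
  induction e using tri_induct <;> (simp [mirE]; try omega)

lemma crit_half : Crit (1 / 2) 0 (1 / 2) := by
  refine ⟨?_, ?_, ?_, ?_⟩ <;> norm_num [kappaT]

lemma half_le_vx (n : ℕ) : 1 / 2 ≤ vx (triInt (1 / 2) 0 (1 / 2)) n n := by
  have h1 := one_le_vx_add_hx crit_half n n
  have h2 := hx_le_vx_swap (1 / 2) 0 (1 / 2) n n
  linarith

lemma half_le_hx (n : ℕ) : 1 / 2 ≤ hx (triInt (1 / 2) 0 (1 / 2)) n n := by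
  have h1 := one_le_vx_add_hx crit_half n n
  have h2 : vx (triInt (1 / 2) 0 (1 / 2)) n n ≤ hx (triInt (1 / 2) 0 (1 / 2)) n n :=
    Pr_relabel_le diag_injective (s := Prod.swap) tg_diag (triInt_diag _ _ _) (box_finite _ _)
      (fun z hz => ⟨hz.2.2.1, hz.2.2.2, hz.1, hz.2.1⟩) (fun z hz => hz) (fun z hz => hz)
  linarith

lemma hx_three_two {n : ℕ} (hn : 0 < n) :
    1 / 128 ≤ hx (triInt (1 / 2) 0 (1 / 2)) (3 * n) (2 * n) := by
  set p := triInt (1 / 2) 0 (1 / 2) with hp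
  have hp1 : ∀ e : TriE, e.2.2 = 1 → p e = 0 := fun e he => by simp [hp, triInt, he]
  have hX : 1 / 8 ≤ (bern p).real (Xev n) := by
    have h := le_real_xev (p := p) hn (fun e => rfl)
    rw [real_conn_sg hp1, real_conn_sg hp1] at h
    have h1 := half_le_vx n
    have h2 := half_le_hx (2 * n)
    have h3 : (1 / 2 : ℝ) * (1 / 2 / 2) ≤ vx p n n * (hx p (2 * n) (2 * n) / 2) :=
      mul_le_mul h1 (by linarith) (by norm_num) (by linarith)
    calc (1 / 8 : ℝ) = 1 / 2 * (1 / 2 / 2) := by norm_num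
      _ ≤ _ := h3.trans h
  set X' : Set (Config TriE) := {ω | (fun e => ω (mirE n e)) ∈ Xev n} with hX'
  have hX'P : 1 / 8 ≤ (bern p).real X' := by
    have := bern_relabel p (mirE n) (mirE_injective n) (fd_xev n).measurableSet
    rw [hX', this]
    exact hX
  have hX'u : IsUpperSet X' := fun ω ω' h hω => isUpperSet_xev n (fun e => h _) hω
  have hX'f : Fd X' := by
    obtain ⟨s, hs⟩ := fd_xev n
    classical
    refine ⟨s.image (mirE n), fun ω ω' hw h => hs _ _ (fun e he => hw _ ?_) h⟩
    rw [Finset.coe_image]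
    exact ⟨e, he, rfl⟩
  set H : Set (Config TriE) := {ω | Conn sg ω (box n n) {z | z.1 = 0} {z | z.1 = n}} with hH
  have hHP : 1 / 2 ≤ (bern p).real H := by
    rw [hH, real_conn_sg hp1]
    exact half_le_hx n
  have h1 := fkg_three p (isUpperSet_xev n) hX'u (isUpperSet_conn sg _ _ _) (fd_xev n) hX'f
    (fd_conn_sg (box_finite n n) {z | z.1 = 0} {z | z.1 = n})
  have h2 := (mul3_le (by norm_num) (by norm_num) (by norm_num) hX hX'P hHP).trans h1
  norm_num at h2
  refine h2.trans ?_
  have hRf := rect_finite (-n) (2 * n) 0 (2 * n)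
  refine le_trans (b := Pr p (rect (-n) (2 * n) 0 (2 * n)) {z | z.1 = -n} {z | z.1 = 2 * n}) ?_ ?_
  · rw [← real_conn_sg hp1]
    refine measureReal_mono ?_
    rintro ω ⟨⟨⟨u, v, t, hu, hv, ht, hm, huv, hut⟩, ⟨u', v', t', hu', hv', ht', hm', huv', hut'⟩⟩,
      ⟨s, hs, r, hr, hsR, hsr⟩⟩
    simp only [mem_ofPred_eq] at hs hr
    let m : Z2 → Z2 := fun z => (n - z.1, z.2)
    have hmm : MapsTo m (box n n) (box n n) := fun z hz => by
      simp only [box, m, mem_ofPred_eq] at hz ⊢; omega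
    have huv2 : Rch sg ω (box n n) (m u') (m v') := huv'.relabel (s := m) (sg_mirE n) hmm
    have hut2 : Rch sg ω (rect (-n) (2 * n) 0 (2 * n)) (m u') (m t') := by
      refine hut'.relabel (s := m) (sg_mirE n) fun z hz => ?_
      simp only [box, rect, m, mem_ofPred_eq] at hz ⊢; push_cast at hz; omega
    have s1 : box n n ⊆ rect (-n) (2 * n) 0 (2 * n) := by
      intro z hz; simp only [rect, box, mem_ofPred_eq] at hz ⊢; omega
    have s2 : box (2 * n) (2 * n) ⊆ rect (-n) (2 * n) 0 (2 * n) := by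
      intro z hz; simp only [rect, box, mem_ofPred_eq] at hz ⊢; push_cast at hz; omega
    obtain ⟨z, hz1, hz2⟩ := exists_intersection (rch_sg_iff.1 huv) hm (x0 := 0) (x1 := n) (y0 := 0)
      (y1 := n) (fun z hz => ⟨hz.1, hz.2.1⟩) ⟨0, fun z hz => hz.2.2.1⟩ (by omega) (by omega)
      (rch_sg_iff.1 hsr) hsR (fun z hz => hz.2.2) (by omega) (by omega)
    obtain ⟨z', hz1', hz2'⟩ := exists_intersection (rch_sg_iff.1 huv2) (hmm hm') (x0 := 0) (x1 := n)
      (y0 := 0) (y1 := n) (fun z hz => ⟨hz.1, hz.2.1⟩) ⟨0, fun z hz => hz.2.2.1⟩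
      (by simp only [m]; omega) (by simp only [m]; omega)
      (rch_sg_iff.1 hsr) hsR (fun z hz => hz.2.2) (by omega) (by omega)
    rw [← rch_sg_iff] at hz1 hz2 hz1' hz2'
    refine ⟨m t', ?_, t, ?_, hut2.mem (s1 (hmm hm')), ?_⟩
    · simp only [m, mem_ofPred_eq, ht']; push_cast; ring
    · simp only [mem_ofPred_eq, ht]; push_cast; ring
    · exact (hut2.symm.trans ((hz1'.trans (hz2'.symm.trans (hz2.trans hz1.symm))).mono le_rfl s1)).trans
        (hut.mono le_rfl s2)
  · refine Pr_shift_le (w := (n, 0)) (fun e => rfl) hRf ?_ ?_ ?_ <;> intro z hz <;>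
      simp only [box, rect, mem_ofPred_eq, Prod.fst_add, Prod.snd_add] at hz ⊢ <;> push_cast <;> omega

theorem bx_half : Bx (triInt (1 / 2) 0 (1 / 2)) := by
  refine (hBx_of (tInv_triInt _ _ _) (c := 1 / 128) (by norm_num) fun m hm =>
    ⟨hx_three_two hm, le_trans (by norm_num) (half_le_vx _)⟩).bx (tInv_triInt _ _ _) (K₀ := 1)
    one_pos ⟨1 / 2, by norm_num, 0, fun n _ => ?_⟩
  rw [one_mul]
  exact half_le_vx n

end RSW

section Swap

/-- Intensities of a lattice with triangular layers (where `l` holds) and square layers. -/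
def lay (p0 p1 p2 : ℝ) (l : ℤ → Bool) : TriE → ℝ := fun e =>
  if l e.2.1 then ![p0, p1, p2] e.2.2 else ![p0, 0, 1 - p0] e.2.2

/-- The intensities obtained by replacing the triangles of row `b` by stars. -/
def piv (p0 p1 p2 : ℝ) (l : ℤ → Bool) (b : ℤ) : TriE → ℝ := fun e =>
  if e.2.1 = b then 1 - ![p0, p1, p2] e.2.2 else lay p0 p1 p2 l e

/-- Replace the stars of row `b` by triangles. -/
def lowT (b : ℤ) (η : Config TriE) : Config TriE :=
  blockMap upBlock (fun j => if j.2 = b then st else id) η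

lemma lowT_apply (b : ℤ) (η : Config TriE) (x y : ℤ) (i : Fin 3) :
    lowT b η (x, y, i) = if y = b then η (x, y, i + 1) && η (x, y, i + 2) else η (x, y, i) := by
  have := blockMap_apply upBlock (fun j => if j.2 = b then st else id) η (x, y) i
  rw [upBlock_apply] at this
  rw [lowT, this]
  by_cases h : y = b <;> simp [h, st]

/-- The down-triangles as blocks of edges. -/
def dnBlock : Z2 × Fin 3 ≃ TriE where
  toFun j := (j.1.1 - (if j.2 = 2 then 0 else 1), j.1.2 - (if j.2 = 0 then 0 else 1), j.2)
  invFun e := ((e.1 + (if e.2.2 = 2 then 0 else 1), e.2.1 + (if e.2.2 = 0 then 0 else 1)), e.2.2)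
  left_inv j := by simp
  right_inv e := by simp

lemma dnBlock_apply (j : Z2 × Fin 3) : dnBlock j =
    (j.1.1 - (if j.2 = 2 then 0 else 1), j.1.2 - (if j.2 = 0 then 0 else 1), j.2) := rfl

/-- The identification of the edges before and after the exchange of the layers `b - 1` and `b`. -/
def sw (b : ℤ) (e : TriE) : TriE :=
  if e.2.1 = b then
    (if e.2.2 = 0 then (e.1 + 1, b - 1, 2) else if e.2.2 = 1 then (e.1, b - 1, 1) else (e.1, b, 0))
  else if e.2.1 = b - 1 then
    (if e.2.2 = 0 then e else if e.2.2 = 1 then (e.1 + 1, b, 1) else (e.1 - 1, b, 2))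
  else e

lemma sw_injective (b : ℤ) : Function.Injective (sw b) := by
  rintro ⟨x, y, i⟩ ⟨x', y', i'⟩ h
  simp only [sw] at h
  by_cases h1 : y = b <;> by_cases h2 : y' = b <;> by_cases h3 : y = b - 1 <;>
    by_cases h4 : y' = b - 1 <;> fin_cases i <;> fin_cases i' <;>
    simp [h1, h2, h3, h4] at h ⊢ <;> omega

/-- Replace the stars centred at the vertices of row `b` by triangles. -/
def uppT (b : ℤ) (η : Config TriE) : Config TriE :=
  blockMap dnBlock (fun j => if j.2 = b then st else id) (fun e => η (sw b e))

lemma uppT_zero (b : ℤ) (η : Config TriE) (x : ℤ) :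
    uppT b η (x, b, 0) = (η (x + 1, b, 1) && η (x, b, 2)) := by
  have := blockMap_apply dnBlock (fun j => if j.2 = b then st else id) (fun e => η (sw b e)) (x + 1, b) 0
  simpa [dnBlock, st, sw, uppT] using this

lemma uppT_one (b : ℤ) (η : Config TriE) (x : ℤ) :
    uppT b η (x, b - 1, 1) = (η (x, b, 2) && η (x + 1, b - 1, 2)) := by
  have := blockMap_apply dnBlock (fun j => if j.2 = b then st else id) (fun e => η (sw b e)) (x + 1, b) 1
  simpa [dnBlock, st, sw, uppT] using this

lemma uppT_two (b : ℤ) (η : Config TriE) (x : ℤ) :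
    uppT b η (x, b - 1, 2) = (η (x, b - 1, 2) && η (x, b, 1)) := by
  have := blockMap_apply dnBlock (fun j => if j.2 = b then st else id) (fun e => η (sw b e)) (x, b) 2
  simpa [dnBlock, st, sw, uppT] using this

lemma uppT_up (b : ℤ) (η : Config TriE) (x : ℤ) : uppT b η (x, b, 2) = η (x, b, 0) := by
  have := blockMap_apply dnBlock (fun j => if j.2 = b then st else id) (fun e => η (sw b e)) (x, b + 1) 2
  simpa [dnBlock, st, sw, uppT] using this

lemma uppT_other (b : ℤ) (η : Config TriE) {e : TriE} (h1 : (tg e).1.2 ≠ b) (h2 : (tg e).2.2 ≠ b) :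
    uppT b η e = η e := by
  induction e using tri_induct with
  | h0 x y =>
    have := blockMap_apply dnBlock (fun j => if j.2 = b then st else id) (fun e => η (sw b e)) (x + 1, y) 0
    simp only [tg_zero, ne_eq] at h1 h2
    simpa [dnBlock, st, sw, uppT, h1] using this
  | h1 x y =>
    have := blockMap_apply dnBlock (fun j => if j.2 = b then st else id) (fun e => η (sw b e)) (x + 1, y + 1) 1
    simp only [tg_one, ne_eq] at h1 h2
    have h3 : y ≠ b - 1 := by omega
    simpa [dnBlock, st, sw, uppT, h1, h2, h3] using this
  | h2 x y =>
    have := blockMap_apply dnBlock (fun j => if j.2 = b then st else id) (fun e => η (sw b e)) (x, y + 1) 2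
    simp only [tg_two, ne_eq] at h1 h2
    have h3 : y ≠ b - 1 := by omega
    simpa [dnBlock, st, sw, uppT, h1, h2, h3] using this

lemma lowT_other (b : ℤ) (η : Config TriE) {e : TriE} (h1 : e.2.1 ≠ b) : lowT b η e = η e := by
  obtain ⟨x, y, i⟩ := e
  rw [lowT_apply, if_neg h1]

lemma le_cl (x : Fin 3 → Bool) : x ≤ cl x := fun k => by
  rw [cl]
  cases x k <;> simp

variable {p0 p1 p2 : ℝ} {l l' : ℤ → Bool} {b : ℤ}

/-- Star–triangle transformation in the row `b`. -/
lemma lay_le_lowT (h : Crit p0 p1 p2) (hb : l b = true) {A : Set (Config TriE)} (hA : IsUpperSet A)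
    (hAf : Fd A) :
    (bern (lay p0 p1 p2 l)).real A ≤ (bern (piv p0 p1 p2 l b)).real {η | lowT b η ∈ A} := by
  have key := bern_blockMap_eq (A := A) upBlock (fun j => if j.2 = b then cl else id)
    (fun j => if j.2 = b then st else id) (lay p0 p1 p2 l) (piv p0 p1 p2 l b) (fun ⟨x, y⟩ z => by
      by_cases hy : y = b
      · subst hy
        have := star_triangle ![p0, p1, p2] h.mem h.2.2.2 z
        simpa [lay, piv, hb] using this
      · simp [piv, hy]) hAf.measurableSet
  rw [show (bern (piv p0 p1 p2 l b)).real {η | lowT b η ∈ A} = _ from key.symm]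
  refine measureReal_mono fun ω hω => hA ?_ hω
  rintro ⟨x, y, i⟩
  have := blockMap_apply upBlock (fun j => if j.2 = b then cl else id) ω (x, y) i
  rw [upBlock_apply] at this
  rw [this]
  by_cases hy : y = b
  · simp only [hy, if_true]
    exact le_cl (fun k => ω (x, b, k)) i
  · simp [hy]

/-- The set `R` contains all vertices of the down-triangles below row `b` with two vertices in `R`. -/
def DnClosed (b : ℤ) (R : Set Z2) : Prop :=
  ∀ a : ℤ, ((a - 1, b) ∈ R → (a, b) ∈ R → (a, b - 1) ∈ R) ∧
    ((a, b - 1) ∈ R → (a - 1, b) ∈ R → (a, b) ∈ R) ∧ ((a, b - 1) ∈ R → (a, b) ∈ R → (a - 1, b) ∈ R)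

lemma Rch.of_clDn {ω : Config TriE} {R : Set Z2} {u v : Z2} (hR : DnClosed b R)
    (h : Rch tg (blockMap dnBlock (fun j => if j.2 = b then cl else id) ω) R u v) :
    Rch tg ω R u v := by
  have two : ∀ e₁ e₂ x y z, ω e₁ = true → ω e₂ = true → x ∈ R → y ∈ R → z ∈ R →
      (tg e₁ = (x, y) ∨ tg e₁ = (y, x)) → (tg e₂ = (y, z) ∨ tg e₂ = (z, y)) →
      Rch tg ω R x z := fun e₁ e₂ x y z he₁ he₂ hx hy hz hg₁ hg₂ =>
    (Step.rch ⟨hx, hy, e₁, he₁, hg₁⟩).trans (Step.rch ⟨hy, hz, e₂, he₂, hg₂⟩)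
  have key : ∀ e, blockMap dnBlock (fun j => if j.2 = b then cl else id) ω e = true →
      (tg e).1 ∈ R → (tg e).2 ∈ R → Rch tg ω R (tg e).1 (tg e).2 := by
    intro e he h1 h2
    induction e using tri_induct with
    | h0 x y =>
      have := blockMap_apply dnBlock (fun j => if j.2 = b then cl else id) ω (x + 1, y) 0
      by_cases hy : y = b
      · subst hy
        simp [dnBlock_apply, cl] at this
        rw [this] at he
        simp only [Bool.or_eq_true, Bool.and_eq_true] at he
        rcases he with he | ⟨he1, he2⟩
        · exact Step.rch ⟨h1, h2, _, he, Or.inl rfl⟩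
        · exact two _ _ _ (x + 1, y - 1) _ he1 he2 h1
            ((hR (x + 1)).1 (by simpa using h1) (by simpa using h2)) h2 (by simp) (by simp)
      · simp [dnBlock_apply, hy] at this
        rw [this] at he
        exact Step.rch ⟨h1, h2, _, he, Or.inl rfl⟩
    | h1 x y =>
      have := blockMap_apply dnBlock (fun j => if j.2 = b then cl else id) ω (x + 1, y + 1) 1
      by_cases hy : y + 1 = b
      · subst hy
        simp [dnBlock_apply, cl] at this
        rw [this] at he
        simp only [Bool.or_eq_true, Bool.and_eq_true] at he
        rcases he with he | ⟨he1, he2⟩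
        · exact Step.rch ⟨h1, h2, _, he, Or.inl rfl⟩
        · exact two _ _ _ (x + 1, y + 1) _ he1 he2 h1
            ((hR (x + 1)).2.1 (by simpa using h1) (by simpa using h2)) h2 (by simp) (by simp)
      · simp [dnBlock_apply, hy] at this
        rw [this] at he
        exact Step.rch ⟨h1, h2, _, he, Or.inl rfl⟩
    | h2 x y =>
      have := blockMap_apply dnBlock (fun j => if j.2 = b then cl else id) ω (x, y + 1) 2
      by_cases hy : y + 1 = b
      · subst hy
        simp [dnBlock_apply, cl] at this
        rw [this] at he
        simp only [Bool.or_eq_true, Bool.and_eq_true] at he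
        rcases he with he | ⟨he1, he2⟩
        · exact Step.rch ⟨h1, h2, _, he, Or.inl rfl⟩
        · exact two _ _ _ (x - 1, y + 1) _ he2 he1 h1
            ((hR x).2.2 (by simpa using h1) (by simpa using h2)) h2 (by simp) (by simp)
      · simp [dnBlock_apply, hy] at this
        rw [this] at he
        exact Step.rch ⟨h1, h2, _, he, Or.inl rfl⟩
  refine Rch.map id (fun x y hxy => ?_) h
  obtain ⟨hx, hy, e, he, hg⟩ := hxy
  have := key e he
  rcases hg with hg | hg <;> rw [hg] at this
  · exact this hx hy
  · exact (this hy hx).symm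

/-- The layers `b - 1` and `b` of `l` are exchanged in `l'`. -/
structure Swapped (b : ℤ) (l l' : ℤ → Bool) : Prop where
  below : l (b - 1) = false
  above : l b = true
  below' : l' (b - 1) = true
  above' : l' b = false
  other : ∀ i, i ≠ b → i ≠ b - 1 → l' i = l i

lemma uppT_le_lay (h : Crit p0 p1 p2) (hs : Swapped b l l') {R A B : Set Z2} (hRf : R.Finite)
    (hR : DnClosed b R) :
    (bern (piv p0 p1 p2 l b)).real {η | Conn tg (uppT b η) R A B} ≤
      Pr (lay p0 p1 p2 l') R A B := by
  have hC := (fd_conn hRf A B).measurableSet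
  have key := bern_blockMap_eq (A := {ω | Conn tg ω R A B}) dnBlock (fun j => if j.2 = b then cl else id)
    (fun j => if j.2 = b then st else id) (lay p0 p1 p2 l')
    (fun e => piv p0 p1 p2 l b (sw b e)) (fun ⟨x, y⟩ z => by
      by_cases hy : y = b
      · subst hy
        have := star_triangle ![p0, p1, p2] h.mem h.2.2.2 z
        simp only [if_true]
        convert this using 3
        · funext k
          fin_cases k <;> simp [lay, dnBlock, hs.below']
        · funext k
          fin_cases k <;> simp [lay, dnBlock, piv, sw, hs.below]
      · simp only [hy, if_false]
        congr 2
        funext k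
        have hy1 : y - 1 ≠ b - 1 := by omega
        fin_cases k
        · simp [lay, dnBlock, piv, sw, hy]
        · by_cases h2 : y - 1 = b
          · simp [lay, dnBlock, piv, sw, h2, hs.below, hs.above']
          · simp [lay, dnBlock, piv, sw, h2, hy1, hs.other _ h2 hy1]
        · by_cases h2 : y - 1 = b
          · simp [lay, dnBlock, piv, sw, h2, hs.above']
          · simp [lay, dnBlock, piv, sw, h2, hy1, hs.other _ h2 hy1]) hC
  have h2 := bern_relabel (piv p0 p1 p2 l b) (sw b) (sw_injective b)
    (A := {ζ | blockMap dnBlock (fun j => if j.2 = b then st else id) ζ ∈ {ω | Conn tg ω R A B}})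
    (measurable_blockMap dnBlock _ hC)
  rw [show (bern (piv p0 p1 p2 l b)).real {η | Conn tg (uppT b η) R A B} = _ from h2.trans key.symm]
  refine measureReal_mono ?_
  rintro ω ⟨u, hu, v, hv, huR, huv⟩
  exact ⟨u, hu, v, hv, huR, huv.of_clDn hR⟩

end Swap

section Coupling

variable {p0 p1 p2 : ℝ} {l l' : ℤ → Bool} {b : ℤ} {η : Config TriE} {R R' A A' B B' : Set Z2}

/-- `X'` contains the points of `X` outside row `b`, and the three vertices near those in row `b`. -/
def Spr (b : ℤ) (X X' : Set Z2) : Prop :=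
  ∀ x y : ℤ, (x, y) ∈ X → (y ≠ b → (x, y) ∈ X') ∧
    (y = b → (x, b) ∈ X' ∧ (x - 1, b) ∈ X' ∧ (x, b - 1) ∈ X')

/-- The vertex `y` is joined to the star centre `(a, b)` by an open edge. -/
def Leg (b : ℤ) (η : Config TriE) (a : ℤ) (y : Z2) : Prop :=
  (y = (a, b - 1) ∧ η (a, b - 1, 2) = true) ∨ (y = (a, b) ∧ η (a, b, 1) = true) ∨
    (y = (a - 1, b) ∧ η (a - 1, b, 2) = true)

lemma Leg.mem {a : ℤ} {y : Z2} (h : Leg b η a y) (hX : Spr b A A') (ha : (a, b) ∈ A) : y ∈ A' := by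
  obtain ⟨h1, h2, h3⟩ := (hX a b ha).2 rfl
  rcases h with ⟨rfl, -⟩ | ⟨rfl, -⟩ | ⟨rfl, -⟩ <;> assumption

lemma Leg.rch {a : ℤ} {y z : Z2} (hy : Leg b η a y) (hz : Leg b η a z) (hy' : y ∈ R') (hz' : z ∈ R') :
    Rch tg (uppT b η) R' y z := by
  have e2 := uppT_two b η a
  have e1 := uppT_one b η (a - 1)
  have e0 := uppT_zero b η (a - 1)
  have g1 := tg_one (a - 1) (b - 1)
  have g0 := tg_zero (a - 1) b
  have g2 := tg_two a (b - 1)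
  simp only [sub_add_cancel] at e0 e1 e2 g0 g1 g2
  rcases hy with ⟨rfl, hy⟩ | ⟨rfl, hy⟩ | ⟨rfl, hy⟩ <;>
    rcases hz with ⟨rfl, hz⟩ | ⟨rfl, hz⟩ | ⟨rfl, hz⟩ <;> simp only [hy, hz] at e0 e1 e2
  · exact Rch.refl
  · exact Step.rch ⟨hy', hz', _, e2, Or.inl g2⟩
  · exact Step.rch ⟨hy', hz', _, e1, Or.inl g1⟩
  · exact Step.rch ⟨hy', hz', _, e2, Or.inr g2⟩
  · exact Rch.refl
  · exact Step.rch ⟨hy', hz', _, e0, Or.inr g0⟩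
  · exact Step.rch ⟨hy', hz', _, e1, Or.inr g1⟩
  · exact Step.rch ⟨hy', hz', _, e0, Or.inl g0⟩
  · exact Rch.refl

/-- Connections are preserved by the exchange of two layers. -/
lemma conn_uppT (h0 : ∀ x, η (x, b - 1, 1) = false) (hR : Spr b R R') (hA : Spr b A A')
    (hB : Spr b B B') (hAB : ∀ a, (a, b) ∈ A → (a, b) ∉ B) (h : Conn tg (lowT b η) R A B) :
    Conn tg (uppT b η) R' A' B' := by
  obtain ⟨u, hu, v, hv, huR, huv⟩ := h
  let S : Z2 → Prop := fun y => ∃ s ∈ A', s ∈ R' ∧ Rch tg (uppT b η) R' s y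
  have hS : ∀ y z, S y → Rch tg (uppT b η) R' y z → S z := fun y z ⟨s, h1, h2, h3⟩ h =>
    ⟨s, h1, h2, h3.trans h⟩
  let P : Z2 → Prop := fun z => (z.2 ≠ b → S z) ∧ (z.2 = b → (z ∈ A ∨ ∃ y, Leg b η z.1 y ∧ S y))
  have hleg : ∀ a y, (a, b) ∈ R → P (a, b) → Leg b η a y → S y := by
    intro a y ha hP hy
    have hyR := hy.mem hR ha
    rcases hP.2 rfl with h1 | ⟨z, hz, hzS⟩
    · exact ⟨y, hy.mem hA h1, hyR, Rch.refl⟩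
    · exact hS z y hzS (hz.rch hy (hz.mem hR ha) hyR)
  have mk : ∀ a y, Leg b η a y → S y → P (a, b) := fun a y hy hyS =>
    ⟨fun h => absurd rfl h, fun _ => Or.inr ⟨y, hy, hyS⟩⟩
  have hup : ∀ x, η (x, b, 0) = true → (x, b) ∈ R' → (x, b + 1) ∈ R' →
      Step tg (uppT b η) R' (x, b) (x, b + 1) := fun x hx h1 h2 =>
    ⟨h1, h2, (x, b, 2), by rw [uppT_up, hx], Or.inl (tg_two x b)⟩
  have hne : b + 1 ≠ b := by omega
  have hne' : b - 1 ≠ b := by omega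
  have key : ∀ e, lowT b η e = true → (tg e).1 ∈ R → (tg e).2 ∈ R →
      (P (tg e).1 → P (tg e).2) ∧ (P (tg e).2 → P (tg e).1) := by
    intro e he h1 h2
    by_cases hb1 : (tg e).1.2 = b
    · induction e using tri_induct with
      | h0 x y =>
        obtain rfl : y = b := hb1
        rw [lowT_apply, if_pos rfl, Bool.and_eq_true] at he
        simp only [tg_zero] at h1 h2 ⊢
        have l1 : Leg y η x (x, y) := Or.inr (Or.inl ⟨rfl, he.1⟩)
        have l2 : Leg y η (x + 1) (x, y) := Or.inr (Or.inr ⟨by simp, by simpa using he.2⟩)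
        exact ⟨fun h => mk _ _ l2 (hleg _ _ h1 h l1), fun h => mk _ _ l1 (hleg _ _ h2 h l2)⟩
      | h1 x y =>
        obtain rfl : y = b := hb1
        rw [lowT_apply, if_pos rfl, Bool.and_eq_true] at he
        simp only [tg_one] at h1 h2 ⊢
        have l2 : Leg y η (x + 1) (x, y) := Or.inr (Or.inr ⟨by simp, by simpa using he.1⟩)
        have hs := (hup x he.2 (l2.mem hR h1) ((hR _ _ h2).1 hne)).rch
        exact ⟨fun h => ⟨fun _ => hS _ _ (hleg _ _ h1 h l2) hs, fun h => absurd h hne⟩,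
          fun h => mk _ _ l2 (hS _ _ (h.1 hne) hs.symm)⟩
      | h2 x y =>
        obtain rfl : y = b := hb1
        rw [lowT_apply, if_pos rfl, Bool.and_eq_true] at he
        simp only [tg_two] at h1 h2 ⊢
        have l1 : Leg y η x (x, y) := Or.inr (Or.inl ⟨rfl, he.2⟩)
        have hs := (hup x he.1 (l1.mem hR h1) ((hR _ _ h2).1 hne)).rch
        exact ⟨fun h => ⟨fun _ => hS _ _ (hleg _ _ h1 h l1) hs, fun h => absurd h hne⟩,
          fun h => mk _ _ l1 (hS _ _ (h.1 hne) hs.symm)⟩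
    · have hrow : e.2.1 ≠ b := by
        induction e using tri_induct <;> exact hb1
      rw [lowT_other b η hrow] at he
      by_cases hb2 : (tg e).2.2 = b
      · induction e using tri_induct with
        | h0 x y => exact absurd hb2 hb1
        | h1 x y =>
          obtain rfl : y = b - 1 := by simp only [tg_one] at hb2; omega
          rw [h0] at he; exact absurd he (by simp)
        | h2 x y =>
          obtain rfl : y = b - 1 := by simp only [tg_two] at hb2; omega
          simp only [tg_two, sub_add_cancel] at h1 h2 ⊢
          have l1 : Leg b η x (x, b - 1) := Or.inl ⟨rfl, he⟩
          exact ⟨fun h => mk _ _ l1 (h.1 hne'), fun h => ⟨fun _ => hleg _ _ h2 h l1,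
            fun h => absurd h hne'⟩⟩
      · have hs : Rch tg (uppT b η) R' (tg e).1 (tg e).2 :=
          Step.rch ⟨(hR _ _ h1).1 hb1, (hR _ _ h2).1 hb2, e, by rw [uppT_other b η hb1 hb2, he],
            Or.inl rfl⟩
        exact ⟨fun h => ⟨fun _ => hS _ _ (h.1 hb1) hs, fun h => absurd h hb2⟩,
          fun h => ⟨fun _ => hS _ _ (h.1 hb2) hs.symm, fun h => absurd h hb1⟩⟩
  have hPv : P v := huv.induct (P := P)
    ⟨fun h => ⟨u, (hA _ _ hu).1 h, (hR _ _ huR).1 h, Rch.refl⟩, fun _ => Or.inl hu⟩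
    fun x y _ ⟨hx, hy, e, he, hg⟩ hP => by
      have := key e he
      rcases hg with hg | hg <;> rw [hg] at this
      · exact (this hx hy).1 hP
      · exact (this hy hx).2 hP
  have hvR := huv.mem huR
  obtain ⟨a, y⟩ := v
  by_cases hy : y = b
  · subst hy
    rcases hPv.2 rfl with h1 | ⟨z, hz, s, hs, hsR, h⟩
    · exact absurd hv (hAB a h1)
    · exact ⟨s, hs, z, hz.mem hB hv, hsR, h⟩
  · obtain ⟨s, hs, hsR, h⟩ := hPv.1 hy
    exact ⟨s, hs, _, (hB _ _ hv).1 hy, hsR, h⟩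

lemma ae_closed (p : TriE → ℝ) : ∀ᵐ ω ∂(bern p), ∀ e : TriE, p e = 0 → ω e = false := by
  classical
  rw [ae_all_iff]
  intro e
  by_cases hc : p e = 0
  · have hm : MeasurableSet {ω : Config TriE | ω e = true} :=
      Fd.measurableSet ⟨{e}, fun ω ω' hw h => by
        rw [mem_ofPred_eq, ← hw e (by simp)]; exact h⟩
    have := bern_cond p e hm
    simp [hc, clamp] at this
    rw [ae_iff]
    simpa [hc, measureReal_eq_zero_iff] using this
  · exact ae_of_all _ fun ω h => absurd h hc

lemma ae_piv (hs : Swapped b l l') :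
    ∀ᵐ η ∂(bern (piv p0 p1 p2 l b)), ∀ x, η (x, b - 1, 1) = false := by
  filter_upwards [ae_closed (piv p0 p1 p2 l b)] with η hη x
  exact hη _ (by simp [piv, lay, hs.below])

/-- The effect on connection probabilities of exchanging two layers. -/
lemma lay_swap_le (h : Crit p0 p1 p2) (hs : Swapped b l l') (hRf : R.Finite) (hRf' : R'.Finite)
    (hR : Spr b R R') (hD : DnClosed b R') (hA : Spr b A A')
    (hB : Spr b B B') (hAB : ∀ a, (a, b) ∈ A → (a, b) ∉ B) :
    Pr (lay p0 p1 p2 l) R A B ≤ Pr (lay p0 p1 p2 l') R' A' B' := by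
  refine ((lay_le_lowT h hs.above (isUpperSet_conn tg R A B) (fd_conn hRf A B)).trans ?_).trans
    (uppT_le_lay h hs hRf' hD)
  refine ENNReal.toReal_mono (measure_ne_top _ _) (measure_mono_ae ?_)
  filter_upwards [ae_piv (p0 := p0) (p1 := p1) (p2 := p2) hs] with η hη
  exact conn_uppT hη hR hA hB hAB

end Coupling

section FiniteEnergy

lemma bern_force {E : Type} [DecidableEq E] (p : E → ℝ) (e : E) (c : Bool) {A B : Set (Config E)}
    (hB : MeasurableSet B) (h : ∀ ω ∈ A, Function.update ω e c ∈ B) :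
    (if c then clamp (p e) else 1 - clamp (p e)) * (bern p).real A ≤ (bern p).real B := by
  have h0 := clamp_nonneg (p e)
  have h1 := clamp_le_one (p e)
  have hAB : (bern p).real A ≤ (bern p).real {ω | Function.update ω e c ∈ B} :=
    measureReal_mono h
  rw [bern_cond p e hB]
  cases c
  · have : 0 ≤ clamp (p e) * (bern p).real {ω | Function.update ω e true ∈ B} :=
      mul_nonneg h0 measureReal_nonneg
    have := mul_le_mul_of_nonneg_left hAB (sub_nonneg.2 h1)
    simp only [Bool.false_eq_true, if_false]
    linarith
  · have : 0 ≤ (1 - clamp (p e)) * (bern p).real {ω | Function.update ω e false ∈ B} :=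
      mul_nonneg (sub_nonneg.2 h1) measureReal_nonneg
    have := mul_le_mul_of_nonneg_left hAB h0
    simp only [if_true]
    linarith

variable {p0 p1 p2 : ℝ} {l l' : ℤ → Bool} {b : ℤ} {η : Config TriE} {R R' : Set Z2}

/-- The bottom row is connected below row `b` to the vertex `(a, b)`, by a last vertical edge. -/
def Att (b : ℤ) (R : Set Z2) (a : ℤ) : Set (Config TriE) :=
  {η | (a, b) ∈ R ∧ η (a, b - 1, 2) = true ∧
    Conn tg η (R ∩ {z | z.2 < b}) {z | z.2 = 0} {(a, b - 1)}}

lemma dep_att (a : ℤ) : Dep {e : TriE | e.2.1 ≠ b} (Att b R a) := by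
  rintro η η' hw ⟨h1, h2, h3⟩
  refine ⟨h1, by rw [← hw _ (by simp), h2], dep_conn tg _ _ _ η η' (fun e he => hw e ?_) h3⟩
  have : (tg e).1.2 < b := he.1.2
  have he' : (tg e).1.2 = e.2.1 := by induction e using tri_induct <;> rfl
  rw [he'] at this
  exact this.ne

lemma measurableSet_att (hRf : R.Finite) (a : ℤ) : MeasurableSet (Att b R a) := by
  have h1 : MeasurableSet {ω : Config TriE | ω (a, b - 1, 2) = true} :=
    Fd.measurableSet ⟨{(a, b - 1, 2)}, fun ω ω' hw h => by
      rw [mem_ofPred_eq, ← hw _ (by simp)]; exact h⟩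
  have h2 := (fd_conn (hRf.subset (inter_subset_left (t := {z : Z2 | z.2 < b}))) {z | z.2 = 0}
    {(a, b - 1)}).measurableSet
  by_cases h : (a, b) ∈ R
  · convert h1.inter h2 using 1
    ext η; simp [Att, h]
  · convert MeasurableSet.empty using 1
    ext η; simp [Att, h]

lemma exists_att (hb : 1 ≤ b) (h0 : ∀ x, η (x, b - 1, 1) = false)
    (h : Conn tg (lowT b η) R {z | z.2 = 0} {z | z.2 = b}) : ∃ a, η ∈ Att b R a := by
  obtain ⟨u, hu, v, hv, huR, huv⟩ := h
  have hu : u.2 = 0 := hu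
  have hv : v.2 = b := hv
  by_contra! hcon
  have : v.2 < b ∧ Conn tg η (R ∩ {z | z.2 < b}) {z | z.2 = 0} {v} := by
    refine huv.induct (P := fun x => x.2 < b ∧ Conn tg η (R ∩ {z | z.2 < b}) {z | z.2 = 0} {x}) ?_ ?_
    · exact ⟨by omega, u, hu, u, rfl, ⟨huR, (by omega : u.2 < b)⟩, Rch.refl⟩
    · rintro x y - ⟨hx, hy, e, he, hg⟩ ⟨hxb, s, hs, x', rfl, hsR, hr⟩
      have hxr : x' ∈ R ∩ {z | z.2 < b} := ⟨hx, hxb⟩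
      by_cases hyb : y.2 < b
      · refine ⟨hyb, s, hs, y, rfl, hsR, hr.trans (Step.rch ⟨hxr, ⟨hy, hyb⟩, e, ?_, hg⟩)⟩
        rw [← he, lowT_other]
        have he' : (tg e).1.2 = e.2.1 := by induction e using tri_induct <;> rfl
        rw [← he']
        rcases hg with hg | hg <;> rw [hg]
        · exact hxb.ne
        · exact hyb.ne
      · exfalso
        induction e using tri_induct with
        | h0 c d =>
          simp only [tg_zero, Prod.ext_iff] at hg; omega
        | h1 c d =>
          simp only [tg_one, Prod.ext_iff] at hg
          obtain rfl : d = b - 1 := by omega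
          rw [lowT_other _ _ (by simp), h0] at he
          simp at he
        | h2 c d =>
          simp only [tg_two, Prod.ext_iff] at hg
          obtain rfl : d = b - 1 := by omega
          rw [lowT_other _ _ (by simp)] at he
          obtain rfl : x' = (c, b - 1) := by
            ext <;> simp <;> omega
          obtain rfl : y = (c, b) := by
            ext <;> simp <;> omega
          exact hcon c ⟨hy, he, s, hs, _, rfl, hsR, hr⟩
  omega

lemma conn_of_att (hR : Spr b R R') {a : ℤ} (h : η ∈ Att b R a) (ha : η (a, b, 1) = true) :
    Conn tg (uppT b η) R' {z | z.2 = 0} {z | z.2 = b} := by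
  obtain ⟨h1, h2, s, hs, t, rfl, hsR, hr⟩ := h
  have hsub : R ∩ {z | z.2 < b} ⊆ R' := fun z hz => (hR _ _ hz.1).1 (ne_of_lt hz.2)
  refine ⟨s, hs, (a, b), rfl, hsub hsR, ?_⟩
  have hr' : Rch tg (uppT b η) (R ∩ {z | z.2 < b}) s (a, b - 1) := hr.congr fun e he =>
    (uppT_other b η (ne_of_lt he.1.2) (ne_of_lt he.2.2)).symm
  refine (hr'.mono le_rfl hsub).trans (Step.rch ⟨hsub (hr.mem hsR), ((hR _ _ h1).2 rfl).1,
    (a, b - 1, 2), by rw [uppT_two, h2, ha]; rfl, Or.inl (by simp)⟩)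

lemma measurable_uppT (b : ℤ) : Measurable (uppT b) :=
  (measurable_blockMap dnBlock _).comp (measurable_relabel (sw b))

lemma lowT_update_le (a : ℤ) (η : Config TriE) :
    lowT b (Function.update (Function.update (Function.update η (a, b, 1) true) (a, b, 0) false)
      (a, b, 2) false) ≤ lowT b η := by
  rintro ⟨x, y, i⟩
  rw [lowT_apply, lowT_apply]
  by_cases hy : y = b
  · subst hy
    by_cases hx : x = a
    · subst hx
      fin_cases i <;> simp [Function.update, Prod.ext_iff]
    · simp [Function.update, hx]
  · simp [Function.update, hy]

/-- Exchanging two layers when the target is the lower one of the two rows affected. -/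
lemma lay_swap_row_le (h : Crit p0 p1 p2) (hs : Swapped b l l') (hb : 1 ≤ b) (hRf : R.Finite)
    (hRf' : R'.Finite) (hR : Spr b R R') (hD : DnClosed b R') :
    (1 - p1) * p0 * p2 * Pr (lay p0 p1 p2 l) R {z | z.2 = 0} {z | z.2 = b} +
      (1 - (1 - p1) * p0 * p2) * Pr (lay p0 p1 p2 l) R {z | z.2 = 0} {z | z.2 = b + 1} ≤
      Pr (lay p0 p1 p2 l') R' {z | z.2 = 0} {z | z.2 = b} := by
  classical
  set ε := (1 - p1) * p0 * p2 with hε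
  obtain ⟨hp0, hp1, hp2, -⟩ := id h
  have hε0 : 0 ≤ ε := mul_nonneg (mul_nonneg (by linarith) hp0.1) hp2.1
  have hε1 : ε ≤ 1 := mul_le_one₀ (mul_le_one₀ (by linarith) hp0.1 hp0.2) hp2.1 hp2.2
  set μ := bern (piv p0 p1 p2 l b) with hμ
  let M : Set (Config TriE) := {η | Conn tg (lowT b η) R {z | z.2 = 0} {z | z.2 = b}}
  let N : Set (Config TriE) := {η | Conn tg (lowT b η) R {z | z.2 = 0} {z | z.2 = b + 1}}
  let Q : Set (Config TriE) := {η | Conn tg (uppT b η) R' {z | z.2 = 0} {z | z.2 = b}}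
  have hMle := lay_le_lowT h hs.above (isUpperSet_conn tg R {z | z.2 = 0} {z | z.2 = b})
    (fd_conn hRf _ _)
  have hNle := lay_le_lowT h hs.above (isUpperSet_conn tg R {z | z.2 = 0} {z | z.2 = b + 1})
    (fd_conn hRf _ _)
  have hQle := uppT_le_lay h hs (A := {z | z.2 = 0}) (B := {z | z.2 = b}) hRf' hD
  have hmN : MeasurableSet N :=
    (measurable_blockMap upBlock _) (fd_conn hRf {z | z.2 = 0} {z | z.2 = b + 1}).measurableSet
  have hmM : MeasurableSet M :=
    (measurable_blockMap upBlock _) (fd_conn hRf {z | z.2 = 0} {z | z.2 = b}).measurableSet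
  have hmQ : MeasurableSet Q :=
    (measurable_uppT b) (fd_conn hRf' {z | z.2 = 0} {z | z.2 = b}).measurableSet
  have h0 : ∀ᵐ η ∂μ, ∀ x, η (x, b - 1, 1) = false := ae_piv (p0 := p0) (p1 := p1) (p2 := p2) hs
  have hNQ : ∀ᵐ η ∂μ, η ∈ N → η ∈ Q := by
    filter_upwards [h0] with η hη hN
    have := conn_uppT hη hR (A := {z | z.2 = 0}) (A' := {z | z.2 = 0}) (B := {z | z.2 = b + 1})
      (B' := {z | z.2 = b + 1}) (fun x y h => ⟨fun _ => h, fun hy => by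
        have h : y = 0 := h
        omega⟩) (fun x y h => ⟨fun _ => h, fun hy => by
        have h : y = b + 1 := h
        omega⟩) (fun a (h1 : b = 0) _ => by omega) hN
    obtain ⟨u, (hu : u.2 = 0), v, (hv : v.2 = b + 1), huR, huv⟩ := this
    obtain ⟨w, hw, hr, -⟩ := huv.last_exit (φ := fun z => z.2) (fun x y h => step_snd h) huR
      (α := b) (by omega) (by omega)
    exact ⟨u, hu, w, hw, huR, hr⟩
  let F : Finset ℤ := (hRf.image Prod.fst).toFinset
  let D : ℤ → Set (Config TriE) := fun a => Att b R a ∩ ⋂ a' ∈ F.filter (· < a), (Att b R a')ᶜ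
  have hF : ∀ a η, η ∈ Att b R a → a ∈ F := fun a η h => by
    simp only [F, Finite.mem_toFinset]
    exact ⟨_, h.1, rfl⟩
  have hmD : ∀ a, MeasurableSet (D a) := fun a => (measurableSet_att hRf a).inter
    (Finset.measurableSet_biInter _ fun a' _ => (measurableSet_att hRf a').compl)
  have hdD : ∀ a, Dep {e : TriE | e.2.1 ≠ b} (D a) := by
    rintro a η η' hw ⟨h1, h2⟩
    refine ⟨dep_att a η η' hw h1, ?_⟩
    simp only [mem_iInter] at h2 ⊢
    exact fun a' ha' h => h2 a' ha' (dep_att a' η' η (fun e he => (hw e he).symm) h)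
  have hdisj : (F : Set ℤ).PairwiseDisjoint fun a => D a ∩ (Q \ N) := by
    have : ∀ a a' : ℤ, a < a' → ∀ η, η ∈ D a → η ∉ D a' := fun a a' haa η h1 h2 => by
      have := h2.2
      simp only [mem_iInter] at this
      exact this a (Finset.mem_filter.2 ⟨hF _ _ h1.1, haa⟩) h1.1
    intro a _ a' _ haa
    refine Set.disjoint_left.2 fun η h1 h2 => ?_
    rcases lt_or_gt_of_ne haa with h | h
    · exact this _ _ h η h1.1 h2.1
    · exact this _ _ h η h2.1 h1.1
  have hcov : ∀ᵐ η ∂μ, η ∈ M \ N → η ∈ ⋃ a ∈ F, D a ∩ Nᶜ := by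
    filter_upwards [h0] with η hη hMN
    obtain ⟨a, ha⟩ := exists_att hb hη hMN.1
    have hne : (F.filter fun a => η ∈ Att b R a).Nonempty := ⟨a, Finset.mem_filter.2 ⟨hF _ _ ha, ha⟩⟩
    have hmin := Finset.min'_mem _ hne
    rw [Finset.mem_filter] at hmin
    refine mem_biUnion (x := (F.filter fun a => η ∈ Att b R a).min' hne) hmin.1
      ⟨⟨hmin.2, ?_⟩, hMN.2⟩
    simp only [mem_iInter]
    intro a' ha' h
    have := Finset.min'_le (F.filter fun a => η ∈ Att b R a) a'
      (Finset.mem_filter.2 ⟨(Finset.mem_filter.1 ha').1, h⟩)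
    exact absurd (Finset.mem_filter.1 ha').2 (not_lt.2 this)
  have hone : ∀ a, ε * μ.real (D a ∩ Nᶜ) ≤ μ.real (D a ∩ (Q \ N)) := by
    intro a
    have hmT : MeasurableSet (D a ∩ (Q \ N)) := (hmD a).inter (hmQ.diff hmN)
    have hu : ∀ (e : TriE) (c : Bool), Measurable fun ω : Config TriE => Function.update ω e c := by
      intro e c; fun_prop
    have s3 := bern_force (piv p0 p1 p2 l b) (a, b, 2) false hmT
      (A := {ω | Function.update ω (a, b, 2) false ∈ D a ∩ (Q \ N)}) fun ω h => h
    have s2 := bern_force (piv p0 p1 p2 l b) (a, b, 0) false (hu (a, b, 2) false hmT)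
      (A := {ω | Function.update (Function.update ω (a, b, 0) false) (a, b, 2) false ∈
        D a ∩ (Q \ N)}) fun ω h => h
    have s1 := bern_force (piv p0 p1 p2 l b) (a, b, 1) true
      (hu (a, b, 0) false (hu (a, b, 2) false hmT)) (A := D a ∩ Nᶜ) ?_
    · have c1 : clamp (piv p0 p1 p2 l b (a, b, 1)) = 1 - p1 := by
        simp only [piv, if_true]
        exact clamp_of_mem (by simp; linarith) (by simp; linarith)
      have c0 : clamp (piv p0 p1 p2 l b (a, b, 0)) = 1 - p0 := by
        simp only [piv, if_true]
        exact clamp_of_mem (by simp; linarith) (by simp; linarith)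
      have c2 : clamp (piv p0 p1 p2 l b (a, b, 2)) = 1 - p2 := by
        simp only [piv, if_true]
        exact clamp_of_mem (by simp; linarith) (by simp; linarith)
      simp only [c0, c1, c2, if_true, Bool.false_eq_true, if_false, sub_sub_cancel] at s1 s2 s3
      have t1 := mul_le_mul_of_nonneg_left s1 (mul_nonneg hp2.1 hp0.1)
      have t2 := mul_le_mul_of_nonneg_left s2 hp2.1
      calc ε * μ.real (D a ∩ Nᶜ) = p2 * p0 * ((1 - p1) * μ.real (D a ∩ Nᶜ)) := by rw [hε]; ring
        _ ≤ _ := t1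
        _ = _ := by rw [mul_assoc]; rfl
        _ ≤ _ := t2
        _ ≤ _ := s3
    · rintro η ⟨hD1, hN⟩
      set η' := Function.update (Function.update (Function.update η (a, b, 1) true) (a, b, 0) false)
        (a, b, 2) false with hη'
      have hoff : ∀ e ∈ {e : TriE | e.2.1 ≠ b}, η e = η' e := by
        rintro ⟨x, y, i⟩ (he : y ≠ b)
        simp [hη', Function.update, he]
      have hD2 : η' ∈ D a := hdD a η η' hoff hD1
      refine ⟨hD2, conn_of_att hR hD2.1 (by simp [Function.update]), fun hN' => hN ?_⟩
      exact Conn.mono (lowT_update_le a η) le_rfl le_rfl le_rfl hN'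
  have e1 : ε * μ.real (M \ N) ≤ μ.real (Q \ N) := by
    calc ε * μ.real (M \ N) ≤ ε * μ.real (⋃ a ∈ F, D a ∩ Nᶜ) :=
          mul_le_mul_of_nonneg_left (ENNReal.toReal_mono (measure_ne_top _ _) (measure_mono_ae hcov)) hε0
      _ ≤ ε * ∑ a ∈ F, μ.real (D a ∩ Nᶜ) :=
          mul_le_mul_of_nonneg_left (measureReal_biUnion_finset_le _ _) hε0
      _ ≤ ∑ a ∈ F, μ.real (D a ∩ (Q \ N)) := by
          rw [Finset.mul_sum]; exact Finset.sum_le_sum fun a _ => hone a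
      _ = μ.real (⋃ a ∈ F, D a ∩ (Q \ N)) :=
          (measureReal_biUnion_finset hdisj fun a _ => (hmD a).inter (hmQ.diff hmN)).symm
      _ ≤ μ.real (Q \ N) := measureReal_mono (iUnion₂_subset fun a _ => inter_subset_right)
  have e2 : μ.real M ≤ μ.real (M \ N) + μ.real N := by
    have := measureReal_sdiff_add_inter (μ := μ) (s := M) hmN
    have h2 : μ.real (M ∩ N) ≤ μ.real N := measureReal_mono inter_subset_right
    linarith
  have e3 : μ.real N + μ.real (Q \ N) ≤ μ.real Q := by
    have := measureReal_sdiff_add_inter (μ := μ) (s := Q) hmN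
    have h2 : μ.real N ≤ μ.real (Q ∩ N) := by
      refine ENNReal.toReal_mono (measure_ne_top _ _) (measure_mono_ae ?_)
      filter_upwards [hNQ] with η hη hN
      exact ⟨hη hN, hN⟩
    linarith
  have f1 : Pr (lay p0 p1 p2 l) R {z | z.2 = 0} {z | z.2 = b} ≤ μ.real M := hMle
  have f2 : Pr (lay p0 p1 p2 l) R {z | z.2 = 0} {z | z.2 = b + 1} ≤ μ.real N := hNle
  have f3 : μ.real Q ≤ Pr (lay p0 p1 p2 l') R' {z | z.2 = 0} {z | z.2 = b} := hQle
  have g1 := mul_le_mul_of_nonneg_left (f1.trans e2) hε0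
  have g2 := mul_le_mul_of_nonneg_left f2 (sub_nonneg.2 hε1)
  rw [mul_add] at g1
  linarith

end FiniteEnergy

section Slide

variable {p0 p1 p2 : ℝ}

lemma Pr_congr {p p' : TriE → ℝ} {R : Set Z2} (hRf : R.Finite) (A B : Set Z2)
    (h : ∀ e ∈ inner tg R, p e = p' e) : Pr p R A B = Pr p' R A B :=
  bern_congr (inner_tg_finite hRf).toFinset (fun e he => h e (by simpa using he))
    ((dep_conn tg R A B).mono (by simp))

lemma lay_congr {l l' : ℤ → Bool} {T : ℤ} {R : Set Z2}
    (hR : ∀ z ∈ R, 0 ≤ z.2 ∧ z.2 ≤ T) (hl : ∀ i, 0 ≤ i → i < T → l i = l' i) :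
    ∀ e ∈ inner tg R, lay p0 p1 p2 l e = lay p0 p1 p2 l' e := by
  intro e he
  obtain ⟨h1, h2⟩ := he
  have h1 := hR _ h1
  have h2 := hR _ h2
  induction e using tri_induct with
  | h0 x y => simp [lay]
  | h1 x y =>
    simp only [tg_one] at h1 h2
    simp [lay, hl y h1.1 (by omega)]
  | h2 x y =>
    simp only [tg_two] at h1 h2
    simp [lay, hl y h1.1 (by omega)]

/-- The layers while the `k`-th triangular layer is moved down, and has reached height `b`. -/
def slid (k : ℕ) (b : ℤ) (i : ℤ) : Bool := decide (i < k ∨ i = b)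

lemma swapped_slid {k : ℕ} {b : ℤ} (hb : (k : ℤ) < b) : Swapped b (slid k b) (slid k (b - 1)) where
  below := by simp [slid]; omega
  above := by simp [slid]
  below' := by simp [slid]
  above' := by simp [slid]; omega
  other i h1 h2 := by simp [slid, h1, h2]

/-- The region used while moving down the `k`-th triangular layer. -/
def reg (k : ℕ) (b : ℤ) (T r : ℕ) : Set Z2 :=
  {z | 0 ≤ z.2 ∧ z.2 ≤ T ∧ -(k : ℤ) - (if b < z.2 then 1 else 0) ≤ z.1 ∧ z.1 ≤ r}

lemma reg_subset (k : ℕ) (b : ℤ) (T r : ℕ) : reg k b T r ⊆ rect (-(k : ℤ) - 1) r 0 T :=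
  fun z ⟨h1, h2, h3, h4⟩ => ⟨by split_ifs at h3 <;> omega, h4, h1, h2⟩

lemma reg_finite (k : ℕ) (b : ℤ) (T r : ℕ) : (reg k b T r).Finite :=
  (rect_finite _ _ _ _).subset (reg_subset k b T r)

lemma reg_spr {k : ℕ} {b : ℤ} {T r : ℕ} (hb : 1 ≤ b) : Spr b (reg k b T r) (reg k (b - 1) T r) := by
  rintro x y ⟨h1, h2, h3, h4⟩
  simp only at h1 h2 h3 h4
  refine ⟨fun hy => ⟨h1, h2, ?_, h4⟩, fun hy => ?_⟩
  · simp only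
    split_ifs at h3 ⊢ <;> omega
  · subst hy
    simp only [lt_self_iff_false, if_false] at h3
    refine ⟨⟨h1, h2, ?_, h4⟩, ⟨h1, h2, ?_, ?_⟩, ⟨?_, ?_, ?_, h4⟩⟩ <;> simp <;> omega

lemma reg_dnClosed {k : ℕ} {b : ℤ} {T r : ℕ} (hb : 1 ≤ b) : DnClosed b (reg k (b - 1) T r) := by
  intro a
  simp only [reg, mem_ofPred_eq, sub_lt_self_iff, zero_lt_one, if_true, lt_self_iff_false, if_false]
  refine ⟨?_, ?_, ?_⟩ <;> rintro ⟨h1, h2, h3, h4⟩ ⟨h5, h6, h7, h8⟩ <;>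
    refine ⟨?_, ?_, ?_, ?_⟩ <;> omega

lemma Pr_slid_succ (k T r : ℕ) (A B : Set Z2) :
    Pr (lay p0 p1 p2 (slid k k)) (reg k k T r) A B =
      Pr (lay p0 p1 p2 (slid (k + 1) T)) (reg k k T r) A B :=
  Pr_congr (reg_finite _ _ _ _) A B (lay_congr (T := T) (fun z hz => ⟨hz.1, hz.2.1⟩)
    fun i h0 h1 => by simp only [slid, decide_eq_decide]; push_cast; omega)

lemma reg_succ (k T r : ℕ) : reg k k T r ⊆ reg (k + 1) T T r := by
  rintro z ⟨h1, h2, h3, h4⟩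
  refine ⟨h1, h2, ?_, h4⟩
  rw [if_neg (by omega)]
  push_cast
  split_ifs at h3 <;> omega

lemma lay_zero (T r : ℕ) (A B : Set Z2) :
    Pr (triInt p0 0 (1 - p0)) (reg 0 T T r) A B = Pr (lay p0 p1 p2 (slid 0 T)) (reg 0 T T r) A B := by
  refine (Pr_congr (reg_finite _ _ _ _) A B fun e he => ?_).trans
    (Pr_congr (p := lay p0 p1 p2 fun _ => false) (reg_finite _ _ _ _) A B
      (lay_congr (T := T) (fun z hz => ⟨hz.1, hz.2.1⟩) fun i h0 h1 => by simp [slid]; omega))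
  simp [lay, triInt]

lemma lay_full {n : ℕ} {T : ℤ} {R : Set Z2} (hRf : R.Finite) (hR : ∀ z ∈ R, 0 ≤ z.2 ∧ z.2 ≤ n)
    (A B : Set Z2) :
    Pr (lay p0 p1 p2 (slid n T)) R A B = Pr (triInt p0 p1 p2) R A B := by
  refine (Pr_congr hRf A B (lay_congr (l' := fun _ => true) (T := n) hR
    fun i h0 h1 => by simp [slid]; omega)).trans (Pr_congr hRf A B fun e he => ?_)
  simp [lay, triInt]

/-- Horizontal crossings are transported from the square lattice to the triangular lattice. -/
lemma hx_square_le (h : Crit p0 p1 p2) {m n : ℕ} (hmn : n ≤ m) :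
    hx (triInt p0 0 (1 - p0)) m n ≤ hx (triInt p0 p1 p2) (m - n) n := by
  let B : ℕ → ℤ → Set Z2 := fun k b => {z | (m : ℤ) - k - (if b < z.2 then 1 else 0) ≤ z.1}
  let X : ℕ → ℤ → ℝ := fun k b => Pr (lay p0 p1 p2 (slid k b)) (reg k b n m) {z | z.1 ≤ 0} (B k b)
  have swap : ∀ (k : ℕ) (b : ℤ), (k : ℤ) < b → b ≤ n → X k b ≤ X k (b - 1) := by
    intro k b hkb hbn
    refine lay_swap_le h (swapped_slid hkb) (reg_finite _ _ _ _) (reg_finite _ _ _ _)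
      (reg_spr (by omega)) (reg_dnClosed (by omega)) ?_ ?_ ?_
    · intro x y hx
      have hx : x ≤ 0 := hx
      exact ⟨fun _ => hx, fun _ => ⟨hx, (by omega : x - 1 ≤ 0), hx⟩⟩
    · intro x y hx
      have hx : (m : ℤ) - k - (if b < y then 1 else 0) ≤ x := hx
      refine ⟨fun hy => ?_, fun hy => ?_⟩
      · change (m : ℤ) - k - (if b - 1 < y then 1 else 0) ≤ x
        split_ifs at hx ⊢ <;> omega
      · subst hy
        rw [if_neg (lt_irrefl _)] at hx
        refine ⟨?_, ?_, ?_⟩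
        · change (m : ℤ) - k - (if y - 1 < y then 1 else 0) ≤ x
          split_ifs <;> omega
        · change (m : ℤ) - k - (if y - 1 < y then 1 else 0) ≤ x - 1
          split_ifs <;> omega
        · change (m : ℤ) - k - (if y - 1 < y - 1 then 1 else 0) ≤ x
          split_ifs <;> omega
    · intro a h1 h2
      have h1 : a ≤ 0 := h1
      have h2 : (m : ℤ) - k - (if b < b then 1 else 0) ≤ a := h2
      rw [if_neg (lt_irrefl _)] at h2
      omega
  have down : ∀ k j : ℕ, k + j ≤ n → X k n ≤ X k (n - j) := by
    intro k j hj
    induction j with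
    | zero => simp
    | succ j ih =>
      refine (ih (by omega)).trans ((swap k (n - j) (by omega) (by omega)).trans (le_of_eq ?_))
      congr 1; push_cast; ring
  have slide : ∀ k : ℕ, k < n → X k n ≤ X (k + 1) n := by
    intro k hk
    have h1 := down k (n - k) (by omega)
    rw [show (n : ℤ) - (n - k : ℕ) = k by omega] at h1
    refine h1.trans ((Pr_slid_succ k n m _ _).le.trans (measureReal_mono ?_ (measure_ne_top _ _)))
    rintro ω ⟨u, hu, v, hv, huR, huv⟩
    have hvR := huv.mem huR
    refine ⟨u, hu, v, ?_, reg_succ k n m huR, huv.mono le_rfl (reg_succ k n m)⟩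
    have hv : (m : ℤ) - k - (if (k : ℤ) < v.2 then 1 else 0) ≤ v.1 := hv
    change (m : ℤ) - (k + 1 : ℕ) - (if (n : ℤ) < v.2 then 1 else 0) ≤ v.1
    push_cast
    split_ifs at hv ⊢ <;> omega
  have all : ∀ k : ℕ, k ≤ n → X 0 n ≤ X k n := by
    intro k hk
    induction k with
    | zero => exact le_rfl
    | succ k ih => exact (ih (by omega)).trans (slide k (by omega))
  have start : hx (triInt p0 0 (1 - p0)) m n ≤ X 0 n := by
    refine (Pr_mono (R' := reg 0 n n m) (A' := {z | z.1 ≤ 0}) (B' := B 0 n) ?_ ?_ ?_).trans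
      (lay_zero n m _ _).le
    · rintro z ⟨h1, h2, h3, h4⟩
      exact ⟨h3, h4, by simp; split_ifs <;> omega, h2⟩
    · intro z (hz : z.1 = 0)
      exact hz.le
    · intro z (hz : z.1 = m)
      change (m : ℤ) - (0 : ℕ) - (if (n : ℤ) < z.2 then 1 else 0) ≤ z.1
      split_ifs <;> simp [hz]
  refine start.trans ((all n le_rfl).trans ?_)
  have hfull := lay_full (p0 := p0) (p1 := p1) (p2 := p2) (n := n) (T := n) (reg_finite n n n m)
    (fun z hz => ⟨hz.1, hz.2.1⟩) {z | z.1 ≤ 0} (B n n)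
  refine hfull.le.trans (measureReal_mono ?_ (measure_ne_top _ _))
  rintro ω ⟨u, hu, v, hv, huR, huv⟩
  have hv : (m : ℤ) - n - (if (n : ℤ) < v.2 then 1 else 0) ≤ v.1 := hv
  rw [if_neg (by have := (huv.mem huR).2.1; omega)] at hv
  obtain ⟨u', v', h1, h2, -, h3, h4⟩ := huv.trim (φ := fun z => z.1) (fun x y h => step_fst h)
    (α := 0) (β := (m - n : ℕ)) (by omega) huR hu (by omega)
  have hsub : reg n n n m ∩ {x | 0 ≤ x.1 ∧ x.1 ≤ (m - n : ℕ)} ⊆ box (m - n) n :=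
    fun z hz => ⟨hz.2.1, hz.2.2, hz.1.1, hz.1.2.1⟩
  exact ⟨u', h1, v', h2, hsub h3, h4.mono le_rfl hsub⟩

/-- Vertical crossings are transported from the square lattice to the triangular lattice. -/
lemma vx_square_le (h : Crit p0 p1 p2) {ε : ℝ} (hε : ε = (1 - p1) * p0 * p2) (hε0 : 0 < ε) {n T : ℕ}
    (hnT : n ≤ T) (m : ℕ) :
    vx (triInt p0 0 (1 - p0)) m T * (1 - ((1 + ε) ^ T)⁻¹ * (ε⁻¹) ^ n * (1 + ε) ^ n) ≤
      vx (triInt p0 p1 p2) (m + n) n := by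
  obtain ⟨hp0, hp1, hp2, -⟩ := id h
  have hε1 : ε ≤ 1 := hε ▸ mul_le_one₀ (mul_le_one₀ (by linarith) hp0.1 hp0.2) hp2.1 hp2.2
  set U := vx (triInt p0 0 (1 - p0)) m T with hU
  have hU0 : 0 ≤ U := Pr_nonneg _ _ _ _
  let u : ℕ → ℤ → ℕ → ℝ := fun k b x =>
    Pr (lay p0 p1 p2 (slid k b)) (reg k b T m) {z | z.2 = 0} {z | z.2 = x}
  have hspr : ∀ (b x : ℤ), x ≠ b → Spr b {z : Z2 | z.2 = x} {z | z.2 = x} := fun b x hx c y (hc : y = x) =>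
    ⟨fun _ => hc, fun hy => absurd (hc.symm.trans hy) hx⟩
  have swap : ∀ (k : ℕ) (b : ℤ) (x : ℕ), (k : ℤ) < b → b ≤ T → (x : ℤ) ≠ b →
      u k b x ≤ u k (b - 1) x := by
    intro k b x hkb hbn hx
    exact lay_swap_le h (swapped_slid hkb) (reg_finite _ _ _ _) (reg_finite _ _ _ _)
      (reg_spr (by omega)) (reg_dnClosed (by omega)) (hspr b 0 (by omega)) (hspr b x hx)
      fun a (ha : b = 0) => by omega
  have swap_row : ∀ (k x : ℕ), k < x → x ≤ T →
      ε * u k x x + (1 - ε) * u k x (x + 1) ≤ u k (x - 1) x := by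
    intro k x hkx hxT
    have := lay_swap_row_le h (swapped_slid (b := x) (k := k) (by omega)) (by omega)
      (reg_finite k _ T m) (reg_finite k _ T m) (reg_spr (by omega)) (reg_dnClosed (by omega))
    rw [← hε] at this
    exact_mod_cast this
  have down : ∀ (k : ℕ) (A : ℝ), 0 ≤ A → 1 ≤ A * (1 + ε) ^ T →
      (∀ x ≤ T, U * (1 - A * (1 + ε) ^ x) ≤ u k T x) → ∀ j : ℕ, k + j ≤ T → ∀ x ≤ T,
      U * (1 - (if x + j ≤ T then A else A * ε⁻¹) * (1 + ε) ^ x) ≤ u k (T - j) x := by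
    intro k A hA0 hAT hstart j
    have hAA : A ≤ A * ε⁻¹ := le_mul_of_one_le_right hA0 (one_le_inv₀ hε0 |>.2 hε1)
    induction j with
    | zero =>
      intro _ x hx
      simpa [hx] using hstart x hx
    | succ j ih =>
      intro hj x hx
      have hxj := ih (by omega) x hx
      have e1 : ((T : ℤ) - j) - 1 = T - (j + 1 : ℕ) := by push_cast; ring
      by_cases hxb : x + j = T
      · rw [if_neg (by omega)]
        have hb : (T : ℤ) - j = x := by omega
        have hs := swap_row k x (by omega) (by omega)
        rw [if_pos (by omega), hb] at hxj
        rw [← e1, hb]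
        rcases Nat.lt_or_ge x T with hxT | hxT
        · have hx1 := ih (by omega) (x + 1) (by omega)
          rw [if_neg (by omega), hb] at hx1
          have t1 := mul_le_mul_of_nonneg_left hxj hε0.le
          have t2 := mul_le_mul_of_nonneg_left hx1 (sub_nonneg.2 hε1)
          have : U * (1 - A * ε⁻¹ * (1 + ε) ^ x) = ε * (U * (1 - A * (1 + ε) ^ x)) +
              (1 - ε) * (U * (1 - A * ε⁻¹ * (1 + ε) ^ (x + 1))) := by
            rw [pow_succ]
            field_simp
            ring
          linarith
        · obtain rfl : x = T := by omega
          refine le_trans ?_ (Pr_nonneg _ _ _ _)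
          refine mul_nonpos_of_nonneg_of_nonpos hU0 ?_
          have := mul_le_mul_of_nonneg_right hAA (by positivity : 0 ≤ (1 + ε) ^ x)
          linarith
      · have hs := swap k (T - j) x (by omega) (by omega) (by omega)
        rw [e1] at hs
        refine le_trans ?_ (hxj.trans hs)
        have : (x + (j + 1) ≤ T) ↔ (x + j ≤ T) := by omega
        simp only [this]
        exact le_rfl
  have slide : ∀ (k : ℕ) (A : ℝ), 0 ≤ A → 1 ≤ A * (1 + ε) ^ T → k < T →
      (∀ x ≤ T, U * (1 - A * (1 + ε) ^ x) ≤ u k T x) →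
      ∀ x ≤ T, U * (1 - A * ε⁻¹ * (1 + ε) ^ x) ≤ u (k + 1) T x := by
    intro k A hA0 hAT hkT hstart x hx
    have hAA : A ≤ A * ε⁻¹ := le_mul_of_one_le_right hA0 (one_le_inv₀ hε0 |>.2 hε1)
    have h1 := down k A hA0 hAT hstart (T - k) (by omega) x hx
    rw [show (T : ℤ) - (T - k : ℕ) = k by omega] at h1
    refine le_trans ?_ (h1.trans ((Pr_slid_succ k T m _ _).le.trans
      (Pr_mono (reg_succ k T m) le_rfl le_rfl)))
    refine mul_le_mul_of_nonneg_left ?_ hU0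
    refine sub_le_sub_left (mul_le_mul_of_nonneg_right ?_ (by positivity)) _
    split_ifs
    · exact hAA
    · exact le_rfl
  have all : ∀ k : ℕ, k ≤ T → ∀ x ≤ T,
      U * (1 - ((1 + ε) ^ T)⁻¹ * (ε⁻¹) ^ k * (1 + ε) ^ x) ≤ u k T x := by
    intro k
    induction k with
    | zero =>
      intro _ x hx
      have h1 : U ≤ u 0 T x := by
        refine le_trans (measureReal_mono ?_ (measure_ne_top _ _)) (lay_zero T m _ _).le
        rintro ω ⟨a, ha, v, hv, haR, hav⟩
        have ha : a.2 = 0 := ha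
        have hv : v.2 = T := hv
        have hsub : box m T ⊆ reg 0 T T m := by
          rintro z ⟨h1, h2, h3, h4⟩
          exact ⟨h3, h4, by simp; split_ifs <;> omega, h2⟩
        obtain ⟨w, hw, hr, -⟩ := hav.symm.last_exit (φ := fun z => -z.2)
          (fun x y h => by have := step_snd h; rw [abs_le] at this ⊢; omega) (hav.mem haR)
          (α := -x) (by omega) (by omega)
        exact ⟨a, ha, w, (by omega : w.2 = x), hsub haR, hav.trans hr |>.mono le_rfl hsub⟩
      refine le_trans (mul_le_of_le_one_right hU0 ?_) h1
      have : 0 ≤ ((1 + ε) ^ T)⁻¹ * (ε⁻¹) ^ 0 * (1 + ε) ^ x := by positivity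
      linarith
    | succ k ih =>
      intro hk
      have h0 : 1 ≤ (ε⁻¹) ^ k := one_le_pow₀ (one_le_inv₀ hε0 |>.2 hε1)
      have := slide k _ (by positivity) ?_ (by omega) (ih (by omega))
      · simpa only [pow_succ, mul_assoc] using this
      · rw [mul_right_comm, inv_mul_cancel₀ (by positivity), one_mul]
        exact h0
  refine (all n hnT n hnT).trans ?_
  let R : Set Z2 := rect (-n) m 0 n
  have h1 : u n T n ≤ Pr (lay p0 p1 p2 (slid n T)) R {z | z.2 = 0} {z | z.2 = n} := by
    refine measureReal_mono ?_ (measure_ne_top _ _)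
    rintro ω ⟨a, ha, v, hv, haR, hav⟩
    have ha : a.2 = 0 := ha
    have hv : v.2 = n := hv
    obtain ⟨u', v', h1, h2, -, h3, h4⟩ := hav.trim (φ := fun z => z.2) (fun x y h => step_snd h)
      (α := 0) (β := n) (by omega) haR ha.le hv.ge
    have hsub : reg n T T m ∩ {x | 0 ≤ x.2 ∧ x.2 ≤ n} ⊆ R := by
      rintro z ⟨⟨g1, g2, g3, g4⟩, g5, g6⟩
      rw [if_neg (by omega)] at g3
      exact ⟨by omega, g4, g5, g6⟩
    exact ⟨u', h1, v', h2, hsub h3, h4.mono le_rfl hsub⟩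
  refine h1.trans ((lay_full (rect_finite _ _ _ _) (fun z hz => ⟨hz.2.2.1, hz.2.2.2⟩) _ _).le.trans ?_)
  refine Pr_shift_le (w := (n, 0)) (tInv_triInt p0 p1 p2 _) (rect_finite _ _ _ _) ?_ ?_ ?_
  · rintro ⟨x, y⟩ ⟨h1, h2, h3, h4⟩
    refine ⟨?_, ?_, ?_, ?_⟩ <;> simp at h1 h2 h3 h4 ⊢ <;> omega
  · rintro ⟨x, y⟩ (hz : y = 0)
    simp [hz]
  · rintro ⟨x, y⟩ (hz : y = n)
    simp [hz]

end Slide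

section Transport

variable {p0 p1 p2 : ℝ}

lemma exists_vx_square_le (h : Crit p0 p1 p2) (h0 : 0 < p0) (h1 : p1 < 1) (h2 : 0 < p2) :
    ∃ C : ℕ, 1 ≤ C ∧ ∀ m n : ℕ,
      vx (triInt p0 0 (1 - p0)) m (C * n) * (1 - (1 / 2) ^ n) ≤ vx (triInt p0 p1 p2) (m + n) n := by
  obtain ⟨ε, hε⟩ : ∃ ε, ε = (1 - p1) * p0 * p2 := ⟨_, rfl⟩
  have hε0 : 0 < ε := hε ▸ mul_pos (mul_pos (by linarith) h0) h2
  obtain ⟨C, hC⟩ := pow_unbounded_of_one_lt (2 * (ε⁻¹ * (1 + ε))) (by linarith : 1 < 1 + ε)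
  refine ⟨C + 1, by omega, fun m n => le_trans ?_
    (vx_square_le h hε hε0 (show n ≤ (C + 1) * n by nlinarith) m)⟩
  refine mul_le_mul_of_nonneg_left (sub_le_sub_left ?_ _) (Pr_nonneg _ _ _ _)
  rw [pow_mul, mul_assoc, ← mul_pow, ← inv_pow, ← mul_pow]
  refine pow_le_pow_left₀ (by positivity) ?_ n
  rw [inv_mul_le_iff₀ (by positivity)]
  have : (1 + ε) ^ C ≤ (1 + ε) ^ (C + 1) := pow_le_pow_right₀ (by linarith) (by omega)
  linarith

lemma Bx.of_square (h : Crit p0 p1 p2) (h0 : 0 < p0) (h1 : p1 < 1) (h2 : 0 < p2)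
    (hV : Bx (triInt p0 0 (1 - p0))) : Bx (triInt p0 p1 p2) := by
  refine HBx.bx (K₀ := 2) (tInv_triInt _ _ _) (fun K => ?_) (by norm_num) ?_
  · obtain ⟨δ, hδ, n₀, hn⟩ := hV (K + 1)
    refine ⟨δ, hδ, n₀, fun n hn' => ?_⟩
    have := hx_square_le h (m := (K + 1) * n) (n := n) (by nlinarith)
    rw [show (K + 1) * n - n = K * n by rw [add_mul, one_mul, Nat.add_sub_cancel]] at this
    exact (hn n hn').1.trans this
  · obtain ⟨C, hC, hle⟩ := exists_vx_square_le h h0 h1 h2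
    obtain ⟨δ, hδ, n₀, hn⟩ := hV C
    refine ⟨δ / 2, by linarith, max n₀ 1, fun n hn' => ?_⟩
    have hv := (hn n (le_of_max_le_left hn')).2
    have := hle n n
    have hp : ((1 : ℝ) / 2) ^ n ≤ 1 / 2 :=
      pow_le_of_le_one (by norm_num) (by norm_num) (by have := le_of_max_le_right hn'; omega)
    rw [two_mul]
    nlinarith

lemma Crit.square (h : Crit p0 p1 p2) : Crit p0 0 (1 - p0) :=
  ⟨h.1, by norm_num, ⟨by linarith [h.1.2], by linarith [h.1.1]⟩, by simp [kappaT]⟩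

lemma Bx.square (h : Crit p0 p1 p2) (h0 : 0 < p0) (h1 : p1 < 1) (h2 : 0 < p2)
    (hS : Bx (triInt p0 p1 p2)) : Bx (triInt p0 0 (1 - p0)) := by
  refine HBx.bx (K₀ := 3) (tInv_triInt _ _ _) (fun k => ?_) (by norm_num) ?_
  · obtain ⟨C, hC, hle⟩ := exists_vx_square_le h h0 h1 h2
    obtain ⟨δ, hδ, n₀, hn⟩ := hS (2 * (2 * C * k + 2))
    obtain ⟨n₁, hn₁⟩ := exists_pow_lt_of_lt_one (half_pos hδ) (by norm_num : (1 / 2 : ℝ) < 1)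
    refine ⟨δ / 2, by linarith, C * (n₀ + n₁ + 2), fun N hN => ?_⟩
    obtain ⟨n, hnN, hNn, hn0⟩ : ∃ n, C * n ≤ N ∧ N ≤ 2 * C * n ∧ n₀ + n₁ + 2 ≤ n := by
      have h3 : n₀ + n₁ + 2 ≤ N / C := (Nat.le_div_iff_mul_le (by omega)).2 (by rwa [mul_comm] at hN)
      have h4 := Nat.div_add_mod N C
      have h5 := Nat.mod_lt N (by omega : C > 0)
      refine ⟨N / C, Nat.mul_div_le N C, ?_, h3⟩
      nlinarith
    have hm : hx (triInt p0 0 (1 - p0)) (2 * C * k * n) (C * n) ≤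
        hx (triInt p0 0 (1 - p0)) (k * N) N :=
      hx_mono (by calc k * N ≤ k * (2 * C * n) := Nat.mul_le_mul_left k hNn
                    _ = 2 * C * k * n := by ring) hnN
    refine le_trans ?_ hm
    have hone := one_le_vx_add_hx h.square (2 * C * k * n) (C * n)
    have hv := hle (2 * C * k * n) n
    obtain ⟨n', rfl⟩ : ∃ n', n = n' + 1 := ⟨n - 1, by omega⟩
    have hd := vx_add_hx_le h (2 * C * k * (n' + 1) + (n' + 1)) n'
    have hx1 := (hn n' (by omega)).1
    have hx2 : hx (triInt p0 p1 p2) (2 * (2 * C * k + 2) * n') n' ≤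
        hx (triInt p0 p1 p2) (2 * C * k * (n' + 1) + (n' + 1) + 1) n' :=
      hx_mono (by nlinarith [Nat.zero_le (2 * C * k), (by omega : 1 ≤ n'),
        Nat.mul_le_mul_left (2 * C * k) (by omega : 1 ≤ n')]) le_rfl
    have hp : ((1 : ℝ) / 2) ^ (n' + 1) ≤ δ / 2 :=
      (pow_le_pow_of_le_one (by norm_num) (by norm_num) (by omega : n₁ ≤ n' + 1)).trans hn₁.le
    have hv0 := Pr_nonneg (triInt p0 0 (1 - p0)) (box (2 * C * k * (n' + 1)) (C * (n' + 1)))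
      {z | z.2 = 0} {z | z.2 = (C * (n' + 1) : ℕ)}
    change 0 ≤ vx (triInt p0 0 (1 - p0)) (2 * C * k * (n' + 1)) (C * (n' + 1)) at hv0
    have hδ1 : δ ≤ 1 := hx1.trans (Pr_le_one _ _ _ _)
    set v := vx (triInt p0 0 (1 - p0)) (2 * C * k * (n' + 1)) (C * (n' + 1))
    have : v * (1 - δ / 2) ≤ 1 - δ := by
      have := mul_le_mul_of_nonneg_left (sub_le_sub_left hp 1) hv0
      linarith
    have : v ≤ 1 - δ / 2 := by
      by_contra hcon
      push Not at hcon
      nlinarith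
    linarith
  · obtain ⟨δ, hδ, n₀, hn⟩ := hS 2
    refine ⟨δ, hδ, max n₀ 1, fun n hn' => ?_⟩
    have hn1 := le_of_max_le_right hn'
    have h3 := (hn n (le_of_max_le_left hn')).2
    have h4 := one_le_vx_add_hx h.square (3 * n) n
    have h5 := hx_square_le h (m := 3 * n) (n := n) (by omega)
    have h6 := vx_add_hx_le h (2 * n - 1) n
    rw [show 3 * n - n = 2 * n - 1 + 1 by omega] at h5
    have h7 : vx (triInt p0 p1 p2) n (2 * n) ≤ vx (triInt p0 p1 p2) (2 * n - 1) (n + 1) :=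
      vx_mono (by omega) (by omega)
    linarith

end Transport

/-! ### Crossings of tubes along chains of points -/

lemma fkg_forall {E : Type} (p : E → ℝ) {A : ℕ → Set (Config E)} (hA : ∀ i, IsUpperSet (A i))
    (fA : ∀ i, Fd (A i)) {δ : ℝ} (hδ : 0 ≤ δ) (h : ∀ i, δ ≤ (bern p).real (A i)) (m : ℕ) :
    IsUpperSet {ω | ∀ i < m, ω ∈ A i} ∧ Fd {ω | ∀ i < m, ω ∈ A i} ∧
      δ ^ m ≤ (bern p).real {ω | ∀ i < m, ω ∈ A i} := by
  induction m with
  | zero =>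
    have : {ω : Config E | ∀ i < 0, ω ∈ A i} = univ := by ext; simp
    rw [this]
    exact ⟨isUpperSet_univ, ⟨∅, fun _ _ _ _ => trivial⟩, by simp⟩
  | succ m ih =>
    have : {ω : Config E | ∀ i < m + 1, ω ∈ A i} = {ω | ∀ i < m, ω ∈ A i} ∩ A m := by
      ext ω
      simp only [mem_ofPred_eq, mem_inter_iff, Nat.lt_succ_iff_lt_or_eq]
      exact ⟨fun h => ⟨fun i hi => h i (Or.inl hi), h m (Or.inr rfl)⟩,
        fun h i hi => hi.elim (h.1 i) fun hi => hi ▸ h.2⟩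
    rw [this]
    refine ⟨ih.1.inter (hA m), ih.2.1.inter (fA m), ?_⟩
    rw [pow_succ]
    exact (mul_le_mul ih.2.2 (h m) hδ measureReal_nonneg).trans
      (bern_fkg p ih.1 (hA m) ih.2.1 (fA m))

/-- The square of radius `r` around `c`. -/
def sqr (c : Z2) (r : ℤ) : Set Z2 := rect (c.1 - r) (c.1 + r) (c.2 - r) (c.2 + r)

/-- The tube of radius `r` around a chain of points. -/
def tube (w : ℕ → Z2) (M : ℕ) (r : ℤ) : Set Z2 := ⋃ i ∈ Iic M, sqr (w i) r

lemma tube_finite (w : ℕ → Z2) (M : ℕ) (r : ℤ) : (tube w M r).Finite :=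
  (finite_Iic M).biUnion fun _ _ => rect_finite _ _ _ _

lemma mem_tube {w : ℕ → Z2} {M : ℕ} {r : ℤ} {z : Z2} :
    z ∈ tube w M r ↔ ∃ i ≤ M, z ∈ sqr (w i) r := by simp [tube]

/-- Consecutive points of the chain are within distance `n`. -/
def Slow (w : ℕ → Z2) (M : ℕ) (n : ℤ) : Prop :=
  ∀ i < M, |(w (i + 1)).1 - (w i).1| ≤ n ∧ |(w (i + 1)).2 - (w i).2| ≤ n

/-- Tubes are crossed with probability bounded below. -/
def Tb (p : TriE → ℝ) : Prop :=
  ∃ C : ℕ, 0 < C ∧ ∀ M : ℕ, ∃ δ : ℝ, 0 < δ ∧ ∃ n₀ : ℕ, ∀ n ≥ n₀, ∀ w : ℕ → Z2, Slow w M n →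
    δ ≤ Pr p (tube w M (C * n)) (sqr (w 0) (C * n)) (sqr (w M) (C * n))

lemma Bx.tb {p : TriE → ℝ} (hp : TInv p) (h : Bx p) : Tb p := by
  refine ⟨3, by norm_num, fun M => ?_⟩
  obtain ⟨δ, hδ, n₀, hn⟩ := h 3
  refine ⟨(δ * δ) ^ (M + 1), by positivity, n₀, fun n hn₀ w hw => ?_⟩
  obtain ⟨h1, h2⟩ := hn (2 * n) (by omega)
  let RH : ℕ → Set Z2 := fun i => rect ((w i).1 - 3 * n) ((w i).1 + 3 * n) ((w i).2 - n) ((w i).2 + n)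
  let RV : ℕ → Set Z2 := fun i => rect ((w i).1 - n) ((w i).1 + n) ((w i).2 - 3 * n) ((w i).2 + 3 * n)
  let H : ℕ → Set (Config TriE) := fun i =>
    {ω | Conn tg ω (RH i) {z | z.1 = (w i).1 - 3 * n} {z | z.1 = (w i).1 + 3 * n}}
  let V : ℕ → Set (Config TriE) := fun i =>
    {ω | Conn tg ω (RV i) {z | z.2 = (w i).2 - 3 * n} {z | z.2 = (w i).2 + 3 * n}}
  have fH : ∀ i, Fd (H i) := fun i => fd_conn (rect_finite _ _ _ _) _ _
  have fV : ∀ i, Fd (V i) := fun i => fd_conn (rect_finite _ _ _ _) _ _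
  have uH : ∀ i, IsUpperSet (H i) := fun i => isUpperSet_conn _ _ _ _
  have uV : ∀ i, IsUpperSet (V i) := fun i => isUpperSet_conn _ _ _ _
  have pH : ∀ i, δ ≤ (bern p).real (H i) := fun i => by
    refine h1.trans ((hx_le_rect hp ((w i).1 - 3 * n) ((w i).2 - n) _ _).trans (Pr_mono ?_ ?_ ?_)) <;>
      intro z hz <;> simp only [RH, rect, mem_ofPred_eq] at hz ⊢ <;> push_cast at hz <;> omega
  have pV : ∀ i, δ ≤ (bern p).real (V i) := fun i => by
    refine h2.trans ((vx_le_rect hp ((w i).1 - n) ((w i).2 - 3 * n) _ _).trans (Pr_mono ?_ ?_ ?_)) <;>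
      intro z hz <;> simp only [RV, rect, mem_ofPred_eq] at hz ⊢ <;> push_cast at hz <;> omega
  refine (fkg_forall p (A := fun i => H i ∩ V i) (fun i => (uH i).inter (uV i))
    (fun i => (fH i).inter (fV i)) (mul_nonneg hδ.le hδ.le)
    (fun i => (mul_le_mul (pH i) (pV i) hδ.le measureReal_nonneg).trans
      (bern_fkg p (uH i) (uV i) (fH i) (fV i))) (M + 1)).2.2.trans (measureReal_mono fun ω hω => ?_)
  have hω : ∀ i < M + 1, ω ∈ H i ∩ V i := hω
  choose! u hu v hv huR huv using fun i hi => (hω i hi).1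
  choose! a ha b hb haR hab using fun i hi => (hω i hi).2
  have hu : ∀ i < M + 1, (u i).1 = (w i).1 - 3 * n := hu
  have hv : ∀ i < M + 1, (v i).1 = (w i).1 + 3 * n := hv
  have ha : ∀ i < M + 1, (a i).2 = (w i).2 - 3 * n := ha
  have hb : ∀ i < M + 1, (b i).2 = (w i).2 + 3 * n := hb
  have hHs : ∀ i, RH i ⊆ sqr (w i) ((3 : ℕ) * n) := fun i z hz => by
    simp only [RH, sqr, rect, mem_ofPred_eq] at hz ⊢; push_cast; omega
  have hVs : ∀ i, RV i ⊆ sqr (w i) ((3 : ℕ) * n) := fun i z hz => by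
    simp only [RV, sqr, rect, mem_ofPred_eq] at hz ⊢; push_cast; omega
  have hH : ∀ i < M + 1, RH i ⊆ tube w M ((3 : ℕ) * n) := fun i hi z hz =>
    mem_tube.2 ⟨i, by omega, hHs i hz⟩
  have hV : ∀ i < M + 1, RV i ⊆ tube w M ((3 : ℕ) * n) := fun i hi z hz =>
    mem_tube.2 ⟨i, by omega, hVs i hz⟩
  have meet : ∀ i < M + 1, ∀ j < M + 1, |(w j).1 - (w i).1| ≤ n → |(w j).2 - (w i).2| ≤ n →
      Rch tg ω (tube w M ((3 : ℕ) * n)) (u i) (a j) := by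
    intro i hi j hj h1 h2
    rw [abs_le] at h1 h2
    obtain ⟨z, hz, hz'⟩ := exists_intersection (x0 := (w j).1 - n) (x1 := (w j).1 + n)
      (y0 := (w i).2 - n) (y1 := (w i).2 + n) (hab j hj) (haR j hj) (fun z hz => ⟨hz.1, hz.2.1⟩)
      ⟨_, fun z hz => hz.2.2.1⟩ (by have := ha j hj; omega) (by have := hb j hj; omega)
      (huv i hi) (huR i hi) (fun z hz => ⟨hz.2.2.1, hz.2.2.2⟩) (by have := hu i hi; omega)
      (by have := hv i hi; omega)
    exact (hz'.mono le_rfl (hH i hi)).trans (hz.mono le_rfl (hV j hj)).symm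
  have key : ∀ j < M + 1, Rch tg ω (tube w M ((3 : ℕ) * n)) (u 0) (u j) := by
    intro j
    induction j with
    | zero => exact fun _ => Rch.refl
    | succ j ih =>
      intro hj
      have hs := hw j (by omega)
      exact ((ih (by omega)).trans (meet j (by omega) (j + 1) hj hs.1 hs.2)).trans
        (meet (j + 1) hj (j + 1) hj (by simp) (by simp)).symm
  exact ⟨u 0, hHs 0 (huR 0 (by omega)), u M, hHs M (huR M (by omega)), hH 0 (by omega)
    (huR 0 (by omega)), key M (by omega)⟩

lemma Tb.bx {p : TriE → ℝ} (h : Tb p) : Bx p := by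
  intro K
  obtain ⟨C, hC, hT⟩ := h
  obtain ⟨δ, hδ, n₀, hn⟩ := hT (4 * (C + 1) * K + 2 * (C + 1))
  refine ⟨δ, hδ, (2 * C + 2) * (n₀ + 1), fun n hn₀ => ?_⟩
  set M := 4 * (C + 1) * K + 2 * (C + 1) with hM
  obtain ⟨s, hs0, hs1, hs2⟩ : ∃ s, n₀ ≤ s ∧ (2 * C + 2) * s ≤ n ∧ n ≤ (4 * C + 4) * s := by
    have h1 := Nat.div_add_mod n (2 * C + 2)
    have h2 := Nat.mod_lt n (show 0 < 2 * C + 2 by omega)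
    have h3 : n₀ + 1 ≤ n / (2 * C + 2) := (Nat.le_div_iff_mul_le (by omega)).2 (by linarith)
    refine ⟨n / (2 * C + 2), by omega, by omega, ?_⟩
    nlinarith
  obtain ⟨m, hm1, hm2⟩ : ∃ m : ℤ, (C * s : ℤ) ≤ m ∧ m + C * s ≤ n := by
    refine ⟨C * s, le_rfl, ?_⟩
    have : ((2 * C + 2) * s : ℤ) ≤ n := by exact_mod_cast hs1
    nlinarith
  have hMs : (K * n : ℤ) + 2 * (C * s) ≤ M * s := by
    have h1 : (n : ℤ) ≤ (4 * C + 4) * s := by exact_mod_cast hs2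
    have h2 : (K : ℤ) * n ≤ K * ((4 * C + 4) * s) := by gcongr
    rw [hM]; push_cast
    nlinarith
  have hs : (0 : ℤ) ≤ s := by positivity
  constructor
  · let w : ℕ → Z2 := fun i => (i * s - C * s, m)
    refine (hn s hs0 w fun i _ => ?_).trans (measureReal_mono fun ω => ?_)
    · simp only [w]; push_cast
      constructor <;> rw [abs_le] <;> constructor <;> linarith
    · rintro ⟨u, hu, v, hv, huR, h⟩
      have hu : u.1 ≤ 0 := by have := hu.2.1; simp [w] at this; linarith
      have hv : (K * n : ℤ) ≤ v.1 := by have := hv.1; simp [w] at this; linarith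
      obtain ⟨u', v', h1, h2, -, h3, h4⟩ := h.trim (φ := Prod.fst) (fun x y h => step_fst h)
        (α := 0) (β := (K * n : ℤ)) (by positivity) huR hu hv
      have hsub : tube w M (C * s) ∩ {x | 0 ≤ x.1 ∧ x.1 ≤ (K * n : ℤ)} ⊆ box (K * n) n := by
        rintro z ⟨hz, hz'⟩
        obtain ⟨i, -, hi⟩ := mem_tube.1 hz
        have h3 := hi.2.2.1; have h4 := hi.2.2.2
        simp only [w] at h3 h4
        simp only [box, mem_ofPred_eq] at hz' ⊢
        push_cast
        exact ⟨hz'.1, hz'.2, by linarith, by linarith⟩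
      exact ⟨u', h1, v', by simpa using h2, hsub h3, h4.mono le_rfl hsub⟩
  · let w : ℕ → Z2 := fun i => (m, i * s - C * s)
    refine (hn s hs0 w fun i _ => ?_).trans (measureReal_mono fun ω => ?_)
    · simp only [w]; push_cast
      constructor <;> rw [abs_le] <;> constructor <;> linarith
    · rintro ⟨u, hu, v, hv, huR, h⟩
      have hu : u.2 ≤ 0 := by have := hu.2.2.2; simp [w] at this; linarith
      have hv : (K * n : ℤ) ≤ v.2 := by have := hv.2.2.1; simp [w] at this; linarith
      obtain ⟨u', v', h1, h2, -, h3, h4⟩ := h.trim (φ := Prod.snd) (fun x y h => step_snd h)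
        (α := 0) (β := (K * n : ℤ)) (by positivity) huR hu hv
      have hsub : tube w M (C * s) ∩ {x | 0 ≤ x.2 ∧ x.2 ≤ (K * n : ℤ)} ⊆ box n (K * n) := by
        rintro z ⟨hz, hz'⟩
        obtain ⟨i, -, hi⟩ := mem_tube.1 hz
        have h3 := hi.1; have h4 := hi.2.1
        simp only [w] at h3 h4
        simp only [box, mem_ofPred_eq] at hz' ⊢
        push_cast
        exact ⟨by linarith, by linarith, hz'.1, hz'.2⟩
      exact ⟨u', h1, v', by simpa using h2, hsub h3, h4.mono le_rfl hsub⟩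

/-- Relabelling by a linear symmetry of the lattice. -/
lemma Tb.relabel {p p' : TriE → ℝ} (h : Tb p) {σ : TriE → TriE} (hσ : Function.Injective σ)
    {s t : Z2 → Z2} (hst : ∀ z, s (t z) = z)
    (hg : ∀ e, tg (σ e) = (s (tg e).1, s (tg e).2) ∨ tg (σ e) = (s (tg e).2, s (tg e).1))
    (hp : ∀ e, p' (σ e) = p e)
    (hs : ∀ (z c : Z2) (r : ℤ), 0 ≤ r → z ∈ sqr c r → s z ∈ sqr (s c) (2 * r))
    (ht : ∀ (z c : Z2) (r : ℤ), 0 ≤ r → z ∈ sqr c r → t z ∈ sqr (t c) (2 * r)) : Tb p' := by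
  obtain ⟨C, hC, hT⟩ := h
  refine ⟨4 * C, by omega, fun M => ?_⟩
  obtain ⟨δ, hδ, n₀, hn⟩ := hT M
  refine ⟨δ, hδ, n₀, fun n hn₀ w hw => (hn (2 * n) (by omega) (fun i => t (w i)) fun i hi => ?_).trans
    (Pr_relabel_le hσ hg hp (tube_finite _ _ _) ?_ ?_ ?_)⟩
  · have h1 := hw i hi
    have h2 := ht (w (i + 1)) (w i) n (by positivity) (by
      simp only [abs_le] at h1
      simp only [sqr, rect, mem_ofPred_eq]; omega)
    simp only [sqr, rect, mem_ofPred_eq] at h2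
    simp only [abs_le]
    push_cast
    omega
  all_goals
    have key : ∀ z i, z ∈ sqr (t (w i)) (C * (2 * n : ℕ)) → s z ∈ sqr (w i) ((4 * C : ℕ) * n) := by
      intro z i hz
      have := hs _ _ _ (by positivity) hz
      rw [hst] at this
      convert this using 2
      push_cast; ring
  · intro z hz
    obtain ⟨i, hi, hz⟩ := mem_tube.1 hz
    exact mem_tube.2 ⟨i, hi, key z i hz⟩
  · exact fun z hz => key z 0 hz
  · exact fun z hz => key z M hz

/-- The reflection exchanging the classes `1` and `2`. -/
def refl12 (e : TriE) : TriE := ![(-e.1 - e.2.1 - 1, e.2.1, 0), (-e.1 - e.2.1 - 1, e.2.1, 2),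
  (-e.1 - e.2.1 - 1, e.2.1, 1)] e.2.2

lemma refl12_refl12 (e : TriE) : refl12 (refl12 e) = e := by
  induction e using tri_induct <;> simp [refl12] <;> omega

lemma Tb.swap12 {p0 p1 p2 : ℝ} (h : Tb (triInt p0 p1 p2)) : Tb (triInt p0 p2 p1) := by
  refine h.relabel (Function.LeftInverse.injective refl12_refl12)
    (s := fun z => (-z.1 - z.2, z.2)) (t := fun z => (-z.1 - z.2, z.2)) (fun z => by simp)
    (fun e => ?_) (fun e => ?_) ?_ ?_
  · induction e using tri_induct <;> simp [refl12] <;> omega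
  · induction e using tri_induct <;> simp [refl12, triInt]
  all_goals
    intro z c r hr hz
    simp only [sqr, rect, mem_ofPred_eq] at hz ⊢; omega

lemma Tb.swap02 {p0 p1 p2 : ℝ} (h : Tb (triInt p0 p1 p2)) : Tb (triInt p2 p1 p0) := by
  refine h.relabel diag_injective (s := Prod.swap) (t := Prod.swap) (fun z => by simp)
    tg_diag (triInt_diag _ _ _) ?_ ?_
  all_goals
    intro z c r hr hz
    simp only [sqr, rect, mem_ofPred_eq, Prod.fst_swap, Prod.snd_swap] at hz ⊢; omega

lemma Tb.swap01 {p0 p1 p2 : ℝ} (h : Tb (triInt p0 p1 p2)) : Tb (triInt p1 p0 p2) :=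
  h.swap12.swap02.swap12

lemma Tb.of_square {p0 p1 p2 : ℝ} (h : Crit p0 p1 p2) (h0 : 0 < p0) (h1 : p1 < 1) (h2 : 0 < p2)
    (hV : Tb (triInt p0 0 (1 - p0))) : Tb (triInt p0 p1 p2) :=
  (Bx.of_square h h0 h1 h2 hV.bx).tb (tInv_triInt _ _ _)

lemma Tb.square {p0 p1 p2 : ℝ} (h : Crit p0 p1 p2) (h0 : 0 < p0) (h1 : p1 < 1) (h2 : 0 < p2)
    (hS : Tb (triInt p0 p1 p2)) : Tb (triInt p0 0 (1 - p0)) :=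
  (Bx.square h h0 h1 h2 hS.bx).tb (tInv_triInt _ _ _)

lemma tb_of_le_half {q r t : ℝ} (h : Crit q r t) (hq0 : 0 < q) (hq : q ≤ 1 / 2) (hr : r < 1)
    (ht : 0 < t) : Tb (triInt q r t) := by
  have h1 : Tb (triInt (1 / 2) 0 (1 - 1 / 2)) := by
    have := bx_half.tb (tInv_triInt _ _ _)
    norm_num at this ⊢
    exact this
  have hden : 0 < 1 - q / 2 := by linarith
  set x := (1 / 2 - q) / (1 - q / 2) with hx
  have hx0 : 0 ≤ x := div_nonneg (by linarith) hden.le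
  have hx1 : x < 1 := (div_lt_one hden).2 (by linarith)
  have hk : kappaT (1 / 2) x q = 0 := by
    have := div_mul_cancel₀ (1 / 2 - q) hden.ne'
    rw [← hx] at this
    rw [kappaT]; linarith
  have hc : Crit (1 / 2) x q := ⟨by norm_num, ⟨hx0, hx1.le⟩, ⟨hq0.le, by linarith⟩, hk⟩
  have h2 : Tb (triInt (1 / 2) x q) := h1.of_square hc (by norm_num) hx1 hq0
  have hc' : Crit q x (1 / 2) := ⟨hc.2.2.1, hc.2.1, hc.1, by rw [← hk, kappaT, kappaT]; ring⟩
  have h3 : Tb (triInt q 0 (1 - q)) := h2.swap02.square hc' hq0 hx1 (by norm_num)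
  exact h3.of_square h hq0 hr ht

/-- Tube crossings at criticality. -/
theorem tb_critical {p0 p1 p2 : ℝ} (h0 : p0 ∈ Ico (0 : ℝ) 1) (h1 : p1 ∈ Ico (0 : ℝ) 1)
    (h2 : p2 ∈ Ico (0 : ℝ) 1) (hκ : kappaT p0 p1 p2 = 0) : Tb (triInt p0 p1 p2) := by
  have key : ∀ q r t : ℝ, q ∈ Ico (0 : ℝ) 1 → r ∈ Ico (0 : ℝ) 1 → t ∈ Ico (0 : ℝ) 1 →
      kappaT q r t = 0 → 0 < q → q ≤ 1 / 2 → Tb (triInt q r t) := by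
    intro q r t hq hr ht hκ hq0 hq2
    rcases ht.1.eq_or_lt with h | h
    · have hr0 : 0 < r := by
        rw [← h, kappaT] at hκ; linarith [hq.2]
      have hc : Crit q t r := ⟨⟨hq.1, hq.2.le⟩, ⟨ht.1, ht.2.le⟩, ⟨hr.1, hr.2.le⟩, by
        rw [← hκ, kappaT, kappaT]; ring⟩
      exact (tb_of_le_half hc hq0 hq2 ht.2 hr0).swap12
    · exact tb_of_le_half ⟨⟨hq.1, hq.2.le⟩, ⟨hr.1, hr.2.le⟩, ⟨ht.1, ht.2.le⟩, hκ⟩ hq0 hq2 hr.2 h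
  have hκ' := hκ
  rw [kappaT] at hκ'
  have a0 := h0.1; have a1 := h1.1; have a2 := h2.1
  by_cases c0 : 0 < p0 ∧ p0 ≤ 1 / 2
  · exact key _ _ _ h0 h1 h2 hκ c0.1 c0.2
  by_cases c1 : 0 < p1 ∧ p1 ≤ 1 / 2
  · exact (key p1 p0 p2 h1 h0 h2 (by rw [← hκ, kappaT, kappaT]; ring) c1.1 c1.2).swap01
  by_cases c2 : 0 < p2 ∧ p2 ≤ 1 / 2
  · exact (key p2 p1 p0 h2 h1 h0 (by rw [← hκ, kappaT, kappaT]; ring) c2.1 c2.2).swap02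
  exfalso
  have d : ∀ x : ℝ, 0 ≤ x → ¬ (0 < x ∧ x ≤ 1 / 2) → x = 0 ∨ 1 / 2 < x := fun x hx h => by
    by_contra hc
    push Not at hc
    exact h ⟨lt_of_le_of_ne hx (Ne.symm hc.1), hc.2⟩
  have b0 := h0.2; have b1 := h1.2; have b2 := h2.2
  rcases d p0 a0 c0 with e0 | e0 <;> rcases d p1 a1 c1 with e1 | e1 <;>
    rcases d p2 a2 c2 with e2 | e2 <;> try (simp only [e0, e1, e2] at hκ'; linarith)
  nlinarith [mul_pos (sub_pos.2 b0) (sub_pos.2 b1), mul_pos (sub_pos.2 b2) (sub_pos.2 b1),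
    mul_pos (sub_pos.2 b0) (sub_pos.2 b2), mul_nonneg (mul_nonneg a0 a1) (sub_nonneg.2 b2.le)]

/-! ### From lattice paths to crossings of Euclidean boxes -/

lemma exists_trim {f : ℝ → ℝ} (hf : Continuous f) {a b : ℝ} (hab : a ≤ b) (h0 : f 0 ≤ a)
    (h1 : b ≤ f 1) : ∃ t₀ t₁, 0 ≤ t₀ ∧ t₀ ≤ t₁ ∧ t₁ ≤ 1 ∧ f t₀ = a ∧ f t₁ = b ∧
      ∀ t ∈ Icc t₀ t₁, a ≤ f t ∧ f t ≤ b := by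
  have hS : IsCompact (Icc (0 : ℝ) 1 ∩ f ⁻¹' Ici b) :=
    isCompact_Icc.inter_right (isClosed_Ici.preimage hf)
  obtain ⟨t₁, ⟨ht₁, hb⟩, hl⟩ := hS.exists_isLeast ⟨1, by simpa using h1⟩
  have hb : b ≤ f t₁ := hb
  have hbe : f t₁ = b := by
    obtain ⟨t, ht, hft⟩ := intermediate_value_Icc ht₁.1 hf.continuousOn ⟨h0.trans hab, hb⟩
    have := hl ⟨⟨ht.1, ht.2.trans ht₁.2⟩, hft.ge⟩
    rwa [le_antisymm ht.2 this] at hft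
  have hT : IsCompact (Icc (0 : ℝ) t₁ ∩ f ⁻¹' Iic a) :=
    isCompact_Icc.inter_right (isClosed_Iic.preimage hf)
  obtain ⟨t₀, ⟨ht₀, ha⟩, hg⟩ := hT.exists_isGreatest ⟨0, by simpa [ht₁.1] using h0⟩
  have ha : f t₀ ≤ a := ha
  have hae : f t₀ = a := by
    obtain ⟨t, ht, hft⟩ := intermediate_value_Icc ht₀.2 hf.continuousOn ⟨ha, hab.trans hb⟩
    have := hg ⟨⟨ht₀.1.trans ht.1, ht.2⟩, hft.le⟩
    rwa [le_antisymm this ht.1] at hft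
  refine ⟨t₀, t₁, ht₀.1, ht₀.2, ht₁.2, hae, hbe, fun t ht => ⟨?_, ?_⟩⟩
  · by_contra! hc
    have := hg ⟨⟨ht₀.1.trans ht.1, ht.2⟩, hc.le⟩
    rw [le_antisymm this ht.1, hae] at hc
    exact hc.false
  · by_contra! hc
    have := hl ⟨⟨ht₀.1.trans ht.1, ht.2.trans ht₁.2⟩, hc.le⟩
    rw [le_antisymm ht.2 this, hbe] at hc
    exact hc.false

lemma JoinedIn.exists_trim {F : Set Pt} {x y : Pt} (h : JoinedIn F x y) {φ : Pt → ℝ}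
    (hφ : Continuous φ) {a b : ℝ} (hab : a ≤ b) (hx : φ x ≤ a) (hy : b ≤ φ y) :
    ∃ γ : ℝ → Pt, Continuous γ ∧ φ (γ 0) = a ∧ φ (γ 1) = b ∧
      ∀ t ∈ Icc (0 : ℝ) 1, γ t ∈ F ∧ a ≤ φ (γ t) ∧ φ (γ t) ≤ b := by
  obtain ⟨γ, hγ⟩ := h
  obtain ⟨t₀, t₁, h0, h01, h1, ha, hb, hab⟩ := Perc.exists_trim (f := fun t => φ (γ.extend t))
    (hφ.comp γ.continuous_extend) hab (by simpa using hx) (by simpa using hy)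
  refine ⟨fun t => γ.extend (t₀ + t * (t₁ - t₀)), γ.continuous_extend.comp (by fun_prop), by simpa,
    by simpa, fun t ht => ⟨?_, hab _ ⟨?_, ?_⟩⟩⟩
  · have hm : t₀ + t * (t₁ - t₀) ∈ Icc (0 : ℝ) 1 := by
      constructor <;> nlinarith [ht.1, ht.2]
    change γ.extend _ ∈ F
    rw [γ.extend_apply hm]
    exact hγ _
  · nlinarith [ht.1]
  · nlinarith [ht.2]

/-- The vertices within distance `r` of a chain of points. -/
def eTube {V : Type} (pos : V → Pt) (w : ℕ → Pt) (M : ℕ) (r : ℝ) : Set V :=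
  {v | ∃ i ≤ M, dist (pos v) (w i) ≤ r}

lemma Rch.joinedIn {E V : Type} {L : LatticeOn E} {g : E → V × V} {pos : V → Pt}
    (hL : ∀ e, L.ends e = (pos (g e).1, pos (g e).2) ∨ L.ends e = (pos (g e).2, pos (g e).1))
    (hd : ∀ e, dist (pos (g e).1) (pos (g e).2) ≤ 2) {ω : Config E} {w : ℕ → Pt} {M : ℕ} {r : ℝ}
    {u v : V} (h : Rch g ω (eTube pos w M r) u v) :
    u = v ∨ JoinedIn ({z | ∃ i ≤ M, dist z (w i) ≤ r + 2} ∩ openEdgeSet L ω) (pos u) (pos v) := by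
  have step : ∀ x y, Step g ω (eTube pos w M r) x y →
      JoinedIn ({z | ∃ i ≤ M, dist z (w i) ≤ r + 2} ∩ openEdgeSet L ω) (pos x) (pos y) := by
    rintro x y ⟨⟨i, hi, hx⟩, -, e, he, hxy⟩
    have hdxy : dist (pos x) (pos y) ≤ 2 := by
      have := hd e
      rcases hxy with hxy | hxy <;> rw [hxy] at this
      · exact this
      · rwa [dist_comm]
    refine JoinedIn.of_segment_subset fun z hz => ⟨⟨i, hi, ?_⟩, ?_⟩
    · have h1 : dist z (pos x) ≤ dist (pos x) (pos y) := by
        have := (convex_closedBall (pos x) (dist (pos x) (pos y))).segment_subset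
          (Metric.mem_closedBall_self dist_nonneg)
          (Metric.mem_closedBall.2 (dist_comm _ _).le) hz
        exact this
      linarith [dist_triangle z (pos x) (w i)]
    · refine mem_biUnion (x := e) he ?_
      rcases hxy with hxy | hxy <;> rcases hL e with hL | hL <;> rw [hL, hxy] <;>
        first | exact hz | (rw [segment_symm]; exact hz)
  refine h.induct (P := fun x => u = x ∨ JoinedIn
    ({z | ∃ i ≤ M, dist z (w i) ≤ r + 2} ∩ openEdgeSet L ω) (pos u) (pos x)) (Or.inl rfl) ?_
  rintro x y - hxy (rfl | hx)
  · exact Or.inr (step _ _ hxy)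
  · exact Or.inr (hx.trans (step _ _ hxy))

/-- Euclidean tubes are crossed with probability bounded below. -/
def ETb {E V : Type} (g : E → V × V) (pos : V → Pt) (p : E → ℝ) : Prop :=
  ∃ C : ℝ, 0 < C ∧ ∀ M : ℕ, ∃ δ : ℝ, 0 < δ ∧ ∃ r₀ : ℝ, ∀ r ≥ r₀, ∀ w : ℕ → Pt,
    (∀ i < M, dist (w (i + 1)) (w i) ≤ r) →
      ∃ A : Set (Config E), IsUpperSet A ∧ Fd A ∧ δ ≤ (bern p).real A ∧
        ∀ ω ∈ A, Conn g ω (eTube pos w M (C * r)) {v | dist (pos v) (w 0) ≤ C * r}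
          {v | dist (pos v) (w M) ≤ C * r}

lemma rot_add (θ : ℝ) (x y : Pt) : rot θ (x + y) = rot θ x + rot θ y := by
  ext <;> simp [rot] <;> ring

lemma rot_rot (θ θ' : ℝ) (x : Pt) : rot θ (rot θ' x) = rot (θ + θ') x := by
  ext <;> simp [rot, Real.cos_add, Real.sin_add] <;> ring

lemma rot_zero (x : Pt) : rot 0 x = x := by ext <;> simp [rot]

lemma continuous_rot (θ : ℝ) : Continuous (rot θ) := by unfold rot; fun_prop

lemma dist_rot_le (θ : ℝ) (x y : Pt) : dist (rot θ x) (rot θ y) ≤ 2 * dist x y := by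
  have key : ∀ c s a b d : ℝ, |c| ≤ 1 → |s| ≤ 1 → |a| ≤ d → |b| ≤ d → |c * a + s * b| ≤ 2 * d := by
    intro c s a b d hc hs ha hb
    calc |c * a + s * b| ≤ |c| * |a| + |s| * |b| := by
          rw [← abs_mul, ← abs_mul]; exact abs_add_le _ _
      _ ≤ 1 * d + 1 * d := by
          gcongr
      _ = 2 * d := by ring
  have h1 : |x.1 - y.1| ≤ dist x y := le_max_left _ _
  have h2 : |x.2 - y.2| ≤ dist x y := le_max_right _ _
  have e1 := key (Real.cos θ) (-Real.sin θ) _ _ _ (Real.abs_cos_le_one θ)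
    (by rw [abs_neg]; exact Real.abs_sin_le_one θ) h1 h2
  have e2 := key (Real.sin θ) (Real.cos θ) _ _ _ (Real.abs_sin_le_one θ) (Real.abs_cos_le_one θ) h1 h2
  refine max_le ?_ ?_ <;> rw [Real.dist_eq] <;> simp only [rot]
  · rwa [show Real.cos θ * x.1 - Real.sin θ * x.2 - (Real.cos θ * y.1 - Real.sin θ * y.2) =
      Real.cos θ * (x.1 - y.1) + -Real.sin θ * (x.2 - y.2) by ring]
  · rwa [show Real.sin θ * x.1 + Real.cos θ * x.2 - (Real.sin θ * y.1 + Real.cos θ * y.2) =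
      Real.sin θ * (x.1 - y.1) + Real.cos θ * (x.2 - y.2) by ring]

lemma IsRotTrans.dist_le {f : Pt → Pt} (hf : IsRotTrans f) (x y : Pt) :
    dist (f x) (f y) ≤ 2 * dist x y := by
  obtain ⟨θ, t, rfl⟩ := hf
  rw [dist_add_right]
  exact dist_rot_le θ x y

lemma IsRotTrans.exists_inverse {f : Pt → Pt} (hf : IsRotTrans f) :
    ∃ h : Pt → Pt, Continuous h ∧ (∀ z, h (f z) = z) ∧ (∀ z, f (h z) = z) ∧
      ∀ x y, dist (h x) (h y) ≤ 2 * dist x y := by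
  obtain ⟨θ, t, rfl⟩ := hf
  refine ⟨fun z => rot (-θ) (z - t), (continuous_rot _).comp (by fun_prop), fun z => ?_, fun z => ?_,
    fun x y => ?_⟩
  · simp [rot_rot, rot_zero]
  · simp [rot_rot, rot_zero]
  · exact (dist_rot_le _ _ _).trans_eq (by rw [dist_sub_right])

lemma IsRotTrans.comp_quarter {f : Pt → Pt} (hf : IsRotTrans f) (c : ℝ) :
    IsRotTrans fun z => f (c - z.2, z.1) := by
  obtain ⟨θ, t, rfl⟩ := hf
  refine ⟨θ + Real.pi / 2, rot θ (c, 0) + t, ?_⟩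
  funext z
  rw [← add_assoc, ← rot_rot, ← rot_add]
  have : ((c - z.2, z.1) : Pt) = rot (Real.pi / 2) z + (c, 0) := by
    ext <;> simp [rot]
    ring
  rw [this]

/-- Crossings of long boxes with positive probability. -/
lemma ETb.crossing {E V : Type} {L : LatticeOn E} {g : E → V × V} {pos : V → Pt} {p : E → ℝ}
    (h : ETb g pos p)
    (hL : ∀ e, L.ends e = (pos (g e).1, pos (g e).2) ∨ L.ends e = (pos (g e).2, pos (g e).1))
    (hd : ∀ e, dist (pos (g e).1) (pos (g e).2) ≤ 2) {l b : ℝ} (hl : 0 < l) (hb : 0 < b) :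
    ∃ δ : ℝ, 0 < δ ∧ ∃ N₀ : ℕ, ∀ N : ℕ, N₀ ≤ N → ∀ f : Pt → Pt, IsRotTrans f →
      ∃ A : Set (Config E), IsUpperSet A ∧ Fd A ∧ δ ≤ (bern p).real A ∧
        ∀ ω ∈ A, CrossingIn L ω (f '' stdRect (l * N) (b * N)) (f '' leftSide (l * N) (b * N))
          (f '' rightSide (l * N) (b * N)) := by
  obtain ⟨C, hC, hT⟩ := h
  obtain ⟨M, hM⟩ := exists_nat_ge (8 * (C + 1) * (l + b) / b)
  obtain ⟨δ, hδ, r₀, hr⟩ := hT M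
  obtain ⟨N₀, hN₀⟩ := exists_nat_ge (max r₀ 2 * (4 * (C + 1)) / b)
  refine ⟨δ, hδ, N₀ + 1, fun N hN f hf => ?_⟩
  have hNpos : (0 : ℝ) < N := by exact_mod_cast (by omega : 0 < N)
  obtain ⟨r, hrdef⟩ : ∃ r, r = b * N / (4 * (C + 1)) := ⟨_, rfl⟩
  have hrm : max r₀ 2 ≤ r := by
    rw [hrdef, le_div_iff₀ (by positivity)]
    rw [div_le_iff₀ hb] at hN₀
    have : (N₀ : ℝ) ≤ N := by exact_mod_cast (by omega : N₀ ≤ N)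
    nlinarith
  have hr2 : 2 ≤ r := (le_max_right _ _).trans hrm
  have hD : 2 * ((C + 1) * r) = b * N / 2 := by
    rw [hrdef]; field_simp; ring
  have hMr : l * N + b * N ≤ M * (r / 2) := by
    rw [div_le_iff₀ hb] at hM
    have h8 : 8 * (C + 1) * (r / 2) = b * N := by linarith
    have : 8 * (C + 1) * (l * N + b * N) ≤ 8 * (C + 1) * (M * (r / 2)) := by
      calc 8 * (C + 1) * (l * N + b * N) = 8 * (C + 1) * (l + b) * N := by ring
        _ ≤ M * b * N := by gcongr
        _ = M * (8 * (C + 1) * (r / 2)) := by rw [h8]; ring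
        _ = _ := by ring
    exact le_of_mul_le_mul_left this (by positivity)
  let c : ℕ → Pt := fun i => (i * (r / 2) - b * N / 2, b * N / 2)
  obtain ⟨h, hh, hhf, hfh, hhd⟩ := hf.exists_inverse
  obtain ⟨A, hAu, hAf, hAδ, hA⟩ := hr r ((le_max_left _ _).trans hrm) (fun i => f (c i)) fun i _ => by
    refine (hf.dist_le _ _).trans ?_
    have : dist (c (i + 1)) (c i) ≤ r / 2 := by
      refine max_le ?_ ?_ <;> rw [Real.dist_eq] <;> simp only [c]
      · rw [abs_le]; push_cast; constructor <;> linarith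
      · rw [sub_self, abs_zero]; linarith
    linarith
  refine ⟨A, hAu, hAf, hAδ, fun ω hω => ?_⟩
  obtain ⟨u, hu, v, hv, -, huv⟩ := hA ω hω
  have near : ∀ z i, dist z (f (c i)) ≤ C * r + 2 →
      |(h z).1 - (c i).1| ≤ b * N / 2 ∧ |(h z).2 - (c i).2| ≤ b * N / 2 := by
    intro z i hz
    have h1 := hhd z (f (c i))
    rw [hhf] at h1
    have h2 : dist (h z) (c i) ≤ b * N / 2 := by rw [← hD]; linarith
    exact ⟨(le_max_left _ _).trans h2, (le_max_right _ _).trans h2⟩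
  have hu1 : (h (pos u)).1 ≤ 0 := by
    have h1 : dist (pos u) (f (c 0)) ≤ C * r := hu
    have h2 := abs_le.1 (near _ 0 (by linarith)).1
    simp only [c, Nat.cast_zero] at h2
    linarith [h2.2]
  have hv1 : l * N ≤ (h (pos v)).1 := by
    have h1 : dist (pos v) (f (c M)) ≤ C * r := hv
    have h2 := abs_le.1 (near _ M (by linarith)).1
    simp only [c] at h2
    linarith [h2.1]
  have hlN : 0 < l * N := by positivity
  rcases huv.joinedIn hL hd with rfl | hj
  · linarith
  obtain ⟨γ, hγ, h0, h1, hγt⟩ := JoinedIn.exists_trim hj (φ := fun z => (h z).1) (by fun_prop) hlN.le hu1 hv1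
  have hy : ∀ t ∈ Icc (0 : ℝ) 1, 0 ≤ (h (γ t)).2 ∧ (h (γ t)).2 ≤ b * N := by
    intro t ht
    obtain ⟨⟨⟨i, hi, hd⟩, -⟩, -⟩ := hγt t ht
    have h2 := abs_le.1 (near _ i hd).2
    simp only [c] at h2
    constructor <;> linarith [h2.1, h2.2]
  have z0 : (0 : ℝ) ∈ Icc (0 : ℝ) 1 := by simp
  have z1 : (1 : ℝ) ∈ Icc (0 : ℝ) 1 := by simp
  exact ⟨γ, hγ.continuousOn, ⟨h (γ 0), ⟨h0, hy 0 z0⟩, hfh _⟩, ⟨h (γ 1), ⟨h1, hy 1 z1⟩, hfh _⟩,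
    fun t ht => ⟨⟨h (γ t), ⟨(hγt t ht).2.1, (hγt t ht).2.2, hy t ht⟩, hfh _⟩, (hγt t ht).1.2⟩⟩

theorem ETb.boxCrossingProperty {E V : Type} {L : LatticeOn E} {g : E → V × V} {pos : V → Pt}
    {p : E → ℝ} (h : ETb g pos p)
    (hL : ∀ e, L.ends e = (pos (g e).1, pos (g e).2) ∨ L.ends e = (pos (g e).2, pos (g e).1))
    (hd : ∀ e, dist (pos (g e).1) (pos (g e).2) ≤ 2) : BoxCrossingProperty L (bern p) := by
  intro α hα
  obtain ⟨δ, hδ, N₀, hN⟩ := h.crossing hL hd hα one_pos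
  obtain ⟨δ', hδ', N₁, hN'⟩ := h.crossing hL hd one_pos hα
  refine ⟨δ * δ', mul_pos hδ hδ', N₀ + N₁, fun N hNN f hf => ?_⟩
  obtain ⟨A, hAu, hAf, hAδ, hA⟩ := hN N (by omega) f hf
  obtain ⟨B, hBu, hBf, hBδ, hB⟩ := hN' N (by omega) _ (hf.comp_quarter (α * N))
  have hprob : δ * δ' ≤ (bern p).real (A ∩ B) :=
    (mul_le_mul hAδ hBδ hδ'.le measureReal_nonneg).trans (bern_fkg p hAu hBu hAf hBf)
  rw [ENNReal.ofReal_le_iff_le_toReal (measure_ne_top _ _)]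
  refine hprob.trans (ENNReal.toReal_mono (measure_ne_top _ _) (measure_mono ?_))
  rintro ω ⟨hωA, hωB⟩
  have h1 := hA ω hωA
  have h2 := hB ω hωB
  rw [one_mul] at h1 h2
  refine ⟨h1, ?_⟩
  obtain ⟨γ, hγ, ⟨z0, hz0, e0⟩, ⟨z1, hz1, e1⟩, hγt⟩ := h2
  refine ⟨γ, hγ, ⟨_, ⟨hz0.1, ?_, ?_⟩, e0⟩, ⟨_, ⟨hz1.1, ?_, ?_⟩, e1⟩, fun t ht => ?_⟩
  · change 0 ≤ α * N - z0.2; linarith [hz0.2.2]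
  · change α * N - z0.2 ≤ α * N; linarith [hz0.2.1]
  · change 0 ≤ α * N - z1.2; linarith [hz1.2.2]
  · change α * N - z1.2 ≤ α * N; linarith [hz1.2.1]
  · obtain ⟨⟨z, hz, e⟩, ho⟩ := hγt t ht
    refine ⟨⟨_, ⟨?_, ?_, hz.1, hz.2.1⟩, e⟩, ho⟩
    · change 0 ≤ α * N - z.2; linarith [hz.2.2.2]
    · change α * N - z.2 ≤ α * N; linarith [hz.2.2.1]

/-! ### Lattice approximation -/

/-- A lattice point close to a point of the plane. -/
noncomputable def lat (z : Pt) : Z2 := (⌊z.1 / √3 - z.2 / 3⌋, ⌊2 / 3 * z.2⌋)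

lemma one_le_sqrt_three : 3 / 2 ≤ √3 := Real.le_sqrt_of_sq_le (by norm_num)

lemma sqrt_three_le : √3 ≤ 7 / 4 := Real.sqrt_le_iff.2 (by norm_num)

lemma dist_tv_le {u : Z2} {z : Pt} {k : ℕ} (h : u ∈ sqr (lat z) k) :
    dist (tv u.1 u.2) z ≤ 3 * (k + 1) := by
  obtain ⟨a, b⟩ := u
  obtain ⟨x, y⟩ := z
  have hs := one_le_sqrt_three
  have hs' := sqrt_three_le
  obtain ⟨ξ, hξ⟩ : ∃ ξ, ξ = x / √3 - y / 3 := ⟨_, rfl⟩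
  obtain ⟨h1, h2, h3, h4⟩ := h
  simp only [lat, ← hξ] at h1 h2 h3 h4
  have hx : x = √3 * (ξ + y / 3) := by rw [hξ]; field_simp; ring
  have f1 := Int.floor_le ξ
  have f2 := Int.lt_floor_add_one ξ
  have f3 := Int.floor_le (2 / 3 * y)
  have f4 := Int.lt_floor_add_one (2 / 3 * y)
  have h1 : ((⌊ξ⌋ : ℤ) : ℝ) - k ≤ a := by exact_mod_cast h1
  have h2 : (a : ℝ) ≤ (⌊ξ⌋ : ℤ) + k := by exact_mod_cast h2
  have h3 : ((⌊2 / 3 * y⌋ : ℤ) : ℝ) - k ≤ b := by exact_mod_cast h3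
  have h4 : (b : ℝ) ≤ (⌊2 / 3 * y⌋ : ℤ) + k := by exact_mod_cast h4
  refine max_le ?_ ?_ <;> rw [Real.dist_eq] <;> simp only [tv]
  · rw [hx, ← mul_sub, abs_mul, abs_of_pos (by linarith)]
    have : |(a : ℝ) + b / 2 - (ξ + y / 3)| ≤ 3 / 2 * (k + 1) := by
      rw [abs_le]; constructor <;> linarith
    nlinarith [abs_nonneg ((a : ℝ) + b / 2 - (ξ + y / 3))]
  · rw [abs_le]; constructor <;> linarith

lemma abs_floor_sub_le {x y r : ℝ} {n : ℕ} (h : |x - y| ≤ r) (hn : r + 1 ≤ n) :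
    |⌊x⌋ - ⌊y⌋| ≤ (n : ℤ) := by
  have f1 := Int.floor_le x
  have f2 := Int.lt_floor_add_one x
  have f3 := Int.floor_le y
  have f4 := Int.lt_floor_add_one y
  rw [abs_le] at h
  have : |((⌊x⌋ - ⌊y⌋ : ℤ) : ℝ)| ≤ n := by
    push_cast; rw [abs_le]; constructor <;> linarith
  exact_mod_cast this

lemma abs_lat_sub_le {x y : Pt} {r : ℝ} {n : ℕ} (h : dist x y ≤ r) (hn : r + 1 ≤ n) :
    |(lat x).1 - (lat y).1| ≤ (n : ℤ) ∧ |(lat x).2 - (lat y).2| ≤ (n : ℤ) := by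
  have h1 : |x.1 - y.1| ≤ r := (le_max_left _ _).trans h
  have h2 : |x.2 - y.2| ≤ r := (le_max_right _ _).trans h
  have hs := one_le_sqrt_three
  have hr : 0 ≤ r := dist_nonneg.trans h
  constructor
  · refine abs_floor_sub_le (r := r) ?_ hn
    have h3 : |(x.1 - y.1) / √3| ≤ 2 / 3 * r := by
      rw [abs_div, abs_of_pos (a := √3) (by linarith), div_le_iff₀ (by linarith)]
      nlinarith
    rw [show x.1 / √3 - x.2 / 3 - (y.1 / √3 - y.2 / 3) = (x.1 - y.1) / √3 - (x.2 - y.2) / 3 by ring]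
    rw [abs_le] at *
    constructor <;> linarith
  · refine abs_floor_sub_le (r := r) ?_ hn
    rw [abs_le] at *
    constructor <;> linarith

/-- Chains of points in the plane are approximated by chains of lattice points. -/
lemma slow_lat {w : ℕ → Pt} {M : ℕ} {r : ℝ} (hw : ∀ i < M, dist (w (i + 1)) (w i) ≤ r) {n : ℕ}
    (hn : r + 1 ≤ n) : Slow (fun i => lat (w i)) M n :=
  fun i hi => abs_lat_sub_le (hw i hi) hn

lemma exists_scale {r : ℝ} {n₀ : ℕ} (hr : (n₀ : ℝ) + 2 ≤ r) : ∃ n ≥ n₀, r + 1 ≤ n ∧ (n : ℝ) ≤ 2 * r := by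
  have h1 := Nat.le_ceil (r + 1)
  have h2 := Nat.ceil_lt_add_one (show 0 ≤ r + 1 by
    have : (0 : ℝ) ≤ n₀ := by positivity
    linarith)
  have h3 : (0 : ℝ) ≤ n₀ := by positivity
  refine ⟨⌈r + 1⌉₊, ?_, h1, by linarith⟩
  have : (n₀ : ℝ) ≤ ⌈r + 1⌉₊ := by linarith
  exact_mod_cast this

lemma Tb.eTb {p : TriE → ℝ} (h : Tb p) : ETb tg (fun z => tv z.1 z.2) p := by
  obtain ⟨C, hC, hT⟩ := h
  refine ⟨6 * C + 3, by positivity, fun M => ?_⟩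
  obtain ⟨δ, hδ, n₀, hn⟩ := hT M
  refine ⟨δ, hδ, n₀ + 2, fun r hr w hw => ?_⟩
  obtain ⟨n, hnn, hrn, hn2⟩ := exists_scale hr
  refine ⟨_, isUpperSet_conn _ _ _ _, fd_conn (tube_finite _ _ _) _ _,
    hn n hnn (fun i => lat (w i)) (slow_lat hw hrn), fun ω hω => ?_⟩
  have key : ∀ z i, z ∈ sqr (lat (w i)) (C * n) → dist (tv z.1 z.2) (w i) ≤ (6 * C + 3) * r := by
    intro z i hz
    have h1 := dist_tv_le (k := C * n) (by exact_mod_cast hz)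
    have h2 : (C : ℝ) * n ≤ C * (2 * r) := by gcongr
    have h3 : (1 : ℝ) ≤ r := by
      have : (0 : ℝ) ≤ n₀ := by positivity
      linarith
    push_cast at h1
    linarith
  refine Conn.mono le_rfl ?_ (fun z hz => key z 0 hz) (fun z hz => key z M hz) hω
  intro z hz
  obtain ⟨i, hi, hz⟩ := mem_tube.1 hz
  exact ⟨i, hi, key z i hz⟩

/-- The position of the vertices of the hexagonal lattice. -/
noncomputable def hpos (x : HV) : Pt := if x.2 then hup x.1.1 x.1.2 else hdown x.1.1 x.1.2

lemma dist_hpos_le {u : Z2} {s : Bool} {z : Pt} {k : ℕ} (h : u ∈ sqr (lat z) k) :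
    dist (hpos (u, s)) z ≤ 3 * (k + 2) := by
  have h1 := dist_tv_le h
  have h2 : dist (hpos (u, s)) (tv u.1 u.2) ≤ 1 := by
    have hs := one_le_sqrt_three
    have hs' := sqrt_three_le
    refine max_le ?_ ?_ <;> rw [Real.dist_eq] <;> cases s <;> simp only [hpos, tv, hup, hdown] <;>
      simp only [if_true, Bool.false_eq_true, if_false] <;> ring_nf <;> rw [abs_le] <;>
      constructor <;> linarith
  linarith [dist_triangle (hpos (u, s)) (tv u.1 u.2) z]

lemma hexTri_mono {η η' : Config TriE} (h : η ≤ η') : hexTri η ≤ hexTri η' := by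
  rintro ⟨a, b, i⟩
  simp only [hexTri, flip, stUp_apply]
  have h1 := h (-a, -b - 1, i + 1)
  have h2 := h (-a, -b - 1, i + 2)
  revert h1 h2
  cases η (-a, -b - 1, i + 1) <;> cases η (-a, -b - 1, i + 2) <;>
    cases η' (-a, -b - 1, i + 1) <;> cases η' (-a, -b - 1, i + 2) <;> simp

lemma Tb.eTb_hex {p0 p1 p2 : ℝ} (hc : Crit p0 p1 p2) (h : Tb (triInt p0 p1 p2)) :
    ETb hg hpos (triInt (1 - p0) (1 - p1) (1 - p2)) := by
  obtain ⟨C, hC, hT⟩ := h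
  refine ⟨6 * C + 9, by positivity, fun M => ?_⟩
  obtain ⟨δ, hδ, n₀, hn⟩ := hT M
  refine ⟨δ, hδ, n₀ + 2, fun r hr w hw => ?_⟩
  obtain ⟨n, hnn, hrn, hn2⟩ := exists_scale hr
  have hslow : Slow (fun i => dnPt (lat (w i))) M n := fun i hi => by
    have := slow_lat hw hrn i hi
    simp only [dnPt, abs_le] at this ⊢
    omega
  set A := {ω : Config TriE | Conn tg ω (tube (fun i => dnPt (lat (w i))) M (C * n))
    (sqr (dnPt (lat (w 0))) (C * n)) (sqr (dnPt (lat (w M))) (C * n))} with hA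
  have hAu : IsUpperSet A := isUpperSet_conn _ _ _ _
  have hAf : Fd A := fd_conn (tube_finite _ _ _) _ _
  refine ⟨{η | hexTri η ∈ A}, fun η η' h hη => hAu (hexTri_mono h) hη, fd_hexTri hAf, ?_, fun η hη => ?_⟩
  · rw [bern_hexTri hc hAf.measurableSet]
    exact (hn n hnn _ hslow).trans (measureReal_mono fun ω hω => hAu (le_clUp ω) hω)
  have key : ∀ z s i, z ∈ sqr (lat (w i)) (C * n + 1) → dist (hpos (z, s)) (w i) ≤ (6 * C + 9) * r := by
    intro z s i hz
    have h1 := dist_hpos_le (s := s) (k := C * n + 1) (by exact_mod_cast hz)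
    have h2 : (C : ℝ) * n ≤ C * (2 * r) := by gcongr
    have h3 : (1 : ℝ) ≤ r := by
      have : (0 : ℝ) ≤ n₀ := by positivity
      linarith
    push_cast at h1
    linarith
  have hdn : ∀ z c : Z2, z ∈ sqr (dnPt c) (C * n) → dnPt z ∈ sqr c (C * n + 1) := by
    intro z c hz
    simp only [sqr, rect, dnPt, mem_ofPred_eq] at hz ⊢
    omega
  obtain ⟨u, hu, v, hv, huR, huv⟩ := hη
  have hR : ∀ z ∈ tube (fun i => dnPt (lat (w i))) M (C * n),
      (dnPt z, false) ∈ eTube hpos w M ((6 * C + 9) * r) := by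
    intro z hz
    obtain ⟨i, hi, hz⟩ := mem_tube.1 hz
    exact ⟨i, hi, key _ _ _ (hdn _ _ hz)⟩
  refine ⟨(dnPt u, false), key _ _ _ (hdn _ _ hu), (dnPt v, false), key _ _ _ (hdn _ _ hv), hR u huR,
    huv.of_hexTri hR fun e he _ => ?_⟩
  obtain ⟨i, hi, hz⟩ := mem_tube.1 he
  refine ⟨i, hi, key _ _ _ ?_⟩
  induction e using tri_induct <;>
    simp only [tg_zero, tg_one, tg_two, sqr, rect, dnPt, mem_ofPred_eq] at hz ⊢ <;> omega

lemma triLattice_ends (e : TriE) :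
    triLattice.ends e = (tv (tg e).1.1 (tg e).1.2, tv (tg e).2.1 (tg e).2.2) := by
  induction e using tri_induct <;> simp [triLattice]

lemma dist_tg_le (e : TriE) : dist (tv (tg e).1.1 (tg e).1.2) (tv (tg e).2.1 (tg e).2.2) ≤ 2 := by
  have hs := one_le_sqrt_three
  have hs' := sqrt_three_le
  refine max_le ?_ ?_ <;> rw [Real.dist_eq] <;> induction e using tri_induct <;>
    simp only [tg_zero, tg_one, tg_two, tv] <;> push_cast <;> ring_nf <;> rw [abs_le] <;>
    constructor <;> linarith

lemma hexLattice_ends (e : TriE) : hexLattice.ends e = (hpos (hg e).1, hpos (hg e).2) ∨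
    hexLattice.ends e = (hpos (hg e).2, hpos (hg e).1) := by
  induction e using tri_induct <;> simp [hexLattice, hpos]

lemma dist_hg_le (e : TriE) : dist (hpos (hg e).1) (hpos (hg e).2) ≤ 2 := by
  have hs := one_le_sqrt_three
  have hs' := sqrt_three_le
  refine max_le ?_ ?_ <;> rw [Real.dist_eq] <;> induction e using tri_induct <;>
    simp only [hg_zero, hg_one, hg_two, hpos, hup, hdown] <;>
    simp only [if_true, Bool.false_eq_true, if_false] <;> push_cast <;> ring_nf <;>
    rw [abs_le] <;> constructor <;> linarith

/-- If `(p0,p1,p2) ∈ [0,1)³` satisfies `κ_△(p) = 0`, then both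
`P^△_p` on the triangular lattice and `P^⬡_{1-p}` on the hexagonal lattice have the
box-crossing property. -/
theorem tri_hex_box_crossing (p0 p1 p2 : ℝ)
    (h0 : p0 ∈ Set.Ico (0 : ℝ) 1) (h1 : p1 ∈ Set.Ico (0 : ℝ) 1) (h2 : p2 ∈ Set.Ico (0 : ℝ) 1)
    (hκ : kappaT p0 p1 p2 = 0) :
    (∀ P : Measure (Config TriE),
      IsBernoulliProduct (triInt p0 p1 p2) P → BoxCrossingProperty triLattice P) ∧
    (∀ P : Measure (Config TriE),
      IsBernoulliProduct (triInt (1 - p0) (1 - p1) (1 - p2)) P →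
        BoxCrossingProperty hexLattice P) := by
  have hc : Crit p0 p1 p2 := ⟨⟨h0.1, h0.2.le⟩, ⟨h1.1, h1.2.le⟩, ⟨h2.1, h2.2.le⟩, hκ⟩
  have hT := tb_critical h0 h1 h2 hκ
  refine ⟨fun P hP => ?_, fun P hP => ?_⟩
  · rw [hP.eq_bern hc.triInt_mem]
    exact hT.eTb.boxCrossingProperty (fun e => Or.inl (triLattice_ends e)) dist_tg_le
  · rw [hP.eq_bern fun e => by
      rw [triInt_compl]
      have := hc.triInt_mem e
      constructor <;> linarith [this.1, this.2]]
    exact (hT.eTb_hex hc).boxCrossingProperty hexLattice_ends dist_hg_le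

end Perc
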